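/- Let G = (I, J, {A_i}, {B_j}, μ, V) be an arbitrary (possibly degenerate) projection game, and let c be a commuting operator correlation for G with w_G(c) ≥ 1 − ε. Let L = max_{(i,j) : μ(i,j)>0} μ(i)/μ(i,j), where μ(i) = Σ_j μ(i,j). Then there exists a tracial correlation c′ for G — i.e. a complex Hilbert space K, a unit vector ξ, and PVMs {r^i_a}, {r^j_b} of orthogonal projections on K with ⟨ξ, x y ξ⟩ = ⟨ξ, y x ξ⟩ for all x, y in the unital *-subalgebra generated by all these projections, and c′(a,b|i,j) = ⟨ξ, r^i_a r^j_b ξ⟩ — such that w_G(c′) ≥ 1 − 148(Lε)^{1/4}. -/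

import Mathlib

section
open scoped InnerProductSpace
open Filter Topology

/-- In a real Hilbert space, a functional which on a subspace is dominated by the support function
of a bounded complete convex subset of that subspace is represented on it by a point of the set. -/
theorem exists_mem_inner_eq_of_inner_le_support {E : Type*} [NormedAddCommGroup E]
    [InnerProductSpace ℝ E] [CompleteSpace E] (L : Submodule ℝ E) {B : Set E} (hB : IsComplete B)
    (hconv : Convex ℝ B) (hne : B.Nonempty) (hBL : B ⊆ L) {R : ℝ} (hR : ∀ w ∈ B, ‖w‖ ≤ R) (t : E)
    (ht : ∀ v ∈ L, ∀ e > 0, ∃ w ∈ B, ⟪v, t⟫_ℝ ≤ ⟪v, w⟫_ℝ + e) :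
    ∃ b ∈ B, ∀ v ∈ L, ⟪v, t⟫_ℝ = ⟪v, b⟫_ℝ := by
  set V := L.topologicalClosure
  have hLV : L ≤ V := L.le_topologicalClosure
  set t₁ : E := V.starProjection t
  have ht₁ : ∀ v ∈ L, ⟪v, t⟫_ℝ = ⟪v, t₁⟫_ℝ := fun v hv => by
    have := V.starProjection_inner_eq_zero t v (hLV hv)
    rw [real_inner_comm, inner_sub_right] at this
    simp only [t₁]; linarith
  obtain ⟨b, hb, hmin⟩ := exists_norm_eq_iInf_of_complete_convex hne hB hconv t₁
  rw [norm_eq_iInf_iff_real_inner_le_zero hconv hb] at hmin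
  have hd : t₁ - b ∈ V := V.sub_mem (V.starProjection_apply_mem t) (hLV (hBL hb))
  have key : ∀ v ∈ L, ⟪v, t₁ - b⟫_ℝ ≤ 2 * R * ‖v - (t₁ - b)‖ := by
    intro v hv
    refine le_of_forall_pos_le_add fun e he => ?_
    obtain ⟨w, hw, hle⟩ := ht v hv e he
    rw [ht₁ v hv] at hle
    have h1 := hmin w hw
    have h2 : ⟪v - (t₁ - b), w - b⟫_ℝ ≤ ‖v - (t₁ - b)‖ * (R + R) :=
      (real_inner_le_norm _ _).trans (mul_le_mul_of_nonneg_left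
        ((norm_sub_le _ _).trans (add_le_add (hR w hw) (hR b hb))) (norm_nonneg _))
    have h3 : ⟪v, w - b⟫_ℝ = ⟪v - (t₁ - b), w - b⟫_ℝ + ⟪t₁ - b, w - b⟫_ℝ := by
      rw [← inner_add_left]; simp
    rw [inner_sub_right] at h3 ⊢
    linarith
  have hzero : ‖t₁ - b‖ ^ 2 ≤ 0 := by
    have hcl : t₁ - b ∈ closure (L : Set E) := hd
    have : ∀ v ∈ closure (L : Set E), ⟪v, t₁ - b⟫_ℝ ≤ 2 * R * ‖v - (t₁ - b)‖ := by
      intro v hv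
      refine closure_minimal (t := {v | ⟪v, t₁ - b⟫_ℝ ≤ 2 * R * ‖v - (t₁ - b)‖}) key ?_ hv
      exact isClosed_le (by fun_prop) (by fun_prop)
    have := this _ hcl
    simpa using this
  have : t₁ - b = 0 := by simpa using hzero
  exact ⟨b, hb, fun v hv => by rw [ht₁ v hv, sub_eq_zero.1 this]⟩

theorem re_inner_self_complex {E : Type*} [SeminormedAddCommGroup E] [InnerProductSpace ℂ E]
    (x : E) : (⟪x, x⟫_ℂ).re = ‖x‖ ^ 2 :=
  inner_self_eq_norm_sq (𝕜 := ℂ) x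

variable {H : Type*} [NormedAddCommGroup H] [InnerProductSpace ℂ H] [CompleteSpace H]

/-- `M` is the commutant of the ⋆-algebra `N` and `ψ` is cyclic for both. -/
structure IsCyclicPair (N M : StarSubalgebra ℂ (H →L[ℂ] H)) (ψ : H) : Prop where
  mem_iff : ∀ x, x ∈ M ↔ ∀ y ∈ N, Commute x y
  dense_left : DenseRange fun y : N => (y : H →L[ℂ] H) ψ
  dense_right : DenseRange fun x : M => (x : H →L[ℂ] H) ψ

namespace IsCyclicPair
variable {N M : StarSubalgebra ℂ (H →L[ℂ] H)} {ψ : H}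

/-- A sequence of uniformly bounded elements of the commutant which converges, together with the
adjoints, on the cyclic vector, has a limit in the commutant. -/
theorem exists_limit (h : IsCyclicPair N M ψ) {k : ℝ} {x : ℕ → H →L[ℂ] H} (hx : ∀ n, x n ∈ M)
    (hk : ∀ n, ‖x n‖ ≤ k) {u v : H} (hu : Tendsto (fun n => x n ψ) atTop (𝓝 u))
    (hv : Tendsto (fun n => star (x n) ψ) atTop (𝓝 v)) :
    ∃ y ∈ M, ‖y‖ ≤ k ∧ y ψ = u ∧ star y ψ = v := by
  have hk0 : 0 ≤ k := (norm_nonneg _).trans (hk 0)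
  have cauchy : ∀ (z : ℕ → H →L[ℂ] H), (∀ n, z n ∈ M) → (∀ n, ‖z n‖ ≤ k) → ∀ w,
      Tendsto (fun n => z n ψ) atTop (𝓝 w) →
      ∃ g : H →L[ℂ] H, (∀ ζ, Tendsto (fun n => z n ζ) atTop (𝓝 (g ζ))) := by
    intro z hz hzk w hw
    have hc : ∀ ζ, CauchySeq fun n => z n ζ := by
      intro ζ
      rw [Metric.cauchySeq_iff']
      intro e he
      obtain ⟨y, hy⟩ := h.dense_left.exists_dist_lt ζ (show 0 < e / (4 * (k + 1)) by positivity)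
      have hconv : Tendsto (fun n => z n ((y : H →L[ℂ] H) ψ)) atTop
          (𝓝 ((y : H →L[ℂ] H) w)) := by
        have : (fun n => z n ((y : H →L[ℂ] H) ψ)) = fun n => (y : H →L[ℂ] H) (z n ψ) := by
          ext n
          exact DFunLike.congr_fun ((h.mem_iff _).1 (hz n) y y.2).eq ψ
        rw [this]
        exact ((y : H →L[ℂ] H).continuous.tendsto _).comp hw
      obtain ⟨n₀, hn₀⟩ := Metric.cauchySeq_iff'.1 hconv.cauchySeq (e / 2) (by positivity)
      refine ⟨n₀, fun n hn => ?_⟩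
      have h1 := hn₀ n hn
      have hb : ∀ m, dist (z m ζ) (z m ((y : H →L[ℂ] H) ψ)) ≤ e / 4 := fun m => by
        rw [dist_eq_norm, ← map_sub]
        refine ((z m).le_opNorm _).trans ?_
        rw [dist_eq_norm] at hy
        calc ‖z m‖ * ‖ζ - (y : H →L[ℂ] H) ψ‖ ≤ (k + 1) * (e / (4 * (k + 1))) := by
              gcongr
              exact (hzk m).trans (by linarith)
          _ = e / 4 := by field_simp
      have h2 := hb n
      have h3 := hb n₀
      have h4 := dist_triangle4 (z n ζ) (z n ((y : H →L[ℂ] H) ψ)) (z n₀ ((y : H →L[ℂ] H) ψ))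
        (z n₀ ζ)
      rw [dist_comm (z n₀ _)] at h4
      linarith
    choose f hf using fun ζ => cauchySeq_tendsto_of_complete (hc ζ)
    exact ⟨continuousLinearMapOfTendsto z (tendsto_pi_nhds.2 hf), hf⟩
  obtain ⟨y, hy⟩ := cauchy x hx hk u hu
  obtain ⟨y', hy'⟩ := cauchy (fun n => star (x n)) (fun n => star_mem (hx n))
    (fun n => by rw [norm_star]; exact hk n) v hv
  have hstar : star y = y' := by
    rw [ContinuousLinearMap.star_eq_adjoint]
    symm
    rw [ContinuousLinearMap.eq_adjoint_iff]
    intro a b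
    refine tendsto_nhds_unique ((hy' a).inner tendsto_const_nhds)
      ((tendsto_const_nhds (x := a)).inner (hy b) |>.congr fun n => ?_)
    rw [ContinuousLinearMap.star_eq_adjoint, ContinuousLinearMap.adjoint_inner_left]
  refine ⟨y, (h.mem_iff y).2 fun m hm => ?_, ?_, tendsto_nhds_unique (hy ψ) hu, ?_⟩
  · ext ζ
    refine tendsto_nhds_unique (hy (m ζ)) (((m.continuous.tendsto _).comp (hy ζ)).congr fun n => ?_)
    exact (DFunLike.congr_fun ((h.mem_iff _).1 (hx n) m hm).eq ζ).symm
  · refine y.opNorm_le_bound hk0 fun ζ =>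
      le_of_tendsto (hy ζ).norm (Eventually.of_forall fun n => ?_)
    exact (x n).le_of_opNorm_le (hk n) ζ
  · rw [hstar]; exact tendsto_nhds_unique (hy' ψ) hv

end IsCyclicPair

/-- Smoothed polar decomposition `z = f g²` with `‖f‖ ≤ 1`. -/
theorem ContinuousLinearMap.exists_approx_polar (z : H →L[ℂ] H) {e : ℝ} (he : 0 < e) :
    ∃ f g : H →L[ℂ] H, IsSelfAdjoint g ∧ ‖f‖ ≤ 1 ∧ z = f * (g * g) ∧
      g * g ≤ star z * f + e • 1 ∧
      ∀ y, Commute z y → Commute (star z) y → Commute f y ∧ Commute g y := by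
  have ha : IsSelfAdjoint (star z * z) := IsSelfAdjoint.star_mul_self z
  have hnn : ∀ t ∈ spectrum ℝ (star z * z), 0 ≤ t := fun t ht =>
    spectrum_nonneg_of_nonneg (star_mul_self_nonneg z) ht
  have hpos : ∀ t ∈ spectrum ℝ (star z * z), 0 < t + e ^ 2 := fun t ht => by
    have := hnn t ht; positivity
  set φ : ℝ → ℝ := fun t => (√(t + e ^ 2))⁻¹
  set ρ : ℝ → ℝ := fun t => √√(t + e ^ 2)
  have hφ : ContinuousOn φ (spectrum ℝ (star z * z)) :=
    ContinuousOn.inv₀ (by fun_prop) fun t ht => (Real.sqrt_pos.2 (hpos t ht)).ne'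
  have hρ : ContinuousOn ρ (spectrum ℝ (star z * z)) := by fun_prop
  have hρρ : cfc ρ (star z * z) * cfc ρ (star z * z) =
      cfc (fun t => √(t + e ^ 2)) (star z * z) := by
    rw [← cfc_mul ρ ρ (star z * z) hρ hρ]
    exact cfc_congr fun t _ => Real.mul_self_sqrt (Real.sqrt_nonneg _)
  have hmul : cfc φ (star z * z) * (cfc ρ (star z * z) * cfc ρ (star z * z)) = 1 := by
    rw [hρρ, ← cfc_mul φ _ (star z * z) hφ (by fun_prop), ← cfc_one ℝ (star z * z)]
    exact cfc_congr fun t ht => inv_mul_cancel₀ (Real.sqrt_pos.2 (hpos t ht)).ne'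
  have haφ : star z * (z * cfc φ (star z * z)) = cfc (fun t => t * φ t) (star z * z) := by
    rw [cfc_mul (fun t => t) φ (star z * z) (by fun_prop) hφ, cfc_id' ℝ (star z * z), mul_assoc]
  refine ⟨z * cfc φ (star z * z), cfc ρ (star z * z), cfc_predicate _ _, ?_, ?_, ?_, ?_⟩
  · have h1 : star (z * cfc φ (star z * z)) * (z * cfc φ (star z * z)) =
        cfc (fun t => φ t * (t * φ t)) (star z * z) := by
      rw [cfc_mul φ (fun t => t * φ t) (star z * z) hφ (by fun_prop), ← haφ, star_mul,
        (cfc_predicate φ (star z * z)).star_eq, mul_assoc]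
    have h2 : ‖z * cfc φ (star z * z)‖ * ‖z * cfc φ (star z * z)‖ ≤ 1 := by
      rw [← CStarRing.norm_star_mul_self, h1]
      refine norm_cfc_le zero_le_one fun t ht => ?_
      have h0 := hnn t ht
      have : φ t * (t * φ t) = t / (t + e ^ 2) := by
        simp only [φ]
        have := Real.mul_self_sqrt (hpos t ht).le
        have := (Real.sqrt_pos.2 (hpos t ht)).ne'
        field_simp
        rw [Real.sq_sqrt (hpos t ht).le]
      rw [this, Real.norm_of_nonneg (by positivity), div_le_one (hpos t ht)]
      nlinarith
    nlinarith [norm_nonneg (z * cfc φ (star z * z))]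
  · rw [mul_assoc, hmul, mul_one]
  · rw [hρρ, haφ]
    have : (e • 1 : H →L[ℂ] H) = cfc (fun _ => e) (star z * z) := by
      rw [cfc_const e (star z * z), Algebra.algebraMap_eq_smul_one]
    rw [this, ← cfc_add ..]
    refine cfc_mono fun t ht => ?_
    have h0 := Real.sqrt_pos.2 (hpos t ht)
    have h1 := Real.mul_self_sqrt (hpos t ht).le
    have h2 : e ≤ √(t + e ^ 2) := Real.le_sqrt_of_sq_le (by linarith [hnn t ht])
    simp only [φ]
    rw [← div_eq_mul_inv, ← sub_le_iff_le_add, le_div_iff₀ h0]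
    nlinarith
  · intro y hy hy'
    have : Commute (star z * z) y := hy'.mul_left hy
    exact ⟨hy.mul_left (this.cfc_real φ), this.cfc_real ρ⟩

theorem inner_apply_left_eq_star (s : H →L[ℂ] H) (a b : H) : ⟪s a, b⟫_ℂ = ⟪a, star s b⟫_ℂ := by
  rw [ContinuousLinearMap.star_eq_adjoint, ContinuousLinearMap.adjoint_inner_right]

namespace IsCyclicPair
variable {N M : StarSubalgebra ℂ (H →L[ℂ] H)} {ψ : H}

theorem re_inner_le_support (h : IsCyclicPair N M ψ) {x' z : H →L[ℂ] H} (hx' : x' ∈ N) (hz : z ∈ M)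
    {l : ℝ} (hl : 0 < l) {e : ℝ} (he : 0 < e) :
    ∃ f ∈ M, ‖f‖ ≤ 1 ∧ (⟪z ψ, x' ψ⟫_ℂ).re ≤ ‖x'‖ / (2 * √l) *
      (l * (⟪z ψ, f ψ⟫_ℂ).re + (⟪star z ψ, star f ψ⟫_ℂ).re + l * e * ‖ψ‖ ^ 2) := by
  obtain ⟨f, g, hg, hf1, hzf, hgg, hcomm⟩ := z.exists_approx_polar he
  have hc := fun y hy => hcomm y ((h.mem_iff _).1 hz y hy) ((h.mem_iff _).1 (star_mem hz) y hy)
  have hf : f ∈ M := (h.mem_iff _).2 fun y hy => (hc y hy).1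
  have hgadj : ∀ a b, ⟪g a, b⟫_ℂ = ⟪a, g b⟫_ℂ := fun a b => hg.isSymmetric a b
  have hadj := @inner_apply_left_eq_star H _ _ _
  refine ⟨f, hf, hf1, ?_⟩
  have hα : ‖g ψ‖ ^ 2 ≤ (⟪z ψ, f ψ⟫_ℂ).re + e * ‖ψ‖ ^ 2 := by
    have := ((ContinuousLinearMap.le_def _ _).1 hgg).re_inner_nonneg_right ψ
    simp only [sub_apply, add_apply, inner_sub_right,
      inner_add_right, mul_apply_eq_comp, ← hadj, ← hgadj] at this
    simp only [smul_apply, one_apply_eq_self, map_sub, map_add,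
      RCLike.re_to_complex] at this
    rw [← Complex.coe_smul, inner_smul_right, Complex.re_ofReal_mul, hgadj (g ψ),
      re_inner_self_complex, re_inner_self_complex] at this
    linarith
  have hβ : (⟪star z ψ, star f ψ⟫_ℂ).re = ‖g (star f ψ)‖ ^ 2 := by
    rw [hzf, star_mul, star_mul, hg.star_eq, mul_apply_eq_comp,
      mul_apply_eq_comp, hgadj, re_inner_self_complex]
  have hmain : ⟪z ψ, x' ψ⟫_ℂ = ⟪g ψ, x' (g (star f ψ))⟫_ℂ := by
    have e1 : star f (x' ψ) = x' (star f ψ) :=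
      DFunLike.congr_fun ((h.mem_iff _).1 (star_mem hf) x' hx').eq ψ
    have e2 : g (x' (star f ψ)) = x' (g (star f ψ)) :=
      DFunLike.congr_fun (hc x' hx').2.eq _
    rw [← e2, ← e1, ← hgadj, ← hadj]
    conv_lhs => rw [hzf]
    rfl
  have h1 : (⟪z ψ, x' ψ⟫_ℂ).re ≤ ‖x'‖ * (‖g ψ‖ * ‖g (star f ψ)‖) := by
    rw [hmain]
    refine (re_inner_le_norm (𝕜 := ℂ) _ _).trans ?_
    calc _ ≤ ‖g ψ‖ * (‖x'‖ * ‖g (star f ψ)‖) := by gcongr; exact x'.le_opNorm _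
      _ = _ := by ring
  refine h1.trans ?_
  have hs := Real.sqrt_pos.2 hl
  have hsq := Real.sq_sqrt hl.le
  rw [div_mul_eq_mul_div, le_div_iff₀ (by positivity), mul_assoc]
  gcongr
  nlinarith [sq_nonneg (√l * ‖g ψ‖ - ‖g (star f ψ)‖)]

/-- Sakai's linear Radon-Nikodym theorem, in Tomita-Takesaki form. -/
theorem exists_sakai (h : IsCyclicPair N M ψ) {x' : H →L[ℂ] H} (hx' : x' ∈ N) {l : ℝ}
    (hl : 0 < l) :
    ∃ x ∈ M, ∀ z ∈ M, ⟪z ψ, x' ψ⟫_ℂ = l * ⟪z ψ, x ψ⟫_ℂ + ⟪star x ψ, star z ψ⟫_ℂ := by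
  let _ : InnerProductSpace ℝ H := InnerProductSpace.rclikeToReal ℂ H
  have hs := Real.sqrt_pos.2 hl
  have hsq := Real.mul_self_sqrt hl.le
  set k : ℝ := ‖x'‖ / (2 * √l)
  have hk : 0 ≤ k := by positivity
  have hE : ∀ u v : WithLp 2 (H × H),
      ⟪u, v⟫_ℝ = (⟪u.fst, v.fst⟫_ℂ).re + (⟪u.snd, v.snd⟫_ℂ).re := fun _ _ => rfl
  have hsm : ∀ (c d : ℝ) (a b : H), (⟪c • a, d • b⟫_ℂ).re = c * d * (⟪a, b⟫_ℂ).re := by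
    intro c d a b
    rw [← Complex.coe_smul, ← Complex.coe_smul, inner_smul_left, inner_smul_right, ← mul_assoc,
      Complex.conj_ofReal, ← Complex.ofReal_mul, Complex.re_ofReal_mul]
  let Θ : M →ₗ[ℝ] WithLp 2 (H × H) :=
    { toFun := fun x => WithLp.toLp 2 (√l • (x : H →L[ℂ] H) ψ, star (x : H →L[ℂ] H) ψ)
      map_add' := fun x y => by
        rw [← WithLp.toLp_add]; simp
      map_smul' := fun c x => by
        rw [RingHom.id_apply, ← WithLp.toLp_smul]; simp [smul_comm c] }
  have hΘ : ∀ x y : M, ⟪Θ x, Θ y⟫_ℝ = l * (⟪(x : H →L[ℂ] H) ψ, (y : H →L[ℂ] H) ψ⟫_ℂ).re +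
      (⟪star (x : H →L[ℂ] H) ψ, star (y : H →L[ℂ] H) ψ⟫_ℂ).re := fun x y => by
    rw [hE]
    simp only [Θ, LinearMap.coe_mk, AddHom.coe_mk, WithLp.toLp_fst, WithLp.toLp_snd, hsm, hsq]
  set t : WithLp 2 (H × H) := WithLp.toLp 2 ((√l)⁻¹ • x' ψ, 0)
  have hΘt : ∀ x : M, ⟪Θ x, t⟫_ℝ = (⟪(x : H →L[ℂ] H) ψ, x' ψ⟫_ℂ).re := fun x => by
    rw [hE]
    simp only [t, Θ, LinearMap.coe_mk, AddHom.coe_mk, WithLp.toLp_fst, WithLp.toLp_snd, hsm,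
      mul_inv_cancel₀ hs.ne', one_mul, inner_zero_right, Complex.zero_re, add_zero]
  set B : Set (WithLp 2 (H × H)) := Θ '' {x | ‖(x : H →L[ℂ] H)‖ ≤ k}
  have hconv : Convex ℝ B := by
    refine Convex.linear_image (f := Θ) ?_
    intro x hx y hy a b ha hb hab
    simp only [Set.mem_ofPred_eq] at hx hy ⊢
    calc ‖((a • x + b • y : M) : H →L[ℂ] H)‖
        = ‖a • (x : H →L[ℂ] H) + b • (y : H →L[ℂ] H)‖ := rfl
      _ ≤ ‖a • (x : H →L[ℂ] H)‖ + ‖b • (y : H →L[ℂ] H)‖ := norm_add_le _ _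
      _ = a * ‖(x : H →L[ℂ] H)‖ + b * ‖(y : H →L[ℂ] H)‖ := by
        rw [norm_smul, norm_smul, Real.norm_of_nonneg ha, Real.norm_of_nonneg hb]
      _ ≤ a * k + b * k := by gcongr
      _ = k := by rw [← add_mul, hab, one_mul]
  have hcomplete : IsComplete B := by
    refine IsClosed.isComplete (isSeqClosed_iff_isClosed.1 fun u w hu huw => ?_)
    choose x hx hxu using hu
    have hfst : Tendsto (fun n => √l • (x n : H →L[ℂ] H) ψ) atTop (𝓝 w.fst) := by
      have := ((WithLp.prod_continuous_ofLp 2 H H).fst.tendsto w).comp huw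
      refine this.congr fun n => ?_
      simp [← hxu n, Θ]
    have hsnd : Tendsto (fun n => star (x n : H →L[ℂ] H) ψ) atTop (𝓝 w.snd) := by
      have := ((WithLp.prod_continuous_ofLp 2 H H).snd.tendsto w).comp huw
      refine this.congr fun n => ?_
      simp [← hxu n, Θ]
    have hfst' : Tendsto (fun n => (x n : H →L[ℂ] H) ψ) atTop (𝓝 ((√l)⁻¹ • w.fst)) :=
      (hfst.const_smul (√l)⁻¹).congr fun n => by rw [smul_smul, inv_mul_cancel₀ hs.ne', one_smul]
    obtain ⟨y, hyM, hyk, hy1, hy2⟩ := h.exists_limit (fun n => (x n).2) hx hfst' hsnd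
    refine ⟨⟨y, hyM⟩, hyk, ?_⟩
    simp only [Θ, LinearMap.coe_mk, AddHom.coe_mk, hy1, hy2, smul_smul, mul_inv_cancel₀ hs.ne',
      one_smul]
    rfl
  have hR : ∀ w ∈ B, ‖w‖ ≤ √(l * (k * ‖ψ‖) ^ 2 + (k * ‖ψ‖) ^ 2) := by
    rintro _ ⟨x, hx, rfl⟩
    rw [WithLp.prod_norm_eq_of_L2]
    refine Real.sqrt_le_sqrt (add_le_add ?_ ?_)
    · simp only [Θ, LinearMap.coe_mk, AddHom.coe_mk]
      rw [WithLp.toLp_fst, norm_smul, Real.norm_of_nonneg hs.le, mul_pow, Real.sq_sqrt hl.le]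
      gcongr
      exact (x : H →L[ℂ] H).le_of_opNorm_le hx ψ
    · simp only [Θ, LinearMap.coe_mk, AddHom.coe_mk]
      gcongr
      exact (star (x : H →L[ℂ] H)).le_of_opNorm_le (by rw [norm_star]; exact hx) ψ
  obtain ⟨_, ⟨x, hx, rfl⟩, hb⟩ := exists_mem_inner_eq_of_inner_le_support (LinearMap.range Θ)
    hcomplete hconv ⟨Θ 0, 0, by simpa using hk, rfl⟩
    (by rintro _ ⟨x, -, rfl⟩; exact ⟨x, rfl⟩) hR t (by
      rintro _ ⟨z, rfl⟩ e he
      obtain ⟨f, hf, hf1, hle⟩ := h.re_inner_le_support hx' z.2 hl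
        (e := e / (k * l * ‖ψ‖ ^ 2 + 1)) (by positivity)
      refine ⟨Θ (k • ⟨f, hf⟩), ⟨_, ?_, rfl⟩, ?_⟩
      · change ‖k • f‖ ≤ k
        rw [norm_smul, Real.norm_of_nonneg hk]
        exact mul_le_of_le_one_right hk hf1
      · rw [hΘt, map_smul, inner_smul_right, hΘ]
        refine hle.trans ?_
        rw [mul_add]
        refine add_le_add le_rfl ?_
        have : k * (l * (e / (k * l * ‖ψ‖ ^ 2 + 1)) * ‖ψ‖ ^ 2) =
          e * ((k * l * ‖ψ‖ ^ 2) / (k * l * ‖ψ‖ ^ 2 + 1)) := by ring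
        rw [this]
        refine mul_le_of_le_one_right he.le ((div_le_one (by positivity)).2 (by linarith)))
  have hre : ∀ z : M, (⟪(z : H →L[ℂ] H) ψ, x' ψ⟫_ℂ).re =
      l * (⟪(z : H →L[ℂ] H) ψ, (x : H →L[ℂ] H) ψ⟫_ℂ).re +
      (⟪star (x : H →L[ℂ] H) ψ, star (z : H →L[ℂ] H) ψ⟫_ℂ).re := fun z => by
    rw [← hΘt, hb _ ⟨z, rfl⟩, hΘ, ← inner_conj_symm (star (z : H →L[ℂ] H) ψ), Complex.conj_re]
  refine ⟨x, x.2, fun z hz => Complex.ext ?_ ?_⟩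
  · simpa using hre ⟨z, hz⟩
  · have := hre (Complex.I • ⟨z, hz⟩)
    simpa [star_smul, inner_smul_left, inner_smul_right] using this

end IsCyclicPair

theorem re_inner_I_smul_left {E : Type*} [SeminormedAddCommGroup E] [InnerProductSpace ℂ E]
    (a b : E) : (⟪Complex.I • a, b⟫_ℂ).re = (⟪a, b⟫_ℂ).im := by
  simp [inner_smul_left]

theorem re_inner_I_smul_right {E : Type*} [SeminormedAddCommGroup E] [InnerProductSpace ℂ E]
    (a b : E) : (⟪a, Complex.I • b⟫_ℂ).re = -(⟪a, b⟫_ℂ).im := by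
  simp [inner_smul_right]

/-- `C` and the antilinear `A` are the two components of a real-linear orthogonal projection
`C + A`. -/
structure IsProjectionPair (C : H →L[ℂ] H) (A : H →L⋆[ℂ] H) : Prop where
  selfAdjoint : IsSelfAdjoint C
  nonneg : 0 ≤ C
  le_one : C ≤ 1
  inner_comm : ∀ η ζ, ⟪A η, ζ⟫_ℂ = ⟪A ζ, η⟫_ℂ
  sq : ∀ η, A (A η) = C η - C (C η)
  anticomm : ∀ η, A (C η) = A η - C (A η)

theorem exists_isProjectionPair (p : H →L[ℝ] H) (hidem : ∀ η, p (p η) = p η)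
    (hsymm : ∀ η ζ, (⟪p η, ζ⟫_ℂ).re = (⟪η, p ζ⟫_ℂ).re) :
    ∃ (C : H →L[ℂ] H) (A : H →L⋆[ℂ] H), IsProjectionPair C A ∧ ∀ η, p η = C η + A η := by
  have hc : ∀ (c : ℂ) (η : H), p (c • η) = (c.re : ℂ) • p η + (c.im : ℂ) • p (Complex.I • η) := by
    intro c η
    have : c • η = c.re • η + c.im • Complex.I • η := by
      rw [← Complex.coe_smul, ← Complex.coe_smul, smul_smul, ← add_smul, Complex.re_add_im]
    rw [this, map_add, map_smul, map_smul, Complex.coe_smul, Complex.coe_smul]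
  have hI : ∀ η, p (Complex.I • Complex.I • η) = - p η := fun η => by
    rw [smul_smul, Complex.I_mul_I, neg_one_smul, map_neg]
  let C : H →L[ℂ] H :=
    { toFun := fun η => (1 / 2 : ℂ) • (p η - Complex.I • p (Complex.I • η))
      map_add' := fun a b => by simp only [smul_add, map_add]; module
      map_smul' := fun c a => by
        rw [smul_comm Complex.I c, hc c a, hc c (Complex.I • a), hI, RingHom.id_apply]
        conv_rhs => rw [← Complex.re_add_im c]
        match_scalars
        · ring 
        · linear_combination (1 / 2 : ℂ) * c.im * Complex.I_sq 
      cont := by fun_prop }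
  let A : H →L⋆[ℂ] H :=
    { toFun := fun η => (1 / 2 : ℂ) • (p η + Complex.I • p (Complex.I • η))
      map_add' := fun a b => by simp only [smul_add, map_add]; module
      map_smul' := fun c a => by
        rw [smul_comm Complex.I c, hc c a, hc c (Complex.I • a), hI]
        conv_rhs => rw [← Complex.re_add_im c]
        simp only [map_add, map_mul, Complex.conj_ofReal, Complex.conj_I]
        match_scalars
        · ring 
        · linear_combination (1 / 2 : ℂ) * c.im * Complex.I_sq 
      cont := by fun_prop }
  have hC : ∀ η, C η = (1 / 2 : ℂ) • (p η - Complex.I • p (Complex.I • η)) := fun _ => rfl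
  have hA : ∀ η, A η = (1 / 2 : ℂ) • (p η + Complex.I • p (Complex.I • η)) := fun _ => rfl
  have hp : ∀ η, p η = C η + A η := fun η => by rw [hC, hA]; module
  have half : ∀ a b : H, (⟪(1 / 2 : ℂ) • a, b⟫_ℂ).re = 1 / 2 * (⟪a, b⟫_ℂ).re := fun a b => by
    simp [mul_comm]
  have half' : ∀ a b : H, (⟪a, (1 / 2 : ℂ) • b⟫_ℂ).re = 1 / 2 * (⟪a, b⟫_ℂ).re := fun a b => by
    simp
  have hsI : ∀ η ζ, (⟪Complex.I • p (Complex.I • η), ζ⟫_ℂ).re =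
      (⟪η, Complex.I • p (Complex.I • ζ)⟫_ℂ).re := fun η ζ => by
    have := hsymm (Complex.I • η) (Complex.I • ζ)
    rw [re_inner_I_smul_right, re_inner_I_smul_left] at this
    rw [re_inner_I_smul_right, re_inner_I_smul_left]
    linarith
  have hCs : ∀ η ζ, ⟪C η, ζ⟫_ℂ = ⟪η, C ζ⟫_ℂ := by
    have hre : ∀ η ζ, (⟪C η, ζ⟫_ℂ).re = (⟪η, C ζ⟫_ℂ).re := fun η ζ => by
      rw [hC, hC, half, half', inner_sub_left, inner_sub_right, Complex.sub_re, Complex.sub_re,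
        hsymm, hsI]
    refine fun η ζ => Complex.ext (hre η ζ) ?_
    rw [← re_inner_I_smul_left, ← re_inner_I_smul_left, ← map_smul, hre]
  have hAs : ∀ η ζ, ⟪A η, ζ⟫_ℂ = ⟪A ζ, η⟫_ℂ := by
    have hre : ∀ η ζ, (⟪A η, ζ⟫_ℂ).re = (⟪A ζ, η⟫_ℂ).re := fun η ζ => by
      rw [hA, hA, half, half, inner_add_left, inner_add_left, Complex.add_re, Complex.add_re,
        hsymm, hsI, ← inner_conj_symm η, ← inner_conj_symm η, Complex.conj_re, Complex.conj_re]
    refine fun η ζ => Complex.ext (hre η ζ) ?_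
    have h1 := hre (-(Complex.I • η)) ζ
    rw [map_neg, map_smulₛₗ, Complex.conj_I, neg_smul, neg_neg, re_inner_I_smul_left,
      inner_neg_right, Complex.neg_re, re_inner_I_smul_right, neg_neg] at h1
    exact h1
  have hidem' : ∀ η, C (C η) + A (A η) = C η ∧ A (C η) = A η - C (A η) := by
    intro η
    have h1 := hidem η
    have h2 := hidem (Complex.I • η)
    rw [hp (p η), hp η] at h1
    rw [hp (p (Complex.I • η)), hp (Complex.I • η)] at h2
    simp only [map_add, map_smul, map_smulₛₗ, Complex.conj_I, RingHom.map_neg, neg_neg] at h1 h2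
    have h3 : C (C η) + -(C (A η)) + (-(A (C η)) + A (A η)) = C η - A η := by
      have := congrArg (fun v => -Complex.I • v) h2
      simp only [smul_add, smul_smul, neg_mul, Complex.I_mul_I, smul_neg, neg_neg, one_smul,
        neg_smul] at this
      rw [sub_eq_add_neg, ← this]
    constructor
    · linear_combination (norm := module) (1 / 2 : ℂ) • h1 + (1 / 2 : ℂ) • h3
    · linear_combination (norm := module) (1 / 2 : ℂ) • h1 - (1 / 2 : ℂ) • h3
  have hsq : ∀ η, A (A η) = C η - C (C η) := fun η =>
    eq_sub_of_add_eq' (hidem' η).1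
  have hsa : IsSelfAdjoint C := ContinuousLinearMap.isSelfAdjoint_iff_isSymmetric.2 hCs
  have hnorm : ∀ η, (⟪C η, η⟫_ℂ).re = ‖C η‖ ^ 2 + ‖A η‖ ^ 2 := fun η => by
    rw [← re_inner_self_complex, ← re_inner_self_complex, hAs, hsq, inner_sub_left,
      hCs (C η) η, Complex.sub_re]
    ring
  refine ⟨C, A, ⟨hsa, ?_, ?_, hAs, hsq, fun η => (hidem' η).2⟩, hp⟩
  · rw [ContinuousLinearMap.nonneg_iff_isPositive, ContinuousLinearMap.isPositive_def']
    refine ⟨hsa, fun η => ?_⟩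
    change 0 ≤ (⟪C η, η⟫_ℂ).re
    rw [hnorm]; positivity
  · rw [ContinuousLinearMap.le_def, ContinuousLinearMap.isPositive_def']
    refine ⟨(IsSelfAdjoint.one _).sub hsa, fun η => ?_⟩
    change 0 ≤ (⟪η - C η, η⟫_ℂ).re
    rw [inner_sub_left, Complex.sub_re, re_inner_self_complex]
    have h1 := hnorm η
    have h2 : (⟪C η, η⟫_ℂ).re ≤ ‖C η‖ * ‖η‖ := re_inner_le_norm (𝕜 := ℂ) _ _
    nlinarith [sq_nonneg (‖C η‖ - ‖η‖), sq_nonneg ‖A η‖]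

/-- The operators attached to the closed real subspace spanned by the self-adjoint elements of `M`
applied to `ψ`. -/
structure IsModularPair (N M : StarSubalgebra ℂ (H →L[ℂ] H)) (ψ : H) (C : H →L[ℂ] H)
    (A : H →L⋆[ℂ] H) : Prop extends IsProjectionPair C A where
  right : ∀ x ∈ M, A (star x ψ) = x ψ - C (x ψ)
  left : ∀ x ∈ N, A (star x ψ) = C (x ψ)
  approx : ∀ ζ, ∀ e > 0, ∃ z ∈ M, dist (A ζ) (z ψ) < e ∧ dist (C ζ) (star z ψ) < e

namespace IsCyclicPair
variable {N M : StarSubalgebra ℂ (H →L[ℂ] H)} {ψ : H}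

theorem exists_isModularPair (h : IsCyclicPair N M ψ) : ∃ C A, IsModularPair N M ψ C A := by
  let _ : InnerProductSpace ℝ H := InnerProductSpace.rclikeToReal ℂ H
  have hR : ∀ a b : H, ⟪a, b⟫_ℝ = (⟪a, b⟫_ℂ).re := fun _ _ => rfl
  let S : Submodule ℝ H :=
    { carrier := {η | ∃ k ∈ M, IsSelfAdjoint k ∧ k ψ = η}
      add_mem' := by
        rintro _ _ ⟨k, hk, hk', rfl⟩ ⟨l, hl, hl', rfl⟩
        exact ⟨k + l, add_mem hk hl, hk'.add hl', rfl⟩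
      zero_mem' := ⟨0, zero_mem _, .zero _, rfl⟩
      smul_mem' := by
        rintro c _ ⟨k, hk, hk', rfl⟩
        exact ⟨c • k, (M.toSubmodule.restrictScalars ℝ).smul_mem c hk, .smul (.all c) hk', rfl⟩ }
  set K := S.topologicalClosure
  set p : H →L[ℝ] H := K.starProjection
  obtain ⟨C, A, hCA, hp⟩ := exists_isProjectionPair p
    (fun η => K.starProjection_eq_self_iff.2 (K.starProjection_apply_mem η))
    (fun η ζ => by rw [← hR, ← hR]; exact K.inner_starProjection_left_eq_right η ζ)
  have hdecomp : ∀ x : H →L[ℂ] H, ∃ a b : H →L[ℂ] H, IsSelfAdjoint a ∧ IsSelfAdjoint b ∧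
      x = a + Complex.I • b ∧ star x = a - Complex.I • b ∧
      ∀ R : StarSubalgebra ℂ (H →L[ℂ] H), x ∈ R → a ∈ R ∧ b ∈ R := by
    intro x
    refine ⟨(2⁻¹ : ℂ) • (x + star x), (2⁻¹ : ℂ) • (-Complex.I) • (x - star x), ?_, ?_, ?_, ?_, ?_⟩
    · simp [IsSelfAdjoint, star_smul, star_add, add_comm]
    · simp [IsSelfAdjoint, star_smul]
      module
    · match_scalars
      all_goals first | ring1 | linear_combination (2⁻¹ : ℂ) * Complex.I_sq |
        linear_combination (-2⁻¹ : ℂ) * Complex.I_sq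
    · match_scalars
      all_goals first | ring1 | linear_combination (2⁻¹ : ℂ) * Complex.I_sq |
        linear_combination (-2⁻¹ : ℂ) * Complex.I_sq
    · exact fun R hx => ⟨R.smul_mem (add_mem hx (star_mem hx)) _,
        R.smul_mem (R.smul_mem (sub_mem hx (star_mem hx)) _) _⟩
  have hM : ∀ k ∈ M, IsSelfAdjoint k → A (k ψ) = k ψ - C (k ψ) := fun k hk hks => by
    have : p (k ψ) = k ψ :=
      K.starProjection_eq_self_iff.2 (S.le_topologicalClosure ⟨k, hk, hks, rfl⟩)
    rw [hp] at this
    exact eq_sub_of_add_eq' this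
  have hN : ∀ y ∈ N, IsSelfAdjoint y → A (y ψ) = C (y ψ) := fun y hy hys => by
    have : p (Complex.I • y ψ) = 0 := by
      rw [Submodule.starProjection_apply_eq_zero_iff, Submodule.mem_orthogonal]
      intro u hu
      refine closure_minimal (t := {u | ⟪u, Complex.I • y ψ⟫_ℝ = 0}) ?_
        (isClosed_eq (by fun_prop) (by fun_prop)) hu
      rintro _ ⟨k, hk, hks, rfl⟩
      rw [Set.mem_ofPred_eq, hR, re_inner_I_smul_right, neg_eq_zero, ← Complex.conj_eq_iff_im,
        inner_conj_symm, inner_apply_left_eq_star, inner_apply_left_eq_star, hys.star_eq,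
        hks.star_eq]
      exact congrArg _ (DFunLike.congr_fun ((h.mem_iff k).1 hk y hy).eq ψ).symm
    rw [hp, map_smul, map_smulₛₗ, Complex.conj_I, neg_smul, ← sub_eq_add_neg, ← smul_sub,
      smul_eq_zero_iff_right Complex.I_ne_zero, sub_eq_zero] at this
    exact this.symm
  refine ⟨C, A, hCA, fun x hx => ?_, fun x hx => ?_, fun ζ e he => ?_⟩
  · obtain ⟨a, b, ha, hb, hxe, hxs, hmem⟩ := hdecomp x
    obtain ⟨ham, hbm⟩ := hmem M hx
    rw [hxs, hxe]
    simp only [sub_apply, add_apply, smul_apply, map_sub, map_add, map_smul, map_smulₛₗ,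
      Complex.conj_I, hM a ham ha, hM b hbm hb]
    module
  · obtain ⟨a, b, ha, hb, hxe, hxs, hmem⟩ := hdecomp x
    obtain ⟨ham, hbm⟩ := hmem N hx
    rw [hxs, hxe]
    simp only [sub_apply, add_apply, smul_apply, map_sub, map_add, map_smul, map_smulₛₗ,
      Complex.conj_I, hN a ham ha, hN b hbm hb]
    module
  · obtain ⟨_, ⟨k, hk, hks, rfl⟩, h1⟩ := Metric.mem_closure_iff.1
      (K.starProjection_apply_mem ζ) e he
    obtain ⟨_, ⟨l, hl, hls, rfl⟩, h2⟩ := Metric.mem_closure_iff.1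
      (K.starProjection_apply_mem (Complex.I • ζ)) e he
    change dist (p ζ) _ < _ at h1
    change dist (p _) _ < _ at h2
    rw [hp, dist_eq_norm] at h1 h2
    rw [map_smul, map_smulₛₗ, Complex.conj_I] at h2
    refine ⟨(2⁻¹ : ℂ) • (k + Complex.I • l), M.smul_mem (add_mem hk (M.smul_mem hl _)) _, ?_, ?_⟩
    · have : A ζ - ((2⁻¹ : ℂ) • (k + Complex.I • l)) ψ = (2⁻¹ : ℂ) • (C ζ + A ζ - k ψ) +
          (2⁻¹ * Complex.I : ℂ) • (Complex.I • C ζ + -Complex.I • A ζ - l ψ) := by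
        simp only [smul_apply, add_apply]
        match_scalars
        all_goals first | ring1 | linear_combination (2⁻¹ : ℂ) * Complex.I_sq |
          linear_combination (-2⁻¹ : ℂ) * Complex.I_sq
      rw [dist_eq_norm, this]
      refine (norm_add_le _ _).trans_lt ?_
      rw [norm_smul, norm_smul]
      simp only [norm_mul, norm_inv, Complex.norm_ofNat, Complex.norm_I]
      linarith
    · have : C ζ - (star ((2⁻¹ : ℂ) • (k + Complex.I • l))) ψ = (2⁻¹ : ℂ) • (C ζ + A ζ - k ψ) -
          (2⁻¹ * Complex.I : ℂ) • (Complex.I • C ζ + -Complex.I • A ζ - l ψ) := by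
        simp only [star_smul, star_add, hks.star_eq, hls.star_eq, smul_apply, add_apply]
        simp only [RCLike.star_def, Complex.conj_I, map_inv₀, map_ofNat]
        match_scalars
        all_goals first | ring1 | linear_combination (2⁻¹ : ℂ) * Complex.I_sq |
          linear_combination (-2⁻¹ : ℂ) * Complex.I_sq
      rw [dist_eq_norm, this]
      refine (norm_sub_le _ _).trans_lt ?_
      rw [norm_smul, norm_smul]
      simp only [norm_mul, norm_inv, Complex.norm_ofNat, Complex.norm_I]
      linarith

end IsCyclicPair

namespace IsModularPair
variable {N M : StarSubalgebra ℂ (H →L[ℂ] H)} {ψ : H} {C : H →L[ℂ] H} {A : H →L⋆[ℂ] H}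

theorem inner_C (m : IsModularPair N M ψ C A) (a b : H) : ⟪C a, b⟫_ℂ = ⟪a, C b⟫_ℂ :=
  m.selfAdjoint.isSymmetric a b

theorem inner_A_right (m : IsModularPair N M ψ C A) (a b : H) : ⟪a, A b⟫_ℂ = ⟪b, A a⟫_ℂ := by
  rw [← inner_conj_symm, m.inner_comm, inner_conj_symm]

theorem eq_zero_of_A (m : IsModularPair N M ψ C A) (h : IsCyclicPair N M ψ) {η : H}
    (hη : A η = 0) : η = 0 := by
  have h1 : η - C η = 0 := by
    refine h.dense_right.eq_zero_of_inner_right ℂ ?_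
    intro x
    have := m.inner_comm (star (x : H →L[ℂ] H) ψ) η
    rw [hη, inner_zero_left, m.right _ x.2, inner_sub_left, m.inner_C] at this
    rw [inner_sub_right, this]
  have h2 : C η = 0 := by
    refine h.dense_left.eq_zero_of_inner_right ℂ ?_
    intro x
    have := m.inner_comm (star (x : H →L[ℂ] H) ψ) η
    rwa [hη, inner_zero_left, m.left _ x.2, m.inner_C] at this
  rwa [h2, sub_zero] at h1

theorem eq_zero_of_C (m : IsModularPair N M ψ C A) (h : IsCyclicPair N M ψ) {η : H}
    (hη : C η = 0) : η = 0 :=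
  m.eq_zero_of_A h (m.eq_zero_of_A h (by rw [m.sq, hη, map_zero, sub_zero]))

theorem eq_zero_of_one_sub_C (m : IsModularPair N M ψ C A) (h : IsCyclicPair N M ψ) {η : H}
    (hη : η - C η = 0) : η = 0 :=
  m.eq_zero_of_A h (m.eq_zero_of_A h (by rw [m.sq, ← map_sub, hη, map_zero]))

/-- `Nψ` is contained in the range of `A` on the vectors with adjoint in `Mψ`. -/
theorem exists_mem_right (m : IsModularPair N M ψ C A) (h : IsCyclicPair N M ψ) {x' : H →L[ℂ] H}
    (hx' : x' ∈ N) : ∃ y ∈ M, y ψ = A (x' ψ) ∧ star y ψ = C (x' ψ) := by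
  obtain ⟨x, hx, hS⟩ := h.exists_sakai (star_mem hx') one_pos
  have hv : A (star x' ψ - x ψ) = C (star x ψ) := by
    refine ext_inner_right ℂ fun ζ => ?_
    have : ⟪A ζ, star x' ψ - x ψ⟫_ℂ = ⟪star x ψ, C ζ⟫_ℂ := by
      have hcl : (A ζ, C ζ) ∈ closure {q : H × H | ∃ z ∈ M, q = (z ψ, star z ψ)} := by
        rw [Metric.mem_closure_iff]
        intro e he
        obtain ⟨z, hz, h1, h2⟩ := m.approx ζ e he
        exact ⟨_, ⟨z, hz, rfl⟩, max_lt h1 h2⟩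
      refine closure_minimal (t := {q : H × H | ⟪q.1, star x' ψ - x ψ⟫_ℂ = ⟪star x ψ, q.2⟫_ℂ}) ?_
        (isClosed_eq (by fun_prop) (by fun_prop)) hcl
      rintro _ ⟨z, hz, rfl⟩
      have := hS z hz
      simp only [Complex.ofReal_one, one_mul] at this
      simp only [Set.mem_ofPred_eq, inner_sub_right, this, add_sub_cancel_left]
    rw [m.inner_comm, this, m.inner_C]
  have hxψ : x ψ = C (star x' ψ) := by
    have h1 := m.sq (star x' ψ - x ψ)
    rw [hv, m.anticomm, m.right x hx] at h1
    have h2 := m.eq_zero_of_one_sub_C h (η := x ψ - C (x ψ) - C (star x' ψ - x ψ))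
      (by rw [map_sub C (x ψ - C (x ψ)), sub_sub_sub_comm, h1, sub_self])
    rw [map_sub, sub_sub, add_sub_cancel, sub_eq_zero] at h2
    exact h2
  refine ⟨x, hx, ?_, ?_⟩
  · rw [hxψ, ← m.left _ (star_mem hx'), star_star]
  · refine sub_eq_zero.1 (m.eq_zero_of_A h ?_)
    rw [map_sub, m.right x hx, hxψ, ← m.left _ (star_mem hx'), star_star, m.anticomm, sub_self]

theorem conj_apply_of_sakai (m : IsModularPair N M ψ C A) (h : IsCyclicPair N M ψ)
    {x' x : H →L[ℂ] H} {l : ℝ} (hx' : x' ∈ N) (hx : x ∈ M)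
    (hS : ∀ z ∈ M, ⟪z ψ, x' ψ⟫_ℂ = l * ⟪z ψ, x ψ⟫_ℂ + ⟪star x ψ, star z ψ⟫_ℂ) (η : H) :
    A (star x' (A η)) = (l : ℂ) • C (x (η - C η)) + (x (C η) - C (x (C η))) := by
  have hright : ∀ w ∈ M, A (w ψ) = star w ψ - C (star w ψ) := fun w hw => by
    rw [← m.right _ (star_mem hw), star_star]
  have key : ∀ ζ₂, ζ₂ ∈ Set.range (fun y : N => (y : H →L[ℂ] H) ψ) →
      A (star x' (A ζ₂)) = (l : ℂ) • C (x (ζ₂ - C ζ₂)) + (x (C ζ₂) - C (x (C ζ₂))) := by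
    rintro _ ⟨y₂', rfl⟩
    beta_reduce
    obtain ⟨y₂, hy₂, h21, h22⟩ := m.exists_mem_right h y₂'.2
    set ζ₂ := (y₂' : H →L[ℂ] H) ψ
    refine sub_eq_zero.1 (h.dense_left.eq_zero_of_inner_right ℂ ?_)
    intro y₁'
    obtain ⟨y₁, hy₁, h11, h12⟩ := m.exists_mem_right h y₁'.2
    set ζ₁ := (y₁' : H →L[ℂ] H) ψ
    rw [inner_sub_right, sub_eq_zero]
    have e0 := hS (star y₁ * y₂) (mul_mem (star_mem hy₁) hy₂)
    have e1 : ⟪(star y₁ * y₂) ψ, x' ψ⟫_ℂ = ⟪ζ₁, A (star x' (A ζ₂))⟫_ℂ := by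
      rw [mul_apply_eq_comp, inner_apply_left_eq_star, star_star, m.inner_A_right, ← h11, ← h21,
        inner_apply_left_eq_star (star x'), star_star]
      exact congrArg _ (DFunLike.congr_fun ((h.mem_iff _).1 hy₁ x' hx').eq ψ)
    have e2 : ⟪(star y₁ * y₂) ψ, x ψ⟫_ℂ = ⟪ζ₁, C (x (ζ₂ - C ζ₂))⟫_ℂ := by
      rw [mul_apply_eq_comp, inner_apply_left_eq_star, star_star, h21, ← mul_apply_eq_comp,
        m.inner_comm, hright _ (mul_mem hy₁ hx), star_mul, mul_apply_eq_comp, h12, inner_sub_left,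
        m.inner_C, ← inner_sub_right, inner_apply_left_eq_star, star_star, m.inner_C]
    have e3 : ⟪star x ψ, star (star y₁ * y₂) ψ⟫_ℂ = ⟪ζ₁, x (C ζ₂) - C (x (C ζ₂))⟫_ℂ := by
      rw [star_mul, star_star, mul_apply_eq_comp, ← inner_apply_left_eq_star, h11,
        m.inner_A_right, ← mul_apply_eq_comp, hright _ (mul_mem hy₂ (star_mem hx)), star_mul,
        star_star, mul_apply_eq_comp, h22]
    rw [e1, e2, e3] at e0
    rw [e0, inner_add_right, inner_smul_right]
  refine (closure_minimal (t := {ζ₂ | A (star x' (A ζ₂)) =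
    (l : ℂ) • C (x (ζ₂ - C ζ₂)) + (x (C ζ₂) - C (x (C ζ₂)))}) key ?_) (h.dense_left η)
  exact isClosed_eq (by fun_prop) (by fun_prop)

end IsModularPair

open MeasureTheory in
theorem integrable_inv_cosh_pi : Integrable fun t : ℝ => (Real.cosh (Real.pi * t))⁻¹ := by
  refine integrable_inv_one_add_sq.mono' ?_ (.of_forall fun t => ?_)
  · have : Continuous fun t : ℝ => (Real.cosh (Real.pi * t))⁻¹ :=
      Continuous.inv₀ (by fun_prop) fun t => (Real.cosh_pos _).ne'
    exact this.aestronglyMeasurable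
  · rw [Real.norm_of_nonneg (by positivity)]
    refine inv_anti₀ (by positivity) ?_
    have h2 : Real.cosh (Real.pi * t) = 1 + 2 * Real.sinh (Real.pi * t / 2) ^ 2 := by
      have := Real.cosh_two_mul (Real.pi * t / 2)
      rw [Real.cosh_sq] at this
      rw [show Real.pi * t = 2 * (Real.pi * t / 2) by ring, this]
      ring_nf
    have h3 : |t| ≤ |Real.sinh (Real.pi * t / 2)| := by
      have h4 : |Real.pi * t / 2| ≤ |Real.sinh (Real.pi * t / 2)| := by
        rw [Real.abs_sinh]
        exact Real.self_le_sinh_iff.2 (abs_nonneg _)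
      refine le_trans ?_ h4
      rw [abs_div, abs_mul, abs_of_pos Real.pi_pos, abs_two, le_div_iff₀ two_pos, mul_comm]
      exact mul_le_mul_of_nonneg_right (by linarith [Real.pi_gt_three]) (abs_nonneg t)
    have h5 := sq_le_sq.2 h3
    rw [h2]
    nlinarith [sq_nonneg t]

open MeasureTheory in
theorem integral_exp_mul_inv_cosh_pi (a : ℝ) :
    ∫ t : ℝ, Complex.exp (Complex.I * a * t) * ((Real.cosh (Real.pi * t))⁻¹ : ℝ) =
      ((Real.cosh (a / 2))⁻¹ : ℝ) := by
  set u : ℂ := 1 / 2 + Complex.I * a / (2 * Real.pi) with hu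
  have hpi : (Real.pi : ℂ) ≠ 0 := Complex.ofReal_ne_zero.2 Real.pi_ne_zero
  have hre : u.re = 1 / 2 := by
    rw [hu, show Complex.I * a / (2 * Real.pi) = ((a / (2 * Real.pi) : ℝ) : ℂ) * Complex.I by
      push_cast; ring, Complex.add_re, Complex.re_ofReal_mul, Complex.I_re]
    simp
  have hB : Complex.betaIntegral u (1 - u) = Real.pi / Real.cosh (a / 2) := by
    have h1 := Complex.Gamma_mul_Gamma_eq_betaIntegral (s := u) (t := 1 - u)
      (by rw [hre]; norm_num) (by rw [Complex.sub_re, hre]; norm_num)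
    rw [Complex.Gamma_mul_Gamma_one_sub, add_sub_cancel, Complex.Gamma_one, one_mul] at h1
    rw [← h1, hu, mul_add, ← mul_div_assoc, mul_one,
      show (Real.pi : ℂ) * (Complex.I * a / (2 * Real.pi)) = (a / 2 : ℂ) * Complex.I by
        field_simp, add_comm, Complex.sin_add_pi_div_two, Complex.cos_mul_I]
    push_cast
    rfl
  set f : ℝ → ℝ := fun t => (1 + Real.exp (-(2 * Real.pi * t)))⁻¹ with hf
  have hpos : ∀ t : ℝ, 0 < 1 + Real.exp (-(2 * Real.pi * t)) := fun t => by positivity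
  have hderiv : ∀ t, HasDerivAt f (2 * Real.pi * Real.exp (-(2 * Real.pi * t)) /
      (1 + Real.exp (-(2 * Real.pi * t))) ^ 2) t := by
    intro t
    have h1 : HasDerivAt (fun t : ℝ => -(2 * Real.pi * t)) (-(2 * Real.pi)) t := by
      convert! ((hasDerivAt_id t).const_mul (2 * Real.pi)).neg using 1
      ring
    have := ((h1.exp).const_add 1).inv (hpos t).ne'
    convert! this using 1
    ring
  have hinj : Set.InjOn f Set.univ := by
    intro s _ t _ h
    have := inv_injective h
    have := Real.exp_injective (add_left_cancel this)
    have h2 := Real.pi_pos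
    nlinarith
  have himg : f '' Set.univ = Set.Ioo 0 1 := by
    ext x
    simp only [Set.image_univ, Set.mem_range, Set.mem_Ioo]
    constructor
    · rintro ⟨t, rfl⟩
      exact ⟨inv_pos.2 (hpos t),
        inv_lt_one_of_one_lt₀ (by linarith [Real.exp_pos (-(2 * Real.pi * t))])⟩
    · rintro ⟨h0, h1⟩
      refine ⟨-(Real.log (x⁻¹ - 1) / (2 * Real.pi)), ?_⟩
      have h3 : 0 < x⁻¹ - 1 := by linarith [(one_lt_inv₀ h0).2 h1]
      have h2 : -(2 * Real.pi * -(Real.log (x⁻¹ - 1) / (2 * Real.pi))) = Real.log (x⁻¹ - 1) := by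
        have := Real.pi_ne_zero
        field_simp
      simp only [hf]
      rw [h2, Real.exp_log h3, add_sub_cancel, inv_inv]
  have hsub := integral_image_eq_integral_abs_deriv_smul MeasurableSet.univ
    (fun t _ => (hderiv t).hasDerivWithinAt) hinj
    (fun x : ℝ => (x : ℂ) ^ (u - 1) * (1 - (x : ℂ)) ^ ((1 - u) - 1))
  rw [himg, ← integral_Ioc_eq_integral_Ioo, ← intervalIntegral.integral_of_le zero_le_one] at hsub
  change Complex.betaIntegral u (1 - u) = _ at hsub
  rw [hB, Measure.restrict_univ] at hsub
  have hint : ∀ t : ℝ, |2 * Real.pi * Real.exp (-(2 * Real.pi * t)) /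
      (1 + Real.exp (-(2 * Real.pi * t))) ^ 2| •
      ((f t : ℂ) ^ (u - 1) * (1 - (f t : ℂ)) ^ ((1 - u) - 1)) =
      Real.pi * (Complex.exp (Complex.I * a * t) * ((Real.cosh (Real.pi * t))⁻¹ : ℝ)) := by
    intro t
    set E := Real.exp (-(2 * Real.pi * t)) with hE
    have hE0 : 0 < E := Real.exp_pos _
    have hcosh : (Real.cosh (Real.pi * t))⁻¹ = 2 * Real.exp (-(Real.pi * t)) * (1 + E)⁻¹ := by
      have h1 : Real.exp (Real.pi * t) * Real.exp (-(Real.pi * t)) = 1 := by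
        rw [← Real.exp_add]; simp
      have h2 : E = Real.exp (-(Real.pi * t)) * Real.exp (-(Real.pi * t)) := by
        rw [hE, ← Real.exp_add]; ring_nf
      rw [inv_eq_iff_eq_inv, mul_inv, mul_inv, inv_inv, Real.cosh_eq, h2]
      have := Real.exp_pos (-(Real.pi * t))
      field_simp
      linear_combination h1
    have hft : f t = (1 + E)⁻¹ := rfl
    have hft1 : 1 - f t = E * (1 + E)⁻¹ := by
      rw [hft]; field_simp; ring
    have hfp : 0 < f t := inv_pos.2 (hpos t)
    have e1 : ((f t : ℂ) ^ (u - 1) * (1 - (f t : ℂ)) ^ ((1 - u) - 1)) =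
        (1 + E : ℝ) * Complex.exp (-u * Real.log E) := by
      have hne : ((1 + E : ℝ) : ℂ) ≠ 0 := Complex.ofReal_ne_zero.2 (by positivity)
      rw [← Complex.ofReal_one, ← Complex.ofReal_sub, hft1, Complex.ofReal_mul,
        Complex.mul_cpow_ofReal_nonneg hE0.le hfp.le]
      rw [show (((1 : ℝ) : ℂ) - u - ((1 : ℝ) : ℂ)) = -u by push_cast; ring]
      rw [mul_left_comm, ← Complex.cpow_add _ _ (Complex.ofReal_ne_zero.2 hfp.ne'),
        show u - ((1 : ℝ) : ℂ) + -u = -1 by push_cast; ring, Complex.cpow_neg_one, hft,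
        Complex.ofReal_inv, inv_inv, mul_comm, Complex.cpow_def_of_ne_zero
          (Complex.ofReal_ne_zero.2 hE0.ne'), ← Complex.ofReal_log hE0.le, mul_comm (-u)]
    have e2 : Complex.exp (-u * Real.log E) =
        Real.exp (Real.pi * t) * Complex.exp (Complex.I * a * t) := by
      rw [hE, Real.log_exp, Complex.ofReal_exp, ← Complex.exp_add, hu]
      congr 1
      push_cast
      field_simp
    rw [e1, e2, hcosh, abs_of_pos (by positivity), Complex.real_smul]
    have e3 : Real.exp (-(Real.pi * t)) = E * Real.exp (Real.pi * t) := by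
      rw [hE, ← Real.exp_add]; ring_nf
    rw [e3]
    have hne : ((1 + E : ℝ) : ℂ) ≠ 0 := Complex.ofReal_ne_zero.2 (by positivity)
    push_cast at hne ⊢
    field_simp
  rw [integral_congr_ae (.of_forall hint), integral_const_mul, div_eq_mul_inv] at hsub
  rw [← mul_left_cancel₀ hpi hsub]
  push_cast
  rfl

open MeasureTheory in
theorem eq_zero_of_integral_exp_mul_eq_zero {F : ℝ → ℂ} (hc : Continuous F) (hF : Integrable F)
    (h0 : ∀ a : ℝ, ∫ t : ℝ, Complex.exp (Complex.I * a * t) * F t = 0) : F = 0 := by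
  have h : FourierTransform.fourier F = (0 : ℝ → ℂ) := by
    ext w
    rw [Real.fourier_real_eq_integral_exp_smul, Pi.zero_apply, ← h0 (-2 * Real.pi * w)]
    congr 1 with t
    rw [smul_eq_mul]
    congr 2
    push_cast
    ring
  have h2 := hc.fourierInv_fourier_eq hF (by rw [h]; exact integrable_zero _ _ _)
  rw [← h2, h]
  ext w
  rw [Real.fourierInv_eq]
  simp

namespace UnitIntervalCalculus

/-- The coordinate function on the unit interval. -/
def coord : C(unitInterval, ℂ) := ⟨fun c => ((c : ℝ) : ℂ), by fun_prop⟩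

/-- The function `√c`. -/
noncomputable def sqrtCoord : C(unitInterval, ℂ) := ⟨fun c => (√(c : ℝ) : ℝ), by fun_prop⟩

/-- The function `√(1 - c)`. -/
noncomputable def sqrtCoord' : C(unitInterval, ℂ) := ⟨fun c => (√(1 - (c : ℝ)) : ℝ), by fun_prop⟩

/-- The logit function. -/
noncomputable def logit (c : unitInterval) : ℝ := Real.log (c / (1 - c))

/-- The function `√(c (1 - c)) (c / (1 - c)) ^ (i t)`. -/
noncomputable def osc (t : ℝ) : C(unitInterval, ℂ) where
  toFun c := (√((c : ℝ) * (1 - c)) : ℝ) * Complex.exp (Complex.I * t * logit c)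
  continuous_toFun := by
    have hn : ∀ c : unitInterval, ‖Complex.exp (Complex.I * t * logit c)‖ = 1 := fun c => by
      rw [mul_assoc, mul_comm, ← Complex.ofReal_mul, Complex.norm_exp_ofReal_mul_I]
    rw [continuous_iff_continuousAt]
    intro c
    by_cases hc : (c : ℝ) * (1 - c) = 0
    · have h0 : (√((c : ℝ) * (1 - c)) : ℝ) * Complex.exp (Complex.I * t * logit c) = 0 := by
        rw [hc, Real.sqrt_zero, Complex.ofReal_zero, zero_mul]
      rw [ContinuousAt, h0]
      refine squeeze_zero_norm (a := fun c : unitInterval => √((c : ℝ) * (1 - c))) (fun c => ?_) ?_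
      · rw [norm_mul, hn, mul_one, Complex.norm_of_nonneg (Real.sqrt_nonneg _)]
      · have : Continuous fun c : unitInterval => √((c : ℝ) * (1 - c)) := by fun_prop
        simpa [hc] using this.tendsto c
    · have h1 : (c : ℝ) ≠ 0 := left_ne_zero_of_mul hc
      have h2 : 1 - (c : ℝ) ≠ 0 := right_ne_zero_of_mul hc
      refine ContinuousAt.mul (by fun_prop) ?_
      have : ContinuousAt logit c := by
        unfold logit
        exact ContinuousAt.log (ContinuousAt.div (by fun_prop) (by fun_prop) h2) (div_ne_zero h1 h2)
      fun_prop

theorem osc_apply (t : ℝ) (c : unitInterval) :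
    osc t c = (√((c : ℝ) * (1 - c)) : ℝ) * Complex.exp (Complex.I * t * logit c) := rfl

theorem osc_zero_apply (c : unitInterval) : osc 0 c = (√((c : ℝ) * (1 - c)) : ℝ) := by
  simp [osc_apply]

theorem osc_mul_osc (s t : ℝ) : osc s * osc t = osc 0 * osc (s + t) := by
  ext c
  simp only [ContinuousMap.mul_apply, osc_apply]
  rw [Complex.ofReal_add, mul_add, add_mul, Complex.exp_add]
  simp only [Complex.ofReal_zero, mul_zero, zero_mul, Complex.exp_zero]
  ring

theorem star_osc (t : ℝ) : star (osc t) = osc (-t) := by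
  ext c
  simp only [ContinuousMap.star_apply, osc_apply, RCLike.star_def, map_mul, Complex.conj_ofReal,
    ← Complex.exp_conj, Complex.conj_I]
  push_cast
  ring_nf

theorem osc_zero_mul_self : osc 0 * osc 0 = coord * (1 - coord) := by
  ext c
  simp only [ContinuousMap.mul_apply, osc_zero_apply]
  rw [← Complex.ofReal_mul, Real.mul_self_sqrt (mul_nonneg c.2.1 (by linarith [c.2.2]))]
  simp [coord]

theorem sqrtCoord_mul : sqrtCoord * sqrtCoord = coord := by
  ext c
  simp [sqrtCoord, coord, ← Complex.ofReal_mul, Real.mul_self_sqrt c.2.1]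

theorem sqrtCoord'_mul : sqrtCoord' * sqrtCoord' = 1 - coord := by
  ext c
  simp only [ContinuousMap.mul_apply, sqrtCoord', ContinuousMap.coe_mk, ← Complex.ofReal_mul,
    Real.mul_self_sqrt (sub_nonneg.2 c.2.2)]
  simp [coord]

theorem sqrtCoord_mul_sqrtCoord' : sqrtCoord * sqrtCoord' = osc 0 := by
  ext c
  simp only [ContinuousMap.mul_apply, sqrtCoord, sqrtCoord', ContinuousMap.coe_mk, osc_zero_apply,
    Real.sqrt_mul c.2.1]
  push_cast
  rfl

/-- Complex valued Bernstein polynomials. -/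
noncomputable def bern (n k : ℕ) : C(unitInterval, ℂ) :=
  algebraMap ℂ _ (n.choose k) * coord ^ k * (1 - coord) ^ (n - k)

theorem bern_apply (n k : ℕ) (c : unitInterval) : bern n k c = (bernstein n k c : ℝ) := by
  simp [bern, coord, bernstein_apply]

theorem sum_bern_apply (n : ℕ) (f : C(unitInterval, ℂ)) :
    ∑ k : Fin (n + 1), f (bernstein.z k) • bern n k = bernsteinApproximation n f := by
  ext c
  simp only [ContinuousMap.coe_sum, Finset.sum_apply, ContinuousMap.smul_apply, bern_apply,
    bernsteinApproximation.apply, Complex.real_smul, smul_eq_mul, mul_comm]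

theorem tendsto_sum_bern (f : C(unitInterval, ℂ)) :
    Tendsto (fun n => ∑ k : Fin (n + 1), f (bernstein.z k) • bern n k) atTop (𝓝 f) := by
  simp_rw [sum_bern_apply]
  exact bernsteinApproximation_uniform f

theorem norm_sum_bern_le (n : ℕ) (f : C(unitInterval, ℂ)) :
    ‖∑ k : Fin (n + 1), f (bernstein.z k) • bern n k‖ ≤ ‖f‖ := by
  refine (ContinuousMap.norm_le _ (norm_nonneg f)).2 fun c => ?_
  rw [sum_bern_apply, bernsteinApproximation.apply]
  refine (norm_sum_le _ _).trans ?_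
  have h1 : ‖f‖ = ∑ k : Fin (n + 1), bernstein n k c * ‖f‖ := by
    rw [← Finset.sum_mul, bernstein.probability, one_mul]
  refine le_of_le_of_eq (Finset.sum_le_sum fun k _ => ?_) h1.symm
  rw [norm_smul, Real.norm_of_nonneg bernstein_nonneg]
  exact mul_le_mul_of_nonneg_left (f.norm_coe_le_norm _) bernstein_nonneg

theorem induction {p : C(unitInterval, ℂ) → Prop} (const : ∀ z, p (algebraMap ℂ _ z))
    (id : p coord) (add : ∀ f g, p f → p g → p (f + g)) (mul : ∀ f g, p f → p g → p (f * g))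
    (closed : IsClosed {f | p f}) (f : C(unitInterval, ℂ)) : p f := by
  have pow : ∀ g, p g → ∀ k : ℕ, p (g ^ k) := fun g hg k => by
    induction k with
    | zero => simpa using const 1
    | succ k ih => rw [pow_succ]; exact mul _ _ ih hg
  have sum : ∀ (s : Finset ℕ) (g : ℕ → C(unitInterval, ℂ)), (∀ k, p (g k)) →
      p (∑ k ∈ s, g k) := fun s g hg => by
    classical
    induction s using Finset.induction_on with
    | empty => simpa using const 0
    | insert a s ha ih => rw [Finset.sum_insert ha]; exact add _ _ (hg a) ih
  have hid : p (1 - coord) := by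
    have := add _ _ (const 1) (mul _ _ (const (-1)) id)
    convert this using 1
    ext
    simp [sub_eq_add_neg]
  refine closed.mem_of_tendsto (tendsto_sum_bern f) (.of_forall fun n => ?_)
  have : ∑ k : Fin (n + 1), f (bernstein.z k) • bern n k = ∑ k ∈ Finset.range (n + 1),
      (if h : k < n + 1 then f (bernstein.z (⟨k, h⟩ : Fin (n + 1))) else 0) • bern n k := by
    rw [Finset.sum_range]
    exact Finset.sum_congr rfl fun k _ => by rw [dif_pos k.2]
  rw [Set.mem_ofPred_eq, this]
  refine sum _ _ fun k => ?_
  have hsm : ∀ (z : ℂ) (g : C(unitInterval, ℂ)), z • g = algebraMap ℂ _ z * g := fun z g => by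
    ext
    simp
  rw [hsm]
  exact mul _ _ (const _) (mul _ _ (mul _ _ (const _) (pow _ id _)) (pow _ hid _))

end UnitIntervalCalculus

open UnitIntervalCalculus

theorem IsProjectionPair.exists_calculus {C : H →L[ℂ] H} {A : H →L⋆[ℂ] H}
    (h : IsProjectionPair C A) :
    ∃ Φ : C(unitInterval, ℂ) →⋆ₐ[ℂ] (H →L[ℂ] H), Φ coord = C := by
  have hs : ∀ z ∈ spectrum ℂ C, z.re ∈ unitInterval ∧ (z.re : ℂ) = z := by
    intro z hz
    have hz' : (z.re : ℂ) = z := (h.selfAdjoint.mem_spectrum_eq_re hz).symm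
    have hzr : z.re ∈ spectrum ℝ C := by
      rw [← spectrum.algebraMap_mem_iff ℂ]
      simpa [hz'] using hz
    refine ⟨⟨spectrum_nonneg_of_nonneg h.nonneg hzr, ?_⟩, hz'⟩
    have := (le_algebraMap_iff_spectrum_le (R := ℝ) (r := 1) (a := C) h.selfAdjoint).1 (by
      simpa using h.le_one)
    exact this _ hzr
  let σ : C(spectrum ℂ C, unitInterval) := ⟨fun z => ⟨(z : ℂ).re, (hs z z.2).1⟩, by fun_prop⟩
  have hC : IsStarNormal C := h.selfAdjoint.isStarNormal
  refine ⟨(cfcHom hC).comp (σ.compStarAlgHom' ℂ ℂ), ?_⟩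
  have : σ.compStarAlgHom' ℂ ℂ coord = (ContinuousMap.id ℂ).restrict (spectrum ℂ C) := by
    ext z
    exact (hs z z.2).2
  rw [StarAlgHom.comp_apply, this, cfcHom_id]

theorem norm_calculus_le (Φ : C(unitInterval, ℂ) →⋆ₐ[ℂ] (H →L[ℂ] H)) (f : C(unitInterval, ℂ)) :
    ‖Φ f‖ ≤ ‖f‖ := NonUnitalStarAlgHom.norm_apply_le Φ f

theorem inner_calculus (Φ : C(unitInterval, ℂ) →⋆ₐ[ℂ] (H →L[ℂ] H)) (f : C(unitInterval, ℂ))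
    (a b : H) : ⟪Φ f a, b⟫_ℂ = ⟪a, Φ (star f) b⟫_ℂ := by
  rw [inner_apply_left_eq_star, map_star]

theorem commute_calculus (Φ : C(unitInterval, ℂ) →⋆ₐ[ℂ] (H →L[ℂ] H)) (f g : C(unitInterval, ℂ))
    (a : H) : Φ f (Φ g a) = Φ g (Φ f a) := by
  rw [← mul_apply_eq_comp, ← mul_apply_eq_comp, ← map_mul, ← map_mul, mul_comm]

theorem calculus_mul_apply (Φ : C(unitInterval, ℂ) →⋆ₐ[ℂ] (H →L[ℂ] H))
    (f g : C(unitInterval, ℂ)) (a : H) : Φ (f * g) a = Φ f (Φ g a) := by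
  rw [map_mul, mul_apply_eq_comp]

/-- The reflection `f ↦ conj (f (1 - ·))` on the unit interval. -/
noncomputable def UnitIntervalCalculus.reflect (f : C(unitInterval, ℂ)) : C(unitInterval, ℂ) :=
  star (f.comp ⟨unitInterval.symm, unitInterval.continuous_symm⟩)

theorem UnitIntervalCalculus.reflect_osc (t : ℝ) : reflect (osc t) = osc t := by
  ext c
  have h : logit (unitInterval.symm c) = -logit c := by
    simp only [logit, unitInterval.coe_symm_eq, sub_sub_cancel]
    rw [← Real.log_inv, inv_div]
  simp only [reflect, ContinuousMap.star_apply, ContinuousMap.comp_apply, ContinuousMap.coe_mk,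
    osc_apply, h, RCLike.star_def, map_mul, Complex.conj_ofReal, ← Complex.exp_conj,
    Complex.conj_I, unitInterval.coe_symm_eq, sub_sub_cancel, mul_comm (1 - (c : ℝ))]
  push_cast
  ring_nf

theorem IsProjectionPair.apply_calculus {C : H →L[ℂ] H} {A : H →L⋆[ℂ] H}
    (h : IsProjectionPair C A) {Φ : C(unitInterval, ℂ) →⋆ₐ[ℂ] (H →L[ℂ] H)} (hΦ : Φ coord = C)
    (f : C(unitInterval, ℂ)) (η : H) : A (Φ f η) = Φ (reflect f) (A η) := by
  have hcont : Continuous Φ := AddMonoidHomClass.continuous_of_bound Φ 1 fun f => by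
    rw [one_mul]
    exact norm_calculus_le Φ f
  have hrc : Continuous reflect := by
    unfold reflect
    exact (ContinuousMap.continuous_precomp _).star
  refine induction (p := fun f => ∀ η, A (Φ f η) = Φ (reflect f) (A η)) (fun z η => ?_)
    (fun η => ?_)
    (fun f g hf hg η => ?_) (fun f g hf hg η => ?_) ?_ f η
  · have : reflect (algebraMap ℂ _ z) = algebraMap ℂ _ (star z) := by
      ext c
      simp [reflect]
    rw [this, AlgHomClass.commutes, AlgHomClass.commutes]
    simp [Algebra.algebraMap_eq_smul_one]
  · have : reflect coord = 1 - coord := by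
      ext c
      simp [reflect, coord]
    rw [this, map_sub, map_one, hΦ, sub_apply, one_apply_eq_self, h.anticomm]
  · have : reflect (f + g) = reflect f + reflect g := by
      ext c
      simp [reflect]
    rw [this, map_add, map_add, add_apply, add_apply, map_add, hf, hg]
  · have : reflect (f * g) = reflect f * reflect g := by
      ext c
      simp [reflect]
    rw [this, calculus_mul_apply, calculus_mul_apply, hf, hg]
  · simp only [Set.ofPred_forall]
    refine isClosed_iInter fun η => isClosed_eq ?_ ?_
    · exact A.continuous.comp ((ContinuousLinearMap.apply ℂ H η).continuous.comp hcont)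
    · exact (ContinuousLinearMap.apply ℂ H (A η)).continuous.comp (hcont.comp hrc)

/-- The modular unitaries and the modular conjugation attached to a modular pair. -/
structure IsModularFlow (N M : StarSubalgebra ℂ (H →L[ℂ] H)) (ψ : H) (C : H →L[ℂ] H)
    (A : H →L⋆[ℂ] H) (Φ : C(unitInterval, ℂ) →⋆ₐ[ℂ] (H →L[ℂ] H)) (U : ℝ → H →L[ℂ] H)
    (J : H →L⋆[ℂ] H) : Prop extends IsModularPair N M ψ C A where
  calculus_coord : Φ coord = C
  dense : DenseRange (Φ (osc 0))
  U_apply : ∀ t η, U t (Φ (osc 0) η) = Φ (osc t) η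
  J_apply : ∀ η, J (Φ (osc 0) η) = A η

theorem IsModularPair.norm_osc {N M : StarSubalgebra ℂ (H →L[ℂ] H)} {ψ : H} {C : H →L[ℂ] H}
    {A : H →L⋆[ℂ] H} (m : IsModularPair N M ψ C A) {Φ : C(unitInterval, ℂ) →⋆ₐ[ℂ] (H →L[ℂ] H)}
    (hΦ : Φ coord = C) (t : ℝ) (η : H) : ‖Φ (osc t) η‖ = ‖A η‖ := by
  have h2 : ‖Φ (osc t) η‖ ^ 2 = ‖A η‖ ^ 2 := by
    rw [← re_inner_self_complex, ← re_inner_self_complex, inner_calculus, m.inner_comm, m.sq,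
      ← mul_apply_eq_comp, ← map_mul, star_osc, osc_mul_osc, neg_add_cancel, osc_zero_mul_self,
      map_mul, map_sub, map_one, hΦ, mul_apply_eq_comp, sub_apply, one_apply_eq_self,
      ← m.inner_C, inner_sub_right, inner_sub_left, m.inner_C (C η)]
  exact (pow_left_inj₀ (norm_nonneg _) (norm_nonneg _) two_ne_zero).1 h2

theorem IsCyclicPair.exists_isModularFlow {N M : StarSubalgebra ℂ (H →L[ℂ] H)} {ψ : H}
    (h : IsCyclicPair N M ψ) : ∃ C A Φ U J, IsModularFlow N M ψ C A Φ U J := by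
  obtain ⟨C, A, m⟩ := h.exists_isModularPair
  obtain ⟨Φ, hΦ⟩ := m.toIsProjectionPair.exists_calculus
  have hdense : DenseRange (Φ (osc 0)) := by
    have : (LinearMap.range (Φ (osc 0)).toLinearMap).topologicalClosure = ⊤ := by
      rw [Submodule.topologicalClosure_eq_top_iff, Submodule.eq_bot_iff]
      intro η hη
      have h0 : Φ (osc 0) η = 0 := by
        rw [← inner_self_eq_zero (𝕜 := ℂ), inner_calculus, star_osc, neg_zero, ← inner_conj_symm]
        exact (congrArg _ (hη _ ⟨Φ (osc 0) η, rfl⟩)).trans (map_zero _)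
      refine m.eq_zero_of_A h ?_
      rw [← norm_eq_zero, ← m.norm_osc hΦ 0, h0, norm_zero]
    exact Submodule.dense_iff_topologicalClosure_eq_top.2 this
  refine ⟨C, A, Φ, fun t => (Φ (osc t)).toLinearMap.extendOfNorm (Φ (osc 0)).toLinearMap,
    A.toLinearMap.extendOfNorm (Φ (osc 0)).toLinearMap, m, hΦ, hdense, fun t η => ?_, fun η => ?_⟩
  · exact LinearMap.extendOfNorm_eq (f := (Φ (osc t)).toLinearMap) (e := (Φ (osc 0)).toLinearMap)
      hdense ⟨1, fun x => by
        rw [one_mul]; exact ((m.norm_osc hΦ t x).trans (m.norm_osc hΦ 0 x).symm).le⟩ η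
  · exact LinearMap.extendOfNorm_eq (f := A.toLinearMap) (e := (Φ (osc 0)).toLinearMap)
      hdense ⟨1, fun x => by rw [one_mul]; exact (m.norm_osc hΦ 0 x).ge⟩ η

theorem UnitIntervalCalculus.norm_osc_apply_le (t : ℝ) (c : unitInterval) : ‖osc t c‖ ≤ 1 := by
  rw [osc_apply, norm_mul, mul_assoc, mul_comm Complex.I, ← Complex.ofReal_mul,
    Complex.norm_exp_ofReal_mul_I, mul_one, Complex.norm_of_nonneg (Real.sqrt_nonneg _),
    Real.sqrt_le_one]
  nlinarith [c.2.1, c.2.2]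

theorem UnitIntervalCalculus.eq_sqrt_mul_exp_logit {c : unitInterval} (h0 : (c : ℝ) ≠ 0)
    (h1 : 1 - (c : ℝ) ≠ 0) :
    (c : ℝ) = √((c : ℝ) * (1 - c)) * Real.exp (logit c / 2) ∧
      1 - (c : ℝ) = √((c : ℝ) * (1 - c)) * Real.exp (-(logit c / 2)) := by
  have hp0 : 0 < (c : ℝ) := lt_of_le_of_ne c.2.1 h0.symm
  have hp1 : 0 < 1 - (c : ℝ) := lt_of_le_of_ne (by linarith [c.2.2]) h1.symm
  have he : Real.exp (logit c / 2) = √((c : ℝ) / (1 - c)) := by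
    rw [logit, Real.exp_half, Real.exp_log (div_pos hp0 hp1)]
  rw [Real.exp_neg, he, ← Real.sqrt_inv, ← Real.sqrt_mul (mul_pos hp0 hp1).le,
    ← Real.sqrt_mul (mul_pos hp0 hp1).le, inv_div]
  constructor
  · rw [eq_comm, Real.sqrt_eq_iff_mul_self_eq (by positivity) hp0.le]
    field_simp
  · rw [eq_comm, Real.sqrt_eq_iff_mul_self_eq (by positivity) hp1.le]
    field_simp

open MeasureTheory in
/-- The scalar form of the resolvent formula. -/
theorem integral_osc_mul_osc (s : ℝ) (c c' : unitInterval) :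
    ∫ t : ℝ, Complex.exp (Complex.I * s * t) * ((Real.cosh (Real.pi * t))⁻¹ : ℝ) *
      (Real.exp s * ((osc t * coord) c * (osc (-t) * (1 - coord)) c') +
        (osc t * (1 - coord)) c * (osc (-t) * coord) c') =
      2 * Real.exp (s / 2) * ((osc 0 * osc 0) c * (osc 0 * osc 0) c') := by
  have hcon : ∀ t : ℝ, Complex.exp (Complex.I * s * t) * ((Real.cosh (Real.pi * t))⁻¹ : ℝ) *
      (Real.exp s * ((osc t * coord) c * (osc (-t) * (1 - coord)) c') +
        (osc t * (1 - coord)) c * (osc (-t) * coord) c') =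
      (((√((c : ℝ) * (1 - c)) * √((c' : ℝ) * (1 - c')) *
        (Real.exp s * (c * (1 - c')) + (1 - c) * c') : ℝ)) : ℂ) *
        (Complex.exp (Complex.I * (s + logit c - logit c' : ℝ) * t) *
          ((Real.cosh (Real.pi * t))⁻¹ : ℝ)) := fun t => by
    have : Complex.exp (Complex.I * (s + logit c - logit c' : ℝ) * t) =
        Complex.exp (Complex.I * s * t) * (Complex.exp (Complex.I * t * logit c) *
          Complex.exp (Complex.I * (-t : ℝ) * logit c')) := by
      rw [← Complex.exp_add, ← Complex.exp_add]
      push_cast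
      ring_nf
    rw [this]
    simp only [ContinuousMap.mul_apply, ContinuousMap.sub_apply, osc_apply, coord,
      ContinuousMap.coe_mk, ContinuousMap.one_apply]
    push_cast
    ring
  rw [integral_congr_ae (.of_forall hcon), integral_const_mul, integral_exp_mul_inv_cosh_pi]
  simp only [ContinuousMap.mul_apply, osc_zero_apply, ← Complex.ofReal_mul]
  rw [← Complex.ofReal_ofNat, ← Complex.ofReal_mul, ← Complex.ofReal_mul, Complex.ofReal_inj]
  by_cases hd : (c : ℝ) * (1 - c) = 0
  · simp [hd]
  by_cases hd' : (c' : ℝ) * (1 - c') = 0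
  · simp [hd']
  obtain ⟨e1, e2⟩ := eq_sqrt_mul_exp_logit (left_ne_zero_of_mul hd) (right_ne_zero_of_mul hd)
  obtain ⟨e3, e4⟩ := eq_sqrt_mul_exp_logit (left_ne_zero_of_mul hd') (right_ne_zero_of_mul hd')
  have key : Real.exp s * (c * (1 - c')) + (1 - c) * c' =
      √((c : ℝ) * (1 - c)) * √((c' : ℝ) * (1 - c')) *
        (2 * Real.exp (s / 2) * Real.cosh ((s + logit c - logit c') / 2)) := by
    set d := √((c : ℝ) * (1 - c))
    set d' := √((c' : ℝ) * (1 - c'))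
    have h1 : Real.exp s * (Real.exp (logit c / 2) * Real.exp (-(logit c' / 2))) =
        Real.exp (s / 2) * Real.exp ((s + logit c - logit c') / 2) := by
      simp only [← Real.exp_add]
      ring_nf
    have h2 : Real.exp (-(logit c / 2)) * Real.exp (logit c' / 2) =
        Real.exp (s / 2) * Real.exp (-((s + logit c - logit c') / 2)) := by
      simp only [← Real.exp_add]
      ring_nf
    rw [e2, e4, Real.cosh_eq]
    calc Real.exp s * (c * (d' * Real.exp (-(logit c' / 2)))) + d * Real.exp (-(logit c / 2)) * c'
        = Real.exp s * (d * Real.exp (logit c / 2) * (d' * Real.exp (-(logit c' / 2)))) +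
          d * Real.exp (-(logit c / 2)) * (d' * Real.exp (logit c' / 2)) := by rw [← e1, ← e3]
      _ = _ := by linear_combination (d * d') * h1 + (d * d') * h2
  rw [key]
  have := (Real.cosh_pos ((s + logit c - logit c') / 2)).ne'
  field_simp

open MeasureTheory in
theorem integral_bilinear_osc {β : C(unitInterval, ℂ) →ₗ[ℂ] C(unitInterval, ℂ) →ₗ[ℂ] ℂ}
    (hc : Continuous fun p : C(unitInterval, ℂ) × C(unitInterval, ℂ) => β p.1 p.2) {K : ℝ}
    (hK : ∀ f g, ‖f‖ ≤ 1 → ‖g‖ ≤ 1 → ‖β f g‖ ≤ K) (s : ℝ) :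
    ∫ t : ℝ, Complex.exp (Complex.I * s * t) * ((Real.cosh (Real.pi * t))⁻¹ : ℝ) *
      (Real.exp s * β (osc t * coord) (osc (-t) * (1 - coord)) +
        β (osc t * (1 - coord)) (osc (-t) * coord)) =
      2 * Real.exp (s / 2) * β (osc 0 * osc 0) (osc 0 * osc 0) := by
  set B : ℕ → C(unitInterval, ℂ) → C(unitInterval, ℂ) := fun n f =>
    ∑ k : Fin (n + 1), f (bernstein.z k) • bern n k with hB
  have hβ : ∀ n f g, β (B n f) (B n g) = ∑ k : Fin (n + 1), ∑ l : Fin (n + 1),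
      f (bernstein.z k) * g (bernstein.z l) * β (bern n k) (bern n l) := fun n f g => by
    simp only [hB, map_sum, map_smul, LinearMap.sum_apply, LinearMap.smul_apply, Finset.mul_sum,
      smul_eq_mul, mul_assoc]
    rw [Finset.sum_comm]
    refine Finset.sum_congr rfl fun k _ => Finset.sum_congr rfl fun l _ => by ring
  have hlim : ∀ f g, Tendsto (fun n => β (B n f) (B n g)) atTop (𝓝 (β f g)) := fun f g =>
    (hc.tendsto (f, g)).comp ((tendsto_sum_bern f).prodMk_nhds (tendsto_sum_bern g))
  have hexp : ∀ t : ℝ, ‖Complex.exp (Complex.I * s * t)‖ = 1 := fun t => by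
    rw [mul_assoc, mul_comm, ← Complex.ofReal_mul, Complex.norm_exp_ofReal_mul_I]
  have hκ : ∀ t : ℝ, ‖(((Real.cosh (Real.pi * t))⁻¹ : ℝ) : ℂ)‖ = (Real.cosh (Real.pi * t))⁻¹ :=
    fun t => Complex.norm_of_nonneg (inv_nonneg.2 (Real.cosh_pos _).le)
  have hn1 : ∀ t, ‖osc t * coord‖ ≤ 1 ∧ ‖osc t * (1 - coord)‖ ≤ 1 := fun t => by
    constructor <;> refine (ContinuousMap.norm_le _ zero_le_one).2 fun c => ?_ <;>
      rw [ContinuousMap.mul_apply, norm_mul] <;>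
      refine mul_le_one₀ (norm_osc_apply_le t c) (norm_nonneg _) ?_
    · simpa [coord, abs_of_nonneg c.2.1] using c.2.2
    · have : (1 - coord) c = ((1 - c : ℝ) : ℂ) := by simp [coord]
      rw [this, Complex.norm_of_nonneg (by linarith [c.2.2])]
      linarith [c.2.1]
  have hbd : ∀ n f g, ‖f‖ ≤ 1 → ‖g‖ ≤ 1 → ‖β (B n f) (B n g)‖ ≤ K := fun n f g hf hg =>
    hK _ _ ((norm_sum_bern_le n f).trans hf) ((norm_sum_bern_le n g).trans hg)
  let G : (C(unitInterval, ℂ) → C(unitInterval, ℂ) → ℂ) → ℝ → ℂ := fun γ t =>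
    Complex.exp (Complex.I * s * t) * ((Real.cosh (Real.pi * t))⁻¹ : ℝ) *
      (Real.exp s * γ (osc t * coord) (osc (-t) * (1 - coord)) +
        γ (osc t * (1 - coord)) (osc (-t) * coord))
  have hG : ∀ γ t, G γ t = Complex.exp (Complex.I * s * t) * ((Real.cosh (Real.pi * t))⁻¹ : ℝ) *
      (Real.exp s * γ (osc t * coord) (osc (-t) * (1 - coord)) +
        γ (osc t * (1 - coord)) (osc (-t) * coord)) := fun γ t => rfl
  clear_value G
  have hcontk : ∀ c c', Continuous (G fun f g => f c * g c') := fun c c' => by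
    have h1 : Continuous fun t : ℝ => (((Real.cosh (Real.pi * t))⁻¹ : ℝ) : ℂ) :=
      Complex.continuous_ofReal.comp (Continuous.inv₀ (by fun_prop) fun t => (Real.cosh_pos _).ne')
    have h2 : ∀ c, Continuous fun t => osc t c := fun c => by
      simp only [osc_apply]
      fun_prop
    have h3 := h2 c
    have h4 := (h2 c').comp continuous_neg
    rw [funext (hG fun f g => f c * g c')]
    simp only [ContinuousMap.mul_apply]
    exact (Continuous.mul (by fun_prop) h1).mul (((h3.mul continuous_const).mul
      (h4.mul continuous_const)).const_mul _ |>.add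
        ((h3.mul continuous_const).mul (h4.mul continuous_const)))
  have hGbd : ∀ (γ : C(unitInterval, ℂ) → C(unitInterval, ℂ) → ℂ) (K : ℝ),
      (∀ f g, ‖f‖ ≤ 1 → ‖g‖ ≤ 1 → ‖γ f g‖ ≤ K) → ∀ t,
      ‖G γ t‖ ≤ ((Real.exp s + 1) * K) * (Real.cosh (Real.pi * t))⁻¹ := fun γ K hγ t => by
    simp only [hG]
    rw [norm_mul, norm_mul, hexp, hκ, one_mul, mul_comm]
    refine mul_le_mul_of_nonneg_right ?_ (inv_nonneg.2 (Real.cosh_pos _).le)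
    refine (norm_add_le _ _).trans ?_
    rw [norm_mul, Complex.norm_of_nonneg (Real.exp_pos s).le, add_mul, one_mul]
    exact add_le_add (mul_le_mul_of_nonneg_left (hγ _ _ (hn1 _).1 (hn1 _).2) (Real.exp_pos s).le)
      (hγ _ _ (hn1 _).2 (hn1 _).1)
  have hint : ∀ c c', Integrable (G fun f g => f c * g c') := fun c c' => by
    refine (integrable_inv_cosh_pi.const_mul ((Real.exp s + 1) * 1)).mono'
      (hcontk c c').aestronglyMeasurable (.of_forall (hGbd _ 1 fun f g hf hg => ?_))
    rw [norm_mul]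
    exact mul_le_one₀ ((f.norm_coe_le_norm c).trans hf) (norm_nonneg _)
      ((g.norm_coe_le_norm c').trans hg)
  have hGn : ∀ n t, G (fun f g => β (B n f) (B n g)) t = ∑ k : Fin (n + 1), ∑ l : Fin (n + 1),
      G (fun f g => f (bernstein.z k) * g (bernstein.z l)) t * β (bern n k) (bern n l) :=
    fun n t => by
      simp only [hG, hβ, Finset.mul_sum, ← Finset.sum_add_distrib]
      refine Finset.sum_congr rfl fun k _ => Finset.sum_congr rfl fun l _ => by ring
  have hGint : ∀ n, Integrable (G fun f g => β (B n f) (B n g)) := fun n => by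
    rw [funext (hGn n)]
    exact integrable_finsetSum _ fun k _ => integrable_finsetSum _ fun l _ =>
      (hint _ _).mul_const _
  have heq : ∀ n, ∫ t, G (fun f g => β (B n f) (B n g)) t =
      2 * Real.exp (s / 2) * β (B n (osc 0 * osc 0)) (B n (osc 0 * osc 0)) := fun n => by
    rw [funext (hGn n), integral_finsetSum _ fun k _ => integrable_finsetSum _ fun l _ =>
      (hint _ _).mul_const _, hβ, Finset.mul_sum]
    refine Finset.sum_congr rfl fun k _ => ?_
    rw [integral_finsetSum _ fun l _ => (hint _ _).mul_const _, Finset.mul_sum]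
    refine Finset.sum_congr rfl fun l _ => ?_
    rw [integral_mul_const]
    rw [funext (hG fun f g => f (bernstein.z k) * g (bernstein.z l)), integral_osc_mul_osc]
    ring
  rw [← funext (hG fun f g => β f g)]
  refine tendsto_nhds_unique (tendsto_integral_of_dominated_convergence
    (F := fun n => G fun f g => β (B n f) (B n g)) (f := G fun f g => β f g) (μ := volume) _
    (fun n => (hGint n).aestronglyMeasurable)
    (integrable_inv_cosh_pi.const_mul ((Real.exp s + 1) * K))
    (fun n => .of_forall (hGbd _ _ (hbd n))) (.of_forall fun t => ?_)) ?_
  · simp only [hG]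
    exact (((hlim _ _).const_mul _).add (hlim _ _)).const_mul _
  · rw [funext heq]
    exact (hlim _ _).const_mul _

theorem UnitIntervalCalculus.continuous_osc : Continuous osc := by
  refine ContinuousMap.continuous_of_continuous_uncurry _ ?_
  change Continuous fun q : ℝ × unitInterval => osc q.1 q.2
  simp only [osc_apply]
  have hn : ∀ (t : ℝ) (c : unitInterval), ‖Complex.exp (Complex.I * t * logit c)‖ = 1 :=
    fun t c => by
    rw [mul_assoc, mul_comm, ← Complex.ofReal_mul, Complex.norm_exp_ofReal_mul_I]
  rw [continuous_iff_continuousAt]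
  rintro ⟨t, c⟩
  by_cases hc : (c : ℝ) * (1 - c) = 0
  · rw [ContinuousAt]
    simp only [hc, Real.sqrt_zero, Complex.ofReal_zero, zero_mul]
    refine squeeze_zero_norm (a := fun q : ℝ × unitInterval => √((q.2 : ℝ) * (1 - q.2)))
      (fun q => ?_) ?_
    · rw [norm_mul, hn, mul_one, Complex.norm_of_nonneg (Real.sqrt_nonneg _)]
    · have : Continuous fun q : ℝ × unitInterval => √((q.2 : ℝ) * (1 - q.2)) := by fun_prop
      simpa [hc] using this.tendsto (t, c)
  · have h1 : (c : ℝ) ≠ 0 := left_ne_zero_of_mul hc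
    have h2 : 1 - (c : ℝ) ≠ 0 := right_ne_zero_of_mul hc
    have : ContinuousAt (fun q : ℝ × unitInterval => logit q.2) (t, c) := by
      unfold logit
      exact ContinuousAt.log (ContinuousAt.div (by fun_prop) (by fun_prop) h2) (div_ne_zero h1 h2)
    refine ContinuousAt.mul (by fun_prop) ?_
    fun_prop

namespace IsModularFlow

variable {N M : StarSubalgebra ℂ (H →L[ℂ] H)} {ψ : H} {C : H →L[ℂ] H}
  {A : H →L⋆[ℂ] H} {Φ : C(unitInterval, ℂ) →⋆ₐ[ℂ] (H →L[ℂ] H)} {U : ℝ → H →L[ℂ] H}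
  {J : H →L⋆[ℂ] H}

theorem dense_comp (m : IsModularFlow N M ψ C A Φ U J) :
    DenseRange fun η => Φ (osc 0) (Φ (osc 0) η) :=
  m.dense.comp m.dense (Φ (osc 0)).continuous

theorem A_osc (m : IsModularFlow N M ψ C A Φ U J) (t : ℝ) (η : H) :
    A (Φ (osc t) η) = Φ (osc t) (A η) := by
  rw [m.apply_calculus m.calculus_coord, reflect_osc]

theorem A_A (m : IsModularFlow N M ψ C A Φ U J) (η : H) :
    A (A η) = Φ (osc 0) (Φ (osc 0) η) := by
  rw [m.sq, ← calculus_mul_apply, osc_zero_mul_self, map_mul, map_sub, map_one, m.calculus_coord,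
    mul_apply_eq_comp, sub_apply, one_apply_eq_self, map_sub]

theorem J_J (m : IsModularFlow N M ψ C A Φ U J) (η : H) : J (J η) = η := by
  refine congrFun (m.dense_comp.equalizer (J.continuous.comp J.continuous) continuous_id
    (funext fun η => ?_)) η
  change J (J (Φ (osc 0) (Φ (osc 0) η))) = _
  rw [m.J_apply, m.A_osc, m.J_apply, m.A_A]
  rfl

theorem inner_J (m : IsModularFlow N M ψ C A Φ U J) (η ζ : H) : ⟪J η, ζ⟫_ℂ = ⟪J ζ, η⟫_ℂ := by
  refine m.dense.induction_on₂ (p := fun η ζ => ⟪J η, ζ⟫_ℂ = ⟪J ζ, η⟫_ℂ)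
    (isClosed_eq (by fun_prop) (by fun_prop)) (fun η ζ => ?_) η ζ
  rw [m.J_apply, m.J_apply, m.inner_comm, m.A_osc, inner_calculus, star_osc, neg_zero]

theorem U_calculus (m : IsModularFlow N M ψ C A Φ U J) (t : ℝ) (f : C(unitInterval, ℂ)) (η : H) :
    U t (Φ f η) = Φ f (U t η) := by
  refine congrFun (m.dense.equalizer ((U t).continuous.comp (Φ f).continuous)
    ((Φ f).continuous.comp (U t).continuous) (funext fun η => ?_)) η
  change U t (Φ f (Φ (osc 0) η)) = Φ f (U t (Φ (osc 0) η))
  rw [commute_calculus, m.U_apply, m.U_apply, commute_calculus]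

theorem U_U (m : IsModularFlow N M ψ C A Φ U J) (s t : ℝ) (η : H) :
    U s (U t η) = U (s + t) η := by
  refine congrFun (m.dense_comp.equalizer ((U s).continuous.comp (U t).continuous)
    (U (s + t)).continuous (funext fun η => ?_)) η
  change U s (U t (Φ (osc 0) (Φ (osc 0) η))) = U (s + t) (Φ (osc 0) (Φ (osc 0) η))
  rw [m.U_apply, m.U_calculus, m.U_apply, m.U_apply, ← calculus_mul_apply, ← calculus_mul_apply,
    mul_comm, osc_mul_osc, mul_comm]

theorem U_zero (m : IsModularFlow N M ψ C A Φ U J) (η : H) : U 0 η = η := by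
  refine congrFun (m.dense.equalizer (U 0).continuous continuous_id (funext fun η => ?_)) η
  exact m.U_apply 0 η

theorem J_calculus (m : IsModularFlow N M ψ C A Φ U J) (f : C(unitInterval, ℂ)) (η : H) :
    J (Φ f η) = Φ (reflect f) (J η) := by
  refine congrFun (m.dense.equalizer (J.continuous.comp (Φ f).continuous)
    ((Φ (reflect f)).continuous.comp J.continuous) (funext fun η => ?_)) η
  change J (Φ f (Φ (osc 0) η)) = Φ (reflect f) (J (Φ (osc 0) η))
  rw [commute_calculus, m.J_apply, m.J_apply, m.apply_calculus m.calculus_coord]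

theorem inner_U (m : IsModularFlow N M ψ C A Φ U J) (t : ℝ) (a b : H) :
    ⟪U t a, b⟫_ℂ = ⟪a, U (-t) b⟫_ℂ := by
  refine m.dense.induction_on₂ (p := fun a b => ⟪U t a, b⟫_ℂ = ⟪a, U (-t) b⟫_ℂ)
    (isClosed_eq (by fun_prop) (by fun_prop)) (fun a b => ?_) a b
  rw [m.U_apply, m.U_apply, inner_calculus, inner_calculus, star_osc, star_osc, neg_zero,
    commute_calculus]

theorem norm_U (m : IsModularFlow N M ψ C A Φ U J) (t : ℝ) (a : H) : ‖U t a‖ = ‖a‖ := by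
  refine (pow_left_inj₀ (norm_nonneg _) (norm_nonneg _) two_ne_zero).1 ?_
  rw [← re_inner_self_complex, ← re_inner_self_complex, m.inner_U, m.U_U, neg_add_cancel, m.U_zero]

theorem norm_J (m : IsModularFlow N M ψ C A Φ U J) (a : H) : ‖J a‖ = ‖a‖ := by
  refine (pow_left_inj₀ (norm_nonneg _) (norm_nonneg _) two_ne_zero).1 ?_
  rw [← re_inner_self_complex, ← re_inner_self_complex, m.inner_J, m.J_J]

theorem A_eq (m : IsModularFlow N M ψ C A Φ U J) (η : H) : A η = Φ (osc 0) (J η) := by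
  rw [← m.J_apply, m.J_calculus, reflect_osc]

theorem two_smul_C (m : IsModularFlow N M ψ C A Φ U J) : (2 : ℂ) • C ψ = ψ := by
  have h1 := m.left 1 (one_mem _)
  have h2 := m.right 1 (one_mem _)
  rw [star_one, one_apply_eq_self] at h1 h2
  rw [h1] at h2
  rw [two_smul]
  nth_rewrite 1 [h2]
  exact sub_add_cancel _ _

theorem calculus_vacuum (m : IsModularFlow N M ψ C A Φ U J) (f : C(unitInterval, ℂ)) :
    Φ f ψ = f ⟨1 / 2, by norm_num, by norm_num⟩ • ψ := by
  set c : unitInterval := ⟨1 / 2, by norm_num, by norm_num⟩ with hc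
  have hcont : Continuous Φ := AddMonoidHomClass.continuous_of_bound Φ 1 fun f => by
    rw [one_mul]
    exact norm_calculus_le Φ f
  refine induction (p := fun f => Φ f ψ = f c • ψ) (fun z => ?_) ?_
    (fun f g hf hg => ?_) (fun f g hf hg => ?_) ?_ f
  · rw [AlgHomClass.commutes]
    simp [Algebra.algebraMap_eq_smul_one]
  · rw [m.calculus_coord]
    nth_rewrite 2 [← m.two_smul_C]
    rw [smul_smul]
    simp [coord, hc]
  · rw [map_add, add_apply, hf, hg, ContinuousMap.add_apply, add_smul]
  · rw [calculus_mul_apply, hg, map_smul, hf, ContinuousMap.mul_apply, mul_comm, mul_smul]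
  · exact isClosed_eq ((ContinuousLinearMap.apply ℂ H ψ).continuous.comp hcont)
      ((continuous_eval_const c).smul continuous_const)

theorem osc_vacuum (m : IsModularFlow N M ψ C A Φ U J) (t : ℝ) :
    Φ (osc t) ψ = (1 / 2 : ℂ) • ψ := by
  rw [m.calculus_vacuum, osc_apply]
  have h1 : (1 / 2 : ℝ) * (1 - 1 / 2) = (1 / 2) ^ 2 := by norm_num
  have h2 : logit ⟨1 / 2, by norm_num, by norm_num⟩ = 0 := by
    rw [logit, show (1 / 2 : ℝ) / (1 - 1 / 2) = 1 by norm_num, Real.log_one]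
  rw [h2, h1, Real.sqrt_sq (by norm_num)]
  simp

theorem U_vacuum (m : IsModularFlow N M ψ C A Φ U J) (t : ℝ) : U t ψ = ψ := by
  have h := congrArg (U t) (m.osc_vacuum 0)
  rw [m.U_apply, m.osc_vacuum, map_smul] at h
  exact ((smul_right_inj (by norm_num)).1 h).symm

theorem J_vacuum (m : IsModularFlow N M ψ C A Φ U J) : J ψ = ψ := by
  have h1 := m.J_apply ψ
  have h2 := m.left 1 (one_mem _)
  rw [star_one, one_apply_eq_self, ← m.calculus_coord, m.calculus_vacuum] at h2
  rw [h2, m.osc_vacuum, map_smulₛₗ] at h1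
  have h3 : (starRingEnd ℂ) (1 / 2) = 1 / 2 := by rw [map_div₀, map_one, map_ofNat]
  rw [h3] at h1
  refine (smul_right_inj (by norm_num : (1 / 2 : ℂ) ≠ 0)).1 (h1.trans ?_)
  simp [coord]

theorem sqrtCoord'_J (h : IsCyclicPair N M ψ) (m : IsModularFlow N M ψ C A Φ U J)
    {x : H →L[ℂ] H} (hx : x ∈ N) (hs : IsSelfAdjoint x) :
    Φ sqrtCoord' (J (x ψ)) = Φ sqrtCoord (x ψ) := by
  have h1 := m.left x hx
  rw [hs.star_eq, m.A_eq, ← m.calculus_coord, ← sqrtCoord_mul, ← sqrtCoord_mul_sqrtCoord',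
    calculus_mul_apply, calculus_mul_apply, ← sub_eq_zero, ← map_sub] at h1
  refine sub_eq_zero.1 (m.eq_zero_of_C h ?_)
  rw [← m.calculus_coord, ← sqrtCoord_mul, calculus_mul_apply, h1, map_zero]

theorem sqrtCoord_J (h : IsCyclicPair N M ψ) (m : IsModularFlow N M ψ C A Φ U J)
    {x : H →L[ℂ] H} (hx : x ∈ M) (hs : IsSelfAdjoint x) :
    Φ sqrtCoord (J (x ψ)) = Φ sqrtCoord' (x ψ) := by
  have h0 : ∀ η, η - C η = Φ sqrtCoord' (Φ sqrtCoord' η) := fun η => by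
    rw [← calculus_mul_apply, sqrtCoord'_mul, map_sub, map_one, m.calculus_coord, sub_apply,
      one_apply_eq_self]
  have h1 := m.right x hx
  rw [hs.star_eq, m.A_eq, h0, ← sqrtCoord_mul_sqrtCoord', mul_comm, calculus_mul_apply,
    ← sub_eq_zero, ← map_sub] at h1
  refine sub_eq_zero.1 (m.eq_zero_of_one_sub_C h ?_)
  rw [h0, h1, map_zero]

theorem continuous_U (m : IsModularFlow N M ψ C A Φ U J) (η : H) : Continuous fun t => U t η := by
  refine continuous_of_uniform_approx_of_continuous fun u hu => ?_
  obtain ⟨ε, hε, hu⟩ := Metric.mem_uniformity_dist.1 hu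
  obtain ⟨ζ, hζ⟩ := Metric.denseRange_iff.1 m.dense η ε hε
  refine ⟨fun t => Φ (osc t) ζ, ?_, fun t => hu ?_⟩
  · have hcont : Continuous Φ := AddMonoidHomClass.continuous_of_bound Φ 1 fun f => by
      rw [one_mul]
      exact norm_calculus_le Φ f
    exact (ContinuousLinearMap.apply ℂ H ζ).continuous.comp (hcont.comp continuous_osc)
  · change dist (U t η) (Φ (osc t) ζ) < ε
    rwa [← m.U_apply, dist_eq_norm, ← map_sub, m.norm_U, ← dist_eq_norm]

end IsModularFlow

/-- The linear operator `J x J` for an antilinear operator `J`. -/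
noncomputable def antiConj {E : Type*} [NormedAddCommGroup E] [InnerProductSpace ℂ E]
    (J : E →L⋆[ℂ] E) (x : E →L[ℂ] E) : E →L[ℂ] E := J.comp (x.comp J)

theorem antiConj_apply {E : Type*} [NormedAddCommGroup E] [InnerProductSpace ℂ E]
    (J : E →L⋆[ℂ] E) (x : E →L[ℂ] E) (η : E) : antiConj J x η = J (x (J η)) := rfl

namespace IsModularFlow

variable {N M : StarSubalgebra ℂ (H →L[ℂ] H)} {ψ : H} {C : H →L[ℂ] H}
  {A : H →L⋆[ℂ] H} {Φ : C(unitInterval, ℂ) →⋆ₐ[ℂ] (H →L[ℂ] H)} {U : ℝ → H →L[ℂ] H}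
  {J : H →L⋆[ℂ] H}

theorem norm_antiConj_apply_le (m : IsModularFlow N M ψ C A Φ U J) (x : H →L[ℂ] H) (η : H) :
    ‖antiConj J x η‖ ≤ ‖x‖ * ‖η‖ := by
  rw [antiConj_apply, m.norm_J, ← m.norm_J η]
  exact x.le_opNorm _

theorem norm_flow_apply_le (m : IsModularFlow N M ψ C A Φ U J) (x : H →L[ℂ] H) (t : ℝ) (η : H) :
    ‖U t (antiConj J x (U (-t) η))‖ ≤ ‖x‖ * ‖η‖ := by
  rw [m.norm_U, ← m.norm_U (-t) η]
  exact m.norm_antiConj_apply_le x _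

theorem continuous_flow (m : IsModularFlow N M ψ C A Φ U J) (x : H →L[ℂ] H) (η ζ : H) :
    Continuous fun t => ⟪η, U t (antiConj J x (U (-t) ζ))⟫_ℂ := by
  have : ∀ t, ⟪η, U t (antiConj J x (U (-t) ζ))⟫_ℂ = ⟪U (-t) η, antiConj J x (U (-t) ζ)⟫_ℂ :=
    fun t => by rw [m.inner_U, neg_neg]
  simp_rw [this]
  exact ((m.continuous_U η).comp continuous_neg).inner
    ((antiConj J x).continuous.comp ((m.continuous_U ζ).comp continuous_neg))

theorem integral_flow_of_sakai (h : IsCyclicPair N M ψ) (m : IsModularFlow N M ψ C A Φ U J)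
    {x x' : H →L[ℂ] H} (hx' : x' ∈ N) (hx : x ∈ M) {s : ℝ}
    (hS : ∀ z ∈ M, ⟪z ψ, x' ψ⟫_ℂ = (Real.exp s : ℝ) * ⟪z ψ, x ψ⟫_ℂ + ⟪star x ψ, star z ψ⟫_ℂ)
    (η ζ : H) :
    ∫ t : ℝ, Complex.exp (Complex.I * s * t) * ((Real.cosh (Real.pi * t))⁻¹ : ℝ) *
      ⟪η, U t (antiConj J (star x') (U (-t) ζ))⟫_ℂ = 2 * Real.exp (s / 2) * ⟪η, x ζ⟫_ℂ := by
  have hcont : Continuous Φ := AddMonoidHomClass.continuous_of_bound Φ 1 fun f => by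
    rw [one_mul]
    exact norm_calculus_le Φ f
  refine m.dense_comp.induction_on₂ (p := fun η ζ => ∫ t : ℝ, Complex.exp (Complex.I * s * t) *
    ((Real.cosh (Real.pi * t))⁻¹ : ℝ) * ⟪η, U t (antiConj J (star x') (U (-t) ζ))⟫_ℂ =
      2 * Real.exp (s / 2) * ⟪η, x ζ⟫_ℂ) (isClosed_eq ?_ (by fun_prop)) (fun η ζ => ?_) η ζ
  · rw [continuous_iff_continuousAt]
    rintro ⟨η, ζ⟩
    have hκ : Continuous fun t : ℝ => Complex.exp (Complex.I * s * t) *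
        ((Real.cosh (Real.pi * t))⁻¹ : ℝ) := by
      refine Continuous.mul (by fun_prop) (Complex.continuous_ofReal.comp
        (Continuous.inv₀ (by fun_prop) fun t => (Real.cosh_pos _).ne'))
    refine MeasureTheory.continuousAt_of_dominated
      (bound := fun t => (‖η‖ + 1) * (‖star x'‖ * (‖ζ‖ + 1)) * (Real.cosh (Real.pi * t))⁻¹)
      (.of_forall fun q => (hκ.mul (m.continuous_flow _ _ _)).aestronglyMeasurable) ?_
      (integrable_inv_cosh_pi.const_mul _) (.of_forall fun t => ?_)
    · have h1 : ∀ᶠ q : H × H in 𝓝 (η, ζ), ‖q.1‖ < ‖η‖ + 1 :=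
        (continuous_fst.norm.tendsto (η, ζ)).eventually (gt_mem_nhds (by simp))
      have h2 : ∀ᶠ q : H × H in 𝓝 (η, ζ), ‖q.2‖ < ‖ζ‖ + 1 :=
        (continuous_snd.norm.tendsto (η, ζ)).eventually (gt_mem_nhds (by simp))
      filter_upwards [h1, h2] with q hq1 hq2
      refine .of_forall fun t => ?_
      rw [norm_mul, norm_mul, mul_assoc Complex.I, mul_comm Complex.I, ← Complex.ofReal_mul,
        Complex.norm_exp_ofReal_mul_I, one_mul,
        Complex.norm_of_nonneg (inv_nonneg.2 (Real.cosh_pos _).le), mul_comm]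
      refine mul_le_mul_of_nonneg_right ?_ (inv_nonneg.2 (Real.cosh_pos _).le)
      refine (norm_inner_le_norm _ _).trans ?_
      have := m.norm_flow_apply_le (star x') t q.2
      have := norm_nonneg (star x')
      gcongr
      exact (m.norm_flow_apply_le (star x') t q.2).trans (by gcongr)
    · refine Continuous.continuousAt ?_
      fun_prop
  · set β : C(unitInterval, ℂ) →ₗ[ℂ] C(unitInterval, ℂ) →ₗ[ℂ] ℂ :=
      LinearMap.mk₂ ℂ (fun f g => ⟪η, Φ f (x (Φ g ζ))⟫_ℂ)
        (fun f f' g => by rw [map_add, add_apply, inner_add_right])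
        (fun c f g => by rw [map_smul, smul_apply, inner_smul_right, smul_eq_mul])
        (fun f g g' => by rw [map_add, add_apply, map_add, map_add, inner_add_right])
        (fun c f g => by
          rw [map_smul, smul_apply, map_smul, map_smul, inner_smul_right, smul_eq_mul])
    have hβ : ∀ f g, β f g = ⟪η, Φ f (x (Φ g ζ))⟫_ℂ := fun f g => rfl
    have h1 := integral_bilinear_osc (β := β) (K := ‖η‖ * (‖x‖ * ‖ζ‖))
      (by simp only [hβ]; fun_prop) (fun f g hf hg => ?_) s
    · simp only [hβ] at h1
      convert h1 using 2
      · ext t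
        congr 1
        have h2 : ∀ a, Φ (1 - coord) a = a - C a := fun a => by
          rw [map_sub, map_one, m.calculus_coord, sub_apply, one_apply_eq_self]
        rw [mul_comm (osc (-t)), mul_comm (osc (-t))]
        simp only [calculus_mul_apply, h2, m.calculus_coord]
        rw [← inner_smul_right, ← inner_add_right, ← map_smul, ← map_add,
          show (x (C (Φ (osc (-t)) ζ)) - C (x (C (Φ (osc (-t)) ζ)))) =
            A (star x' (A (Φ (osc (-t)) ζ))) - ((Real.exp s : ℝ) : ℂ) •
              C (x (Φ (osc (-t)) ζ - C (Φ (osc (-t)) ζ))) by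
            rw [m.conj_apply_of_sakai h hx' hx hS, add_sub_cancel_left],
          add_sub_cancel]
        have h3 : A (Φ (osc (-t)) ζ) = J (U (-t) (Φ (osc 0) (Φ (osc 0) ζ))) := by
          rw [m.U_apply, commute_calculus, m.J_apply]
        have h4 : ∀ a, Φ (osc t) (A a) = Φ (osc 0) (Φ (osc 0) (U t (J a))) := fun a => by
          rw [m.A_eq, ← m.U_apply, m.U_calculus, m.U_calculus]
        rw [h3, h4, inner_calculus, inner_calculus, star_osc, neg_zero, antiConj_apply]
      · rw [calculus_mul_apply, calculus_mul_apply, inner_calculus, inner_calculus, star_osc,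
          neg_zero]
    · refine (norm_inner_le_norm _ _).trans (mul_le_mul_of_nonneg_left ?_ (norm_nonneg _))
      refine ((Φ f).le_of_opNorm_le ((norm_calculus_le Φ f).trans hf) _).trans ?_
      rw [one_mul]
      refine (x.le_opNorm _).trans (mul_le_mul_of_nonneg_left ?_ (norm_nonneg _))
      refine ((Φ g).le_of_opNorm_le ((norm_calculus_le Φ g).trans hg) _).trans ?_
      rw [one_mul]

theorem commute_flow (h : IsCyclicPair N M ψ) (m : IsModularFlow N M ψ C A Φ U J)
    {x y : H →L[ℂ] H} (hx : x ∈ N) (hy : y ∈ N) (t : ℝ) (ζ : H) :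
    U t (antiConj J x (U (-t) (y ζ))) = y (U t (antiConj J x (U (-t) ζ))) := by
  refine ext_inner_left ℂ fun η => ?_
  have hκ : Continuous fun t : ℝ => (((Real.cosh (Real.pi * t))⁻¹ : ℝ) : ℂ) :=
    Complex.continuous_ofReal.comp (Continuous.inv₀ (by fun_prop) fun t => (Real.cosh_pos _).ne')
  have hint : ∀ η ζ, MeasureTheory.Integrable fun t : ℝ => (((Real.cosh (Real.pi * t))⁻¹ : ℝ) : ℂ) *
      ⟪η, U t (antiConj J x (U (-t) ζ))⟫_ℂ := fun η ζ => by
    refine (integrable_inv_cosh_pi.const_mul (‖η‖ * (‖x‖ * ‖ζ‖))).mono'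
      (hκ.mul (m.continuous_flow x η ζ)).aestronglyMeasurable (.of_forall fun t => ?_)
    rw [norm_mul, Complex.norm_of_nonneg (inv_nonneg.2 (Real.cosh_pos _).le), mul_comm]
    refine mul_le_mul_of_nonneg_right ?_ (inv_nonneg.2 (Real.cosh_pos _).le)
    exact (norm_inner_le_norm _ _).trans
      (mul_le_mul_of_nonneg_left (m.norm_flow_apply_le x t ζ) (norm_nonneg _))
  have key := eq_zero_of_integral_exp_mul_eq_zero
    (F := fun t => (((Real.cosh (Real.pi * t))⁻¹ : ℝ) : ℂ) *
      ⟪η, U t (antiConj J x (U (-t) (y ζ)))⟫_ℂ - (((Real.cosh (Real.pi * t))⁻¹ : ℝ) : ℂ) *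
      ⟪star y η, U t (antiConj J x (U (-t) ζ))⟫_ℂ)
    ((hκ.mul (m.continuous_flow x _ _)).sub (hκ.mul (m.continuous_flow x _ _)))
    ((hint _ _).sub (hint _ _)) fun s => ?_
  · have h1 := congrFun key t
    simp only [Pi.zero_apply, ← mul_sub] at h1
    have h2 := (mul_eq_zero.1 h1).resolve_left
      (Complex.ofReal_ne_zero.2 (inv_ne_zero (Real.cosh_pos _).ne'))
    rw [sub_eq_zero.1 h2, inner_apply_left_eq_star, star_star]
  · obtain ⟨z, hz, hS⟩ := h.exists_sakai (star_mem hx) (Real.exp_pos s)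
    have h1 := m.integral_flow_of_sakai h (star_mem hx) hz hS η (y ζ)
    have h2 := m.integral_flow_of_sakai h (star_mem hx) hz hS (star y η) ζ
    rw [star_star] at h1 h2
    simp only [mul_assoc, mul_sub] at h1 h2 ⊢
    rw [MeasureTheory.integral_sub, h1, h2, inner_apply_left_eq_star, star_star,
      show z (y ζ) = y (z ζ) from DFunLike.congr_fun ((h.mem_iff z).1 hz y hy).eq ζ, sub_self]
    all_goals
      refine MeasureTheory.Integrable.bdd_mul (c := 1) (hint _ _)
        (Continuous.aestronglyMeasurable (by fun_prop)) (.of_forall fun t => ?_)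
      rw [← Complex.ofReal_mul, Complex.norm_exp_I_mul_ofReal]

end IsModularFlow

/-- The standard character of `ℤ / n`. -/
noncomputable def dftChar (n : ℕ) (x : ℤ) : ℂ :=
  Complex.exp (((-(2 * Real.pi * x / n) : ℝ) : ℂ) * Complex.I)

theorem dftChar_add (n : ℕ) (x y : ℤ) : dftChar n (x + y) = dftChar n x * dftChar n y := by
  rw [dftChar, dftChar, dftChar, ← Complex.exp_add, ← add_mul, ← Complex.ofReal_add]
  push_cast
  ring_nf

theorem dftChar_zero (n : ℕ) : dftChar n 0 = 1 := by
  simp [dftChar]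

theorem star_dftChar (n : ℕ) (x : ℤ) : (starRingEnd ℂ) (dftChar n x) = dftChar n (-x) := by
  rw [dftChar, dftChar, ← Complex.exp_conj, map_mul, Complex.conj_I, Complex.conj_ofReal]
  push_cast
  ring_nf

theorem dftChar_mul_natCast (n : ℕ) (x : ℤ) (k : ℕ) : dftChar n (x * k) = dftChar n x ^ k := by
  induction k with
  | zero => simp [dftChar_zero]
  | succ k ih => rw [pow_succ, ← ih, ← dftChar_add]; push_cast; ring_nf

theorem sum_dftChar {n a b : ℕ} (ha : a < n) (hb : b < n) :
    ∑ k ∈ Finset.range n, dftChar n (((a : ℤ) - b) * k) = if a = b then (n : ℂ) else 0 := by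
  split_ifs with h
  · simp [h, dftChar_zero]
  · have hn : (n : ℝ) ≠ 0 := by
      have : 0 < n := by omega
      positivity
    have h1 : dftChar n ((a : ℤ) - b) ≠ 1 := fun h1 => by
      rw [dftChar, Complex.exp_eq_one_iff] at h1
      obtain ⟨z, hz⟩ := h1
      have h2 : ((-(2 * Real.pi * ((a : ℤ) - b : ℤ) / n) : ℝ) : ℂ) =
          ((z * (2 * Real.pi) : ℝ) : ℂ) := by
        refine mul_right_cancel₀ Complex.I_ne_zero (hz.trans ?_)
        push_cast
        ring
      rw [Complex.ofReal_inj] at h2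
      have h3 : ((b : ℤ) - a : ℝ) = z * n := by
        have := Real.pi_ne_zero
        field_simp at h2
        push_cast at h2 ⊢
        linarith
      have h4 : (b : ℤ) - a = z * n := by exact_mod_cast h3
      have h5 : (n : ℤ) ∣ (b : ℤ) - a := ⟨z, by rw [h4, mul_comm]⟩
      have h6 := Int.eq_zero_of_abs_lt_dvd h5 (by rw [abs_lt]; constructor <;> omega)
      omega
    simp_rw [dftChar_mul_natCast]
    rw [geom_sum_eq h1, ← dftChar_mul_natCast]
    have : dftChar n (((a : ℤ) - b) * n) = 1 := by
      rw [dftChar, Complex.exp_eq_one_iff]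
      refine ⟨(b : ℤ) - a, ?_⟩
      have hn' : (n : ℂ) ≠ 0 := by exact_mod_cast hn
      push_cast
      field_simp
      ring
    rw [this, sub_self, zero_div]

/-- Parseval's identity for the finite Fourier transform. -/
theorem sum_norm_sq_dft_of_sign {E : Type*} [NormedAddCommGroup E] [InnerProductSpace ℂ E] {n : ℕ}
    (hn : 0 < n) {σ : ℤ} (hσ : σ = 1 ∨ σ = -1) (l : ℤ) (v : ℕ → E) :
    ∑ k ∈ Finset.range n,
        ‖(n : ℂ)⁻¹ • ∑ r ∈ Finset.range n, dftChar n (σ * (k - l) * r) • v r‖ ^ 2 =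
      (n : ℝ)⁻¹ * ∑ r ∈ Finset.range n, ‖v r‖ ^ 2 := by
  have hn' : (n : ℂ) ≠ 0 := by exact_mod_cast hn.ne'
  rw [← Complex.ofReal_inj]
  push_cast
  have h1 : ∀ x : E, (‖x‖ : ℂ) ^ 2 = ⟪x, x⟫_ℂ := fun x => (inner_self_eq_norm_sq_to_K x).symm
  simp_rw [h1, inner_smul_left, inner_smul_right, sum_inner, inner_sum, inner_smul_left,
    inner_smul_right, star_dftChar, map_inv₀, Complex.conj_natCast, ← Finset.mul_sum]
  have h2 : ∑ k ∈ Finset.range n, ∑ r ∈ Finset.range n, ∑ s ∈ Finset.range n,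
      dftChar n (-(σ * ((k : ℤ) - l) * r)) * (dftChar n (σ * ((k : ℤ) - l) * s) * ⟪v r, v s⟫_ℂ) =
      n * ∑ r ∈ Finset.range n, ⟪v r, v r⟫_ℂ := by
    rw [Finset.sum_comm, Finset.mul_sum]
    refine Finset.sum_congr rfl fun r hr => ?_
    rw [Finset.sum_comm]
    have h3 : ∀ s ∈ Finset.range n, ∑ k ∈ Finset.range n,
        dftChar n (-(σ * ((k : ℤ) - l) * r)) * (dftChar n (σ * ((k : ℤ) - l) * s) *
          ⟪v r, v s⟫_ℂ) = if s = r then (n : ℂ) * ⟪v r, v r⟫_ℂ else 0 := fun s hs => by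
      have h4 : ∀ k : ℕ, dftChar n (-(σ * ((k : ℤ) - l) * r)) *
          (dftChar n (σ * ((k : ℤ) - l) * s) * ⟪v r, v s⟫_ℂ) =
          dftChar n (σ * ((s : ℤ) - r) * k) * (dftChar n (-(σ * l * (s - r))) *
            ⟪v r, v s⟫_ℂ) := fun k => by
        rw [← mul_assoc, ← mul_assoc, ← dftChar_add, ← dftChar_add]
        ring_nf
      have h5 : ∑ k ∈ Finset.range n, dftChar n (σ * ((s : ℤ) - r) * k) =
          if s = r then (n : ℂ) else 0 := by
        rcases hσ with rfl | rfl
        · simp_rw [one_mul]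
          exact sum_dftChar (Finset.mem_range.1 hs) (Finset.mem_range.1 hr)
        · simp_rw [neg_one_mul, neg_sub, eq_comm (a := s)]
          exact sum_dftChar (Finset.mem_range.1 hr) (Finset.mem_range.1 hs)
      simp_rw [h4]
      rw [← Finset.sum_mul, h5]
      split_ifs with h
      · rw [h, sub_self, mul_zero, neg_zero, dftChar_zero, one_mul]
      · rw [zero_mul]
    rw [Finset.sum_congr rfl h3, Finset.sum_ite_eq' _ r, if_pos hr]
  simp_rw [← Finset.mul_sum] at h2
  rw [h2]
  field_simp

theorem sum_norm_sq_dft {E : Type*} [NormedAddCommGroup E] [InnerProductSpace ℂ E] {n : ℕ}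
    (hn : 0 < n) (l : ℤ) (v : ℕ → E) :
    ∑ k ∈ Finset.range n, ‖(n : ℂ)⁻¹ • ∑ r ∈ Finset.range n, dftChar n ((k - l) * r) • v r‖ ^ 2 =
      (n : ℝ)⁻¹ * ∑ r ∈ Finset.range n, ‖v r‖ ^ 2 := by
  simpa only [one_mul] using sum_norm_sq_dft_of_sign hn (Or.inl rfl) l v

theorem sum_norm_sq_dft' {E : Type*} [NormedAddCommGroup E] [InnerProductSpace ℂ E] {n : ℕ}
    (hn : 0 < n) (k : ℤ) (v : ℕ → E) :
    ∑ l ∈ Finset.range n, ‖(n : ℂ)⁻¹ • ∑ r ∈ Finset.range n, dftChar n ((k - l) * r) • v r‖ ^ 2 =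
      (n : ℝ)⁻¹ * ∑ r ∈ Finset.range n, ‖v r‖ ^ 2 := by
  simpa only [neg_one_mul, neg_sub] using sum_norm_sq_dft_of_sign hn (Or.inr rfl) k v

/-- The squared modulus of the finite Fourier transform of `r ↦ exp (i r x)`. -/
noncomputable def dftKernel (n : ℕ) (x : ℝ) (j : ℤ) : ℝ :=
  ‖(n : ℂ)⁻¹ • ∑ r ∈ Finset.range n,
    dftChar n (j * r) • Complex.exp (((r * x : ℝ) : ℂ) * Complex.I)‖ ^ 2

theorem dftKernel_nonneg (n : ℕ) (x : ℝ) (j : ℤ) : 0 ≤ dftKernel n x j := sq_nonneg _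

theorem sum_dftKernel {n : ℕ} (hn : 0 < n) (x : ℝ) (l : ℤ) :
    ∑ k ∈ Finset.range n, dftKernel n x (k - l) = 1 := by
  have hn' : (n : ℝ) ≠ 0 := by positivity
  simp_rw [dftKernel]
  rw [sum_norm_sq_dft hn]
  simp_rw [Complex.norm_exp_ofReal_mul_I]
  simp [hn']

theorem sum_dftKernel' {n : ℕ} (hn : 0 < n) (x : ℝ) (k : ℤ) :
    ∑ l ∈ Finset.range n, dftKernel n x (k - l) = 1 := by
  have hn' : (n : ℝ) ≠ 0 := by positivity
  simp_rw [dftKernel]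
  rw [sum_norm_sq_dft' hn]
  simp_rw [Complex.norm_exp_ofReal_mul_I]
  simp [hn']

theorem dftKernel_mul_sin_sq_le {n : ℕ} (hn : 0 < n) (x : ℝ) (j : ℤ) :
    dftKernel n x j * Real.sin (x / 2 - Real.pi * j / n) ^ 2 ≤ 1 / (n : ℝ) ^ 2 := by
  have hn' : (n : ℝ) ≠ 0 := by positivity
  set z : ℂ := Complex.exp (((x - 2 * Real.pi * j / n : ℝ) : ℂ) * Complex.I) with hz
  have h1 : ∀ r : ℕ, dftChar n (j * r) • Complex.exp (((r * x : ℝ) : ℂ) * Complex.I) = z ^ r :=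
    fun r => by
      rw [dftChar, smul_eq_mul, ← Complex.exp_add, hz, ← Complex.exp_nat_mul]
      push_cast
      ring_nf
  have h2 : ‖z - 1‖ = 2 * |Real.sin (x / 2 - Real.pi * j / n)| := by
    rw [hz, mul_comm, Complex.norm_exp_I_mul_ofReal_sub_one, Real.norm_eq_abs, abs_mul, abs_two]
    ring_nf
  have h3 : ‖z ^ n - 1‖ ≤ 2 := by
    refine (norm_sub_le _ _).trans ?_
    rw [norm_pow, hz, Complex.norm_exp_ofReal_mul_I]
    norm_num
  have h4 : ‖(n : ℂ)⁻¹ • ∑ r ∈ Finset.range n, z ^ r‖ * ‖z - 1‖ ≤ 2 / n := by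
    rw [← norm_mul, smul_mul_assoc, geom_sum_mul, norm_smul, norm_inv, Complex.norm_natCast,
      div_eq_inv_mul]
    gcongr
  rw [dftKernel]
  simp_rw [h1]
  rw [h2] at h4
  have h5 : ‖(n : ℂ)⁻¹ • ∑ r ∈ Finset.range n, z ^ r‖ * |Real.sin (x / 2 - Real.pi * j / n)| ≤
      1 / n := by
    have : (2 : ℝ) / n = 2 * (1 / n) := by ring
    linarith
  rw [← sq_abs (Real.sin _), ← mul_pow, ← one_div_pow]
  gcongr

/-- The finite Fourier transform of the modular oscillations. -/
noncomputable def dftOsc (n : ℕ) (τ : ℝ) (j : ℤ) : C(unitInterval, ℂ) :=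
  (n : ℂ)⁻¹ • ∑ r ∈ Finset.range n, dftChar n (j * r) • osc (r * τ)

theorem norm_dftOsc_apply_sq (n : ℕ) (τ : ℝ) (j : ℤ) (c : unitInterval) :
    ‖dftOsc n τ j c‖ ^ 2 = (c : ℝ) * (1 - c) * dftKernel n (τ * logit c) j := by
  have hc : 0 ≤ (c : ℝ) * (1 - c) := mul_nonneg c.2.1 (sub_nonneg.2 c.2.2)
  have h : dftOsc n τ j c = (√((c : ℝ) * (1 - c)) : ℝ) * ((n : ℂ)⁻¹ • ∑ r ∈ Finset.range n,
      dftChar n (j * r) • Complex.exp (((r * (τ * logit c) : ℝ) : ℂ) * Complex.I)) := by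
    simp only [dftOsc, ContinuousMap.smul_apply, ContinuousMap.sum_apply, osc_apply, smul_eq_mul,
      Finset.mul_sum]
    refine Finset.sum_congr rfl fun r _ => ?_
    push_cast
    ring_nf
  rw [h, norm_mul, mul_pow, dftKernel, Complex.norm_real, Real.norm_eq_abs, sq_abs,
    Real.sq_sqrt hc]

theorem sq_exp_sub_exp_le (u v : ℝ) :
    (Real.exp u - Real.exp v) ^ 2 ≤ (u - v) ^ 2 * (Real.exp u ^ 2 + Real.exp v ^ 2) := by
  wlog h : v ≤ u generalizing u v
  · have := this v u (le_of_not_ge h)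
    nlinarith
  have h1 : Real.exp u - Real.exp v ≤ (u - v) * Real.exp u := by
    have h2 := Real.add_one_le_exp (v - u)
    have h3 : Real.exp v = Real.exp u * Real.exp (v - u) := by rw [← Real.exp_add]; ring_nf
    nlinarith [Real.exp_pos u]
  have h0 : 0 ≤ Real.exp u - Real.exp v := sub_nonneg.2 (Real.exp_le_exp.2 h)
  calc (Real.exp u - Real.exp v) ^ 2 ≤ ((u - v) * Real.exp u) ^ 2 := by gcongr
    _ ≤ _ := by nlinarith [mul_nonneg (sq_nonneg (u - v)) (sq_nonneg (Real.exp v))]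

/-- The truncated geometric probability weights. -/
noncomputable def expWeight (m : ℕ) (θ : ℝ) (k : ℕ) : ℝ :=
  Real.exp (-(k * θ)) / ∑ i ∈ Finset.range m, Real.exp (-(i * θ))

theorem expWeight_sum_pos {m : ℕ} (hm : 0 < m) (θ : ℝ) :
    0 < ∑ i ∈ Finset.range m, Real.exp (-(i * θ)) :=
  Finset.sum_pos (fun _ _ => Real.exp_pos _) (Finset.nonempty_range_iff.2 hm.ne')

theorem expWeight_nonneg (m : ℕ) (θ : ℝ) (k : ℕ) : 0 ≤ expWeight m θ k :=
  div_nonneg (Real.exp_pos _).le (Finset.sum_nonneg fun _ _ => (Real.exp_pos _).le)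

theorem sum_expWeight {m : ℕ} (hm : 0 < m) (θ : ℝ) :
    ∑ k ∈ Finset.range m, expWeight m θ k = 1 := by
  simp_rw [expWeight]
  rw [← Finset.sum_div, div_self (expWeight_sum_pos hm θ).ne']

theorem mul_one_sub_le_exp_neg_abs_logit {c : unitInterval} (h0 : (c : ℝ) ≠ 0)
    (h1 : 1 - (c : ℝ) ≠ 0) : (c : ℝ) * (1 - c) ≤ Real.exp (-|logit c|) := by
  obtain ⟨h2, h3⟩ := eq_sqrt_mul_exp_logit h0 h1
  have h4 : ∀ z : ℝ, Real.exp (-z) * Real.exp (z / 2) = Real.exp (-(z / 2)) := fun z => by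
    rw [← Real.exp_add]; ring_nf
  have hc0 := c.2.1
  have hc1 := c.2.2
  rcases abs_cases (logit c) with ⟨h, -⟩ | ⟨h, -⟩
  · have : 1 - (c : ℝ) = Real.exp (-logit c) * c := by
      linear_combination h3 - Real.exp (-logit c) * h2 - √((c : ℝ) * (1 - c)) * h4 (logit c)
    rw [h, this]
    nlinarith [Real.exp_pos (-logit c), mul_nonneg hc0 (sub_nonneg.2 hc1)]
  · have : (c : ℝ) = Real.exp (logit c) * (1 - c) := by
      have h5 : Real.exp (logit c) * Real.exp (-(logit c / 2)) = Real.exp (logit c / 2) := by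
        rw [← Real.exp_add]; ring_nf
      linear_combination h2 - Real.exp (logit c) * h3 - √((c : ℝ) * (1 - c)) * h5
    rw [h, neg_neg]
    nth_rw 1 [this]
    nlinarith [Real.exp_pos (logit c), mul_nonneg hc0 (sub_nonneg.2 hc1)]

theorem sq_sqrt_sub_sqrt_le {m : ℕ} (θ : ℝ) {c : unitInterval}
    (h0 : (c : ℝ) ≠ 0) (h1 : 1 - (c : ℝ) ≠ 0) (k l : ℕ) :
    (√(expWeight m θ l) * √(1 - c) - √(expWeight m θ k) * √(c : ℝ)) ^ 2 ≤
      (logit c - ((k : ℤ) - l : ℤ) * θ) ^ 2 / 4 *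
        (expWeight m θ l * (1 - c) + expWeight m θ k * c) := by
  obtain ⟨h2, h3⟩ := eq_sqrt_mul_exp_logit h0 h1
  set S := √((c : ℝ) * (1 - c)) with hS
  set Z := ∑ i ∈ Finset.range m, Real.exp (-(i * θ)) with hZ
  have hSZ : 0 ≤ S / Z := div_nonneg (Real.sqrt_nonneg _)
    (Finset.sum_nonneg fun _ _ => (Real.exp_pos _).le)
  have e1 : expWeight m θ l * (1 - c) =
      (√(S / Z) * Real.exp (-(l * θ) / 2 - logit c / 4)) ^ 2 := by
    rw [mul_pow, Real.sq_sqrt hSZ, h3, expWeight, ← hZ, ← Real.exp_nat_mul]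
    have : Real.exp (((2 : ℕ) : ℝ) * (-(l * θ) / 2 - logit c / 4)) =
      Real.exp (-(l * θ)) * Real.exp (-(logit c / 2)) := by rw [← Real.exp_add]; push_cast; ring_nf
    rw [this]; ring
  have e2 : expWeight m θ k * c =
      (√(S / Z) * Real.exp (-(k * θ) / 2 + logit c / 4)) ^ 2 := by
    rw [mul_pow, Real.sq_sqrt hSZ]
    nth_rw 1 [h2]
    rw [expWeight, ← hZ, ← Real.exp_nat_mul]
    have : Real.exp (((2 : ℕ) : ℝ) * (-(k * θ) / 2 + logit c / 4)) =
      Real.exp (-(k * θ)) * Real.exp (logit c / 2) := by rw [← Real.exp_add]; push_cast; ring_nf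
    rw [this]; ring
  rw [← Real.sqrt_mul (expWeight_nonneg _ _ _), ← Real.sqrt_mul (expWeight_nonneg _ _ _), e1, e2,
    Real.sqrt_sq (mul_nonneg (Real.sqrt_nonneg _) (Real.exp_pos _).le),
    Real.sqrt_sq (mul_nonneg (Real.sqrt_nonneg _) (Real.exp_pos _).le), ← mul_sub, mul_pow,
    Real.sq_sqrt hSZ]
  refine (mul_le_mul_of_nonneg_left (sq_exp_sub_exp_le _ _) hSZ).trans (le_of_eq ?_)
  rw [mul_pow, mul_pow, Real.sq_sqrt hSZ]
  push_cast
  ring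

theorem dftKernel_mul_sq_le {n : ℕ} (hn : 0 < n) {τ R y : ℝ} (hτ : 0 < τ) (hR : τ * R ≤ 1)
    (hy : |y| ≤ R) {j : ℤ} (hj : 4 * |j| ≤ n) :
    dftKernel n (τ * y) j * (y - j * (2 * Real.pi / (n * τ))) ^ 2 ≤
      Real.pi ^ 2 / (n ^ 2 * τ ^ 2) := by
  have hn' : (0 : ℝ) < n := by positivity
  have hpi := Real.pi_gt_three
  set φ := τ * y / 2 - Real.pi * j / n with hφ
  have h1 : |φ| ≤ Real.pi / 2 := by
    have h2 : |τ * y / 2| ≤ 1 / 2 := by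
      rw [abs_div, abs_mul, abs_of_pos hτ, abs_two]
      nlinarith
    have h3 : |Real.pi * j / n| ≤ Real.pi / 4 := by
      rw [abs_div, abs_mul, abs_of_pos Real.pi_pos, abs_of_pos hn',
        div_le_div_iff₀ hn' (by norm_num)]
      have : (4 : ℝ) * |(j : ℝ)| ≤ n := by exact_mod_cast hj
      nlinarith
    have := abs_sub (τ * y / 2) (Real.pi * j / n)
    rw [← hφ] at this
    linarith
  have h4 := Real.mul_abs_le_abs_sin h1
  have h5 : (2 / Real.pi * |φ|) ^ 2 ≤ Real.sin φ ^ 2 := by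
    rw [← sq_abs (Real.sin φ)]
    gcongr
  have h6 := dftKernel_mul_sin_sq_le hn (τ * y) j
  rw [← hφ] at h6
  have h7 : y - j * (2 * Real.pi / (n * τ)) = 2 / τ * φ := by
    rw [hφ]; field_simp
  have h8 := dftKernel_nonneg n (τ * y) j
  have h9 : dftKernel n (τ * y) j * (2 / Real.pi * |φ|) ^ 2 ≤ 1 / (n : ℝ) ^ 2 :=
    (mul_le_mul_of_nonneg_left h5 h8).trans h6
  rw [mul_pow, sq_abs] at h9
  rw [h7]
  calc _ = (Real.pi ^ 2 / τ ^ 2) * (dftKernel n (τ * y) j * ((2 / Real.pi) ^ 2 * φ ^ 2)) := by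
        field_simp
    _ ≤ (Real.pi ^ 2 / τ ^ 2) * (1 / (n : ℝ) ^ 2) := by gcongr
    _ = _ := by field_simp

theorem sum_dftOsc_mul_sq_le {n m : ℕ} (hm : 0 < m) (hmn : 4 * m ≤ n) {τ R : ℝ} (hτ : 0 < τ)
    (hR : τ * R ≤ 1) (c : unitInterval) :
    ∑ k ∈ Finset.range m, ∑ l ∈ Finset.range m, ‖dftOsc n τ (k - l) c‖ ^ 2 *
      (√(expWeight m (2 * Real.pi / (n * τ)) l) * √(1 - c) -
        √(expWeight m (2 * Real.pi / (n * τ)) k) * √(c : ℝ)) ^ 2 ≤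
      Real.pi ^ 2 / (n * τ ^ 2) + 2 * Real.exp (-R) := by
  have hn : 0 < n := by omega
  have hn' : (0 : ℝ) < n := by positivity
  set θ := 2 * Real.pi / (n * τ) with hθ
  set w := expWeight m θ with hw
  have hw0 : ∀ k, 0 ≤ w k := expWeight_nonneg m θ
  have hw1 : ∑ k ∈ Finset.range m, w k = 1 := sum_expWeight hm θ
  have hc0 := c.2.1
  have hc1 : 0 ≤ 1 - (c : ℝ) := sub_nonneg.2 c.2.2
  simp_rw [norm_dftOsc_apply_sq]
  have hpos : 0 ≤ Real.pi ^ 2 / (n * τ ^ 2) + 2 * Real.exp (-R) := by positivity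
  by_cases h0 : (c : ℝ) = 0
  · simpa [h0] using hpos
  by_cases h1 : 1 - (c : ℝ) = 0
  · simpa [h1] using hpos
  rcases le_or_gt |logit c| R with hy | hy
  · have hterm : ∀ k ∈ Finset.range m, ∀ l ∈ Finset.range m,
        (c : ℝ) * (1 - c) * dftKernel n (τ * logit c) (k - l) *
          (√(w l) * √(1 - c) - √(w k) * √(c : ℝ)) ^ 2 ≤
        Real.pi ^ 2 / (n ^ 2 * τ ^ 2) * (w l + w k) := fun k hk l hl => by
      have hj : 4 * |(k : ℤ) - l| ≤ n := by
        have := Finset.mem_range.1 hk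
        have := Finset.mem_range.1 hl
        rcases abs_cases ((k : ℤ) - l) with h | h <;> omega
      have e1 := sq_sqrt_sub_sqrt_le (m := m) θ h0 h1 k l
      have e2 := dftKernel_mul_sq_le hn hτ hR hy hj
      rw [← hθ] at e2
      rw [← hw] at e1
      have e3 := dftKernel_nonneg n (τ * logit c) (k - l)
      have e4 : w l * (1 - c) + w k * c ≤ w l + w k := by
        nlinarith [hw0 l, hw0 k]
      have e5 : 0 ≤ w l * (1 - c) + w k * c := by
        have := hw0 l; have := hw0 k; positivity
      have e6 : (c : ℝ) * (1 - c) ≤ 1 := by nlinarith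
      calc _ ≤ (c : ℝ) * (1 - c) * dftKernel n (τ * logit c) (k - l) *
            ((logit c - ((k : ℤ) - l : ℤ) * θ) ^ 2 / 4 * (w l * (1 - c) + w k * c)) := by gcongr
        _ = ((c : ℝ) * (1 - c) / 4) * (dftKernel n (τ * logit c) (k - l) *
            (logit c - ((k : ℤ) - l : ℤ) * θ) ^ 2) * (w l * (1 - c) + w k * c) := by ring
        _ ≤ 1 * (Real.pi ^ 2 / (n ^ 2 * τ ^ 2)) * (w l + w k) := by
            gcongr
            linarith
        _ = _ := by ring
    have hsum : ∑ k ∈ Finset.range m, ∑ l ∈ Finset.range m,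
        Real.pi ^ 2 / (n ^ 2 * τ ^ 2) * (w l + w k) ≤ Real.pi ^ 2 / (n * τ ^ 2) := by
      simp_rw [← Finset.mul_sum, Finset.sum_add_distrib, hw1]
      simp only [Finset.sum_const, Finset.card_range, nsmul_eq_mul, ← Finset.mul_sum, hw1, mul_one]
      rw [div_mul_eq_mul_div, div_le_div_iff₀ (by positivity) (by positivity)]
      have hm' : (m : ℝ) + m ≤ n := by
        have : (4 : ℝ) * m ≤ n := by exact_mod_cast hmn
        have : (0 : ℝ) ≤ m := by positivity
        linarith
      calc _ ≤ Real.pi ^ 2 * n * (n * τ ^ 2) := by gcongr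
        _ = _ := by ring
    refine ((Finset.sum_le_sum fun k hk => Finset.sum_le_sum fun l hl => hterm k hk l hl).trans
      hsum).trans ?_
    linarith [Real.exp_pos (-R)]
  · have e0 : (c : ℝ) * (1 - c) ≤ Real.exp (-R) :=
      (mul_one_sub_le_exp_neg_abs_logit h0 h1).trans (Real.exp_le_exp.2 (by linarith))
    have hterm : ∀ k l : ℕ, (c : ℝ) * (1 - c) * dftKernel n (τ * logit c) (k - l) *
          (√(w l) * √(1 - c) - √(w k) * √(c : ℝ)) ^ 2 ≤
        Real.exp (-R) * ((1 - c) * (w l * dftKernel n (τ * logit c) (k - l)) +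
          c * (w k * dftKernel n (τ * logit c) (k - l))) := fun k l => by
      have e3 := dftKernel_nonneg n (τ * logit c) (k - l)
      have e1 : (√(w l) * √(1 - c) - √(w k) * √(c : ℝ)) ^ 2 ≤ (1 - c) * w l + c * w k := by
        have f1 := Real.sq_sqrt (hw0 l)
        have f2 := Real.sq_sqrt (hw0 k)
        have f3 := Real.sq_sqrt hc0
        have f4 := Real.sq_sqrt hc1
        have f5 : 0 ≤ (√(w l) * √(1 - c)) * (√(w k) * √(c : ℝ)) := by positivity
        calc _ = √(w l) ^ 2 * √(1 - c) ^ 2 + √(w k) ^ 2 * √(c : ℝ) ^ 2 -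
              2 * ((√(w l) * √(1 - c)) * (√(w k) * √(c : ℝ))) := by ring
          _ ≤ _ := by rw [f1, f2, f3, f4]; linarith
      calc _ ≤ Real.exp (-R) * dftKernel n (τ * logit c) (k - l) *
            ((1 - c) * w l + c * w k) := by gcongr
        _ = _ := by ring
    have hs1 : ∑ k ∈ Finset.range m, ∑ l ∈ Finset.range m,
        w l * dftKernel n (τ * logit c) (k - l) ≤ 1 := by
      rw [Finset.sum_comm, ← hw1]
      simp_rw [← Finset.mul_sum]
      refine Finset.sum_le_sum fun l _ => mul_le_of_le_one_right (hw0 l) ?_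
      rw [← sum_dftKernel hn (τ * logit c) l]
      exact Finset.sum_le_sum_of_subset_of_nonneg (Finset.range_mono (by omega))
        fun _ _ _ => dftKernel_nonneg _ _ _
    have hs2 : ∑ k ∈ Finset.range m, ∑ l ∈ Finset.range m,
        w k * dftKernel n (τ * logit c) (k - l) ≤ 1 := by
      rw [← hw1]
      simp_rw [← Finset.mul_sum]
      refine Finset.sum_le_sum fun k _ => mul_le_of_le_one_right (hw0 k) ?_
      rw [← sum_dftKernel' hn (τ * logit c) k]
      exact Finset.sum_le_sum_of_subset_of_nonneg (Finset.range_mono (by omega))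
        fun _ _ _ => dftKernel_nonneg _ _ _
    refine (Finset.sum_le_sum fun k _ => Finset.sum_le_sum fun l _ => hterm k l).trans ?_
    simp_rw [← Finset.mul_sum] at hs1 hs2
    simp_rw [← Finset.mul_sum, Finset.sum_add_distrib, ← Finset.mul_sum]
    have hp : 0 ≤ Real.pi ^ 2 / (n * τ ^ 2) := by positivity
    calc _ ≤ Real.exp (-R) * 2 := mul_le_mul_of_nonneg_left (by nlinarith) (Real.exp_pos _).le
      _ ≤ _ := by linarith

theorem sin_le_sin_of_mem_Icc {α φ : ℝ} (h0 : 0 ≤ α) (h1 : α ≤ φ) (h2 : φ ≤ Real.pi - α) :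
    Real.sin α ≤ Real.sin φ := by
  rcases le_total φ (Real.pi / 2) with h | h
  · exact Real.sin_le_sin_of_le_of_le_pi_div_two (by linarith [Real.pi_pos]) h h1
  · rw [← Real.sin_pi_sub φ]
    exact Real.sin_le_sin_of_le_of_le_pi_div_two (by linarith [Real.pi_pos]) (by linarith)
      (by linarith)

theorem one_sub_le_sum_dftKernel {n m A l : ℕ} (hn : 0 < n) (hmn : m ≤ n) {τ a y : ℝ}
    (hτ : 0 < τ) (ha : 0 < a) (hA : |y| + a ≤ A * (2 * Real.pi / (n * τ))) (hAl : A ≤ l)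
    (hlA : l + A ≤ m) :
    1 - Real.pi ^ 2 / (n * a ^ 2 * τ ^ 2) ≤
      ∑ k ∈ Finset.range m, dftKernel n (τ * y) (k - l) := by
  have hn' : (0 : ℝ) < n := by positivity
  have hpi := Real.pi_pos
  have hA' : (|y| + a) * τ / 2 ≤ Real.pi * A / n := by
    calc _ ≤ A * (2 * Real.pi / (n * τ)) * τ / 2 := by gcongr
      _ = _ := by field_simp
  have hy1 : τ * y / 2 ≤ |y| * τ / 2 := by nlinarith [le_abs_self y]
  have hy2 : -(|y| * τ / 2) ≤ τ * y / 2 := by nlinarith [neg_abs_le y]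
  have hAn : Real.pi * A / n ≤ Real.pi / 2 := by
    have : (2 : ℝ) * A ≤ n := by exact_mod_cast (by omega : 2 * A ≤ n)
    rw [div_le_div_iff₀ hn' two_pos]
    nlinarith
  have hbad : ∀ k ∈ Finset.Ico m n, dftKernel n (τ * y) (k - l) ≤
      Real.pi ^ 2 / (n ^ 2 * a ^ 2 * τ ^ 2) := fun k hk => by
    rw [Finset.mem_Ico] at hk
    set φ := Real.pi * ((k : ℤ) - l : ℤ) / n - τ * y / 2 with hφ
    have h1 : Real.pi * A / n ≤ Real.pi * ((k : ℤ) - l : ℤ) / n := by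
      have : (A : ℝ) ≤ ((k : ℤ) - l : ℤ) := by exact_mod_cast (by omega : (A : ℤ) ≤ (k : ℤ) - l)
      gcongr
    have h2 : Real.pi * ((k : ℤ) - l : ℤ) / n ≤ Real.pi - Real.pi * A / n := by
      have : (((k : ℤ) - l : ℤ) : ℝ) ≤ n - A := by
        exact_mod_cast (by omega : (k : ℤ) - l ≤ (n : ℤ) - A)
      calc _ ≤ Real.pi * (n - A) / n := by gcongr
        _ = _ := by field_simp
    have haτ : 0 < a * τ := by positivity
    have h3 : a * τ / 2 ≤ φ := by linarith
    have h4 : φ ≤ Real.pi - a * τ / 2 := by linarith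
    have h5 := sin_le_sin_of_mem_Icc (by positivity) h3 h4
    have h6 := Real.mul_le_sin (x := a * τ / 2) (by positivity)
      (by have := mul_nonneg (abs_nonneg y) hτ.le; linarith)
    have h7 : a * τ / Real.pi ≤ Real.sin φ := by
      refine le_trans (le_of_eq ?_) (h6.trans h5)
      field_simp
    have h8 := dftKernel_mul_sin_sq_le hn (τ * y) (k - l)
    rw [show τ * y / 2 - Real.pi * ((k : ℤ) - l : ℤ) / n = -φ by rw [hφ]; ring, Real.sin_neg,
      neg_sq] at h8
    have h9 := dftKernel_nonneg n (τ * y) (k - l)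
    have h10 : dftKernel n (τ * y) (k - l) * (a * τ / Real.pi) ^ 2 ≤ 1 / (n : ℝ) ^ 2 :=
      le_trans (by gcongr) h8
    calc _ = (Real.pi / (a * τ)) ^ 2 * (dftKernel n (τ * y) (k - l) * (a * τ / Real.pi) ^ 2) := by
          field_simp
      _ ≤ (Real.pi / (a * τ)) ^ 2 * (1 / (n : ℝ) ^ 2) := by gcongr
      _ = _ := by field_simp
  have hsum := sum_dftKernel hn (τ * y) l
  rw [← Finset.sum_range_add_sum_Ico _ hmn] at hsum
  have h1 := Finset.sum_le_card_nsmul _ _ _ hbad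
  rw [Nat.card_Ico, nsmul_eq_mul] at h1
  have h2 : ((n - m : ℕ) : ℝ) * (Real.pi ^ 2 / (n ^ 2 * a ^ 2 * τ ^ 2)) ≤
      Real.pi ^ 2 / (n * a ^ 2 * τ ^ 2) := by
    calc _ ≤ (n : ℝ) * (Real.pi ^ 2 / (n ^ 2 * a ^ 2 * τ ^ 2)) := by
          gcongr
          exact_mod_cast Nat.sub_le n m
      _ = _ := by field_simp
  linarith

theorem exp_sub_exp_le_sum_expWeight {m A B : ℕ} (hm : 0 < m) (hAB : A ≤ B) {θ : ℝ}
    (hθ : 0 < θ) :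
    Real.exp (-(A * θ)) - Real.exp (-(B * θ)) ≤ ∑ l ∈ Finset.Ico A B, expWeight m θ l := by
  have hq : ∀ k : ℕ, Real.exp (-(k * θ)) = Real.exp (-θ) ^ k := fun k => by
    rw [← Real.exp_nat_mul]; ring_nf
  have hZ := expWeight_sum_pos hm θ
  simp_rw [expWeight]
  rw [← Finset.sum_div, le_div_iff₀ hZ]
  simp_rw [hq]
  set q := Real.exp (-θ) with hqdef
  have hq0 : 0 < q := Real.exp_pos _
  have hq1 : q < 1 := Real.exp_lt_one_iff.2 (by linarith)
  have h1 := geom_sum_Ico_mul_neg q hAB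
  have h2 := geom_sum_mul_neg q m
  have h3 : q ^ B ≤ q ^ A := pow_le_pow_of_le_one hq0.le hq1.le hAB
  have h4 : 0 < q ^ m := by positivity
  refine le_of_mul_le_mul_right ?_ (sub_pos.2 hq1)
  rw [mul_assoc, h2, h1]
  nlinarith

theorem half_sub_three_mul_abs_le {c : unitInterval} (h0 : (c : ℝ) ≠ 0)
    (h1 : 1 - (c : ℝ) ≠ 0) :
    1 / 2 - 3 * |(c : ℝ) - 1 / 2| ≤ (1 - c) * Real.exp (-|logit c|) := by
  have hp0 : 0 < (c : ℝ) := lt_of_le_of_ne c.2.1 h0.symm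
  have hp1 : 0 < 1 - (c : ℝ) := lt_of_le_of_ne (by linarith [c.2.2]) h1.symm
  have he : Real.exp (logit c) = c / (1 - c) := by rw [logit, Real.exp_log (div_pos hp0 hp1)]
  rcases abs_cases (logit c) with ⟨h, h'⟩ | ⟨h, h'⟩
  · rw [h, Real.exp_neg, he, inv_div, ← mul_div_assoc, le_div_iff₀ hp0]
    rcases abs_cases ((c : ℝ) - 1 / 2) with ⟨g, g'⟩ | ⟨g, g'⟩
    · rw [g]; nlinarith
    · rw [g]; nlinarith
  · rw [h, neg_neg, he, mul_div_cancel₀ _ h1]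
    rcases abs_cases ((c : ℝ) - 1 / 2) with ⟨g, g'⟩ | ⟨g, g'⟩ <;> linarith

theorem le_sum_dftOsc {n m : ℕ} (hm : 0 < m) (hmn : m ≤ n) {τ R a : ℝ} (hτ : 0 < τ)
    (ha : 0 < a) (hRm : 2 * (R + a + 2 * Real.pi / (n * τ)) ≤ m * (2 * Real.pi / (n * τ)))
    (c : unitInterval) :
    (c : ℝ) * (1 - c) * (1 / 2 - 3 * |(c : ℝ) - 1 / 2|) ≤
      (∑ k ∈ Finset.range m, ∑ l ∈ Finset.range m, ‖dftOsc n τ (k - l) c‖ ^ 2 *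
        (expWeight m (2 * Real.pi / (n * τ)) l * (1 - c))) +
      (Real.exp (-R) + Real.pi ^ 2 / (n * a ^ 2 * τ ^ 2) + (a + 2 * Real.pi / (n * τ)) +
        Real.exp (-(m * (2 * Real.pi / (n * τ)) - R - a - 2 * Real.pi / (n * τ)))) := by
  have hn : 0 < n := by omega
  have hn' : (0 : ℝ) < n := by positivity
  set θ := 2 * Real.pi / (n * τ) with hθ
  have hθ0 : 0 < θ := by have := Real.pi_pos; positivity
  set w := expWeight m θ with hw
  have hw0 : ∀ k, 0 ≤ w k := expWeight_nonneg m θ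
  have hw1 : ∑ k ∈ Finset.range m, w k = 1 := sum_expWeight hm θ
  have hc0 := c.2.1
  have hc1 : 0 ≤ 1 - (c : ℝ) := sub_nonneg.2 c.2.2
  set e := Real.pi ^ 2 / (n * a ^ 2 * τ ^ 2) with he
  have he0 : 0 ≤ e := by positivity
  set f := Real.exp (-(m * θ - R - a - θ)) with hf
  have hf0 : 0 < f := Real.exp_pos _
  have hR0 := Real.exp_pos (-R)
  have hsum0 : 0 ≤ ∑ k ∈ Finset.range m, ∑ l ∈ Finset.range m, ‖dftOsc n τ (k - l) c‖ ^ 2 *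
      (w l * (1 - c)) := Finset.sum_nonneg fun k _ => Finset.sum_nonneg fun l _ =>
    mul_nonneg (sq_nonneg _) (mul_nonneg (hw0 l) hc1)
  by_cases h0 : (c : ℝ) = 0
  · simp only [h0, zero_mul] at hsum0 ⊢; linarith
  by_cases h1 : 1 - (c : ℝ) = 0
  · simp only [h1, mul_zero, zero_mul] at hsum0 ⊢; linarith
  have hcc : 0 ≤ (c : ℝ) * (1 - c) := mul_nonneg hc0 hc1
  rcases le_or_gt |logit c| R with hy | hy
  · set y := logit c with hydef
    set A := ⌈(|y| + a) / θ⌉₊ with hAdef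
    have hA : |y| + a ≤ A * θ := (div_le_iff₀ hθ0).1 (Nat.le_ceil _)
    have hA' : A * θ ≤ |y| + a + θ := by
      have := (Nat.ceil_lt_add_one (div_nonneg (add_nonneg (abs_nonneg y) ha.le) hθ0.le)).le
      rw [← hAdef] at this
      calc _ ≤ ((|y| + a) / θ + 1) * θ := by gcongr
        _ = _ := by field_simp
    have hAm : 2 * A ≤ m := by
      have : (2 * A : ℝ) * θ ≤ m * θ := by linarith
      exact_mod_cast le_of_mul_le_mul_right this hθ0
    have hgeo := exp_sub_exp_le_sum_expWeight hm (by omega : A ≤ m - A) hθ0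
    rw [← hw] at hgeo
    have hB : Real.exp (-((m - A : ℕ) * θ)) ≤ f := by
      rw [hf, Nat.cast_sub (by omega)]
      exact Real.exp_le_exp.2 (by linarith)
    have hAexp : Real.exp (-|y|) - (a + θ) ≤ Real.exp (-(A * θ)) := by
      have h2 : Real.exp (-|y|) * Real.exp (-(a + θ)) ≤ Real.exp (-(A * θ)) := by
        rw [← Real.exp_add]
        exact Real.exp_le_exp.2 (by linarith)
      have h3 := Real.add_one_le_exp (-(a + θ))
      have h4 : Real.exp (-|y|) ≤ 1 := Real.exp_le_one_iff.2 (by simp)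
      nlinarith [Real.exp_pos (-|y|)]
    have hsub : Finset.Ico A (m - A) ⊆ Finset.range m := fun l hl => by
      rw [Finset.mem_Ico] at hl
      rw [Finset.mem_range]; omega
    have hIco : ∑ l ∈ Finset.Ico A (m - A), w l ≤ 1 := by
      rw [← hw1]
      exact Finset.sum_le_sum_of_subset_of_nonneg hsub fun _ _ _ => hw0 _
    have hlow : Real.exp (-|y|) - (a + θ) - f - e ≤
        ∑ l ∈ Finset.range m, w l * ∑ k ∈ Finset.range m, dftKernel n (τ * y) (k - l) := by
      calc _ ≤ (∑ l ∈ Finset.Ico A (m - A), w l) - e * ∑ l ∈ Finset.Ico A (m - A), w l := by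
            nlinarith
        _ = ∑ l ∈ Finset.Ico A (m - A), w l * (1 - e) := by
            rw [← Finset.sum_mul]; ring
        _ ≤ ∑ l ∈ Finset.Ico A (m - A), w l *
            ∑ k ∈ Finset.range m, dftKernel n (τ * y) (k - l) := by
            refine Finset.sum_le_sum fun l hl => mul_le_mul_of_nonneg_left ?_ (hw0 l)
            rw [Finset.mem_Ico] at hl
            exact one_sub_le_sum_dftKernel hn hmn hτ ha (hθ ▸ hA) hl.1 (by omega)
        _ ≤ _ := Finset.sum_le_sum_of_subset_of_nonneg hsub fun l _ _ =>
            mul_nonneg (hw0 l) (Finset.sum_nonneg fun _ _ => dftKernel_nonneg _ _ _)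
    have hval : ∑ k ∈ Finset.range m, ∑ l ∈ Finset.range m, ‖dftOsc n τ (k - l) c‖ ^ 2 *
        (w l * (1 - c)) = (c : ℝ) * (1 - c) * ((1 - c) *
        ∑ l ∈ Finset.range m, w l * ∑ k ∈ Finset.range m, dftKernel n (τ * y) (k - l)) := by
      rw [Finset.sum_comm]
      simp_rw [norm_dftOsc_apply_sq, Finset.mul_sum]
      refine Finset.sum_congr rfl fun l _ => Finset.sum_congr rfl fun k _ => ?_
      ring
    rw [hval]
    have h2 := half_sub_three_mul_abs_le h0 h1
    rw [← hydef] at h2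
    have h3 : (c : ℝ) * (1 - c) * (1 / 2 - 3 * |(c : ℝ) - 1 / 2|) ≤
        (c : ℝ) * (1 - c) * ((1 - c) * (∑ l ∈ Finset.range m, w l *
          ∑ k ∈ Finset.range m, dftKernel n (τ * y) (k - l)) + (e + (a + θ) + f)) := by
      refine mul_le_mul_of_nonneg_left ?_ hcc
      nlinarith
    have h4 : (c : ℝ) * (1 - c) ≤ 1 := by nlinarith
    nlinarith
  · have e0 : (c : ℝ) * (1 - c) ≤ Real.exp (-R) :=
      (mul_one_sub_le_exp_neg_abs_logit h0 h1).trans (Real.exp_le_exp.2 (by linarith))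
    have := abs_nonneg ((c : ℝ) - 1 / 2)
    nlinarith

/-- Parameters for which the Toeplitz discretization is accurate up to `ε`. -/
theorem exists_toeplitz_parameters {ε : ℝ} (hε : 0 < ε) :
    ∃ n m : ℕ, ∃ τ θ : ℝ, 0 < m ∧ m ≤ n ∧ ∀ c : unitInterval,
      ∑ k ∈ Finset.range m, ∑ l ∈ Finset.range m, ‖dftOsc n τ (k - l) c‖ ^ 2 *
        (√(expWeight m θ l) * √(1 - c) - √(expWeight m θ k) * √(c : ℝ)) ^ 2 ≤ ε ∧
      (c : ℝ) * (1 - c) * (1 / 2 - 3 * |(c : ℝ) - 1 / 2|) ≤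
        (∑ k ∈ Finset.range m, ∑ l ∈ Finset.range m, ‖dftOsc n τ (k - l) c‖ ^ 2 *
          (expWeight m θ l * (1 - c))) + ε := by
  obtain ⟨ν, hν⟩ := exists_nat_ge (max 4 (9 / ε))
  have hν4 : (4 : ℝ) ≤ ν := (le_max_left _ _).trans hν
  have hνε : 9 / ν ≤ ε := by
    rw [div_le_iff₀ (by linarith), mul_comm, ← div_le_iff₀ hε]
    exact (le_max_right _ _).trans hν
  have hν0 : (0 : ℝ) < ν := by linarith
  have hνn : 0 < ν := by exact_mod_cast hν0
  have hpi := Real.pi_gt_three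
  have hpi4 := Real.pi_le_four
  have hexp : ∀ x : ℝ, ν / 2 ≤ x → Real.exp (-x) ≤ 2 / ν := fun x hx => by
    rw [Real.exp_neg, ← one_div, div_le_div_iff₀ (Real.exp_pos _) hν0]
    linarith [Real.add_one_le_exp x]
  have hpi2 : Real.pi ^ 2 ≤ 16 := by nlinarith
  have hpow : (ν : ℝ) ≤ ν ^ 3 := by nlinarith [mul_pos hν0 hν0]
  have hpow' : (ν : ℝ) ≤ ν ^ 5 := by nlinarith [mul_pos hν0 hν0, mul_pos (mul_pos hν0 hν0) hν0]
  have hθ : 2 * Real.pi / ((8 * ν ^ 6 : ℕ) * (1 / ν : ℝ)) = Real.pi / 4 * (1 / ν ^ 5) := by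
    push_cast; field_simp; norm_num
  have hθ1 : Real.pi / 4 * (1 / ν ^ 5) ≤ 1 / (ν : ℝ) := by
    calc _ ≤ 1 * (1 / (ν : ℝ)) := by gcongr; linarith
      _ = _ := one_mul _
  have hmθ : (2 * ν ^ 6 : ℕ) * (Real.pi / 4 * (1 / (ν : ℝ) ^ 5)) = Real.pi / 2 * ν := by
    push_cast; field_simp; norm_num
  have hinv : 1 / (ν : ℝ) ≤ 1 / 4 := by gcongr
  have hn2 : Real.pi ^ 2 / ((8 * ν ^ 6 : ℕ) * (1 / ν : ℝ) ^ 2) ≤ 2 / ν := by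
    push_cast
    rw [div_le_div_iff₀ (by positivity) hν0]
    have : 2 * (8 * (ν : ℝ) ^ 6 * (1 / ν) ^ 2) = 16 * (ν * ν ^ 3) := by field_simp; norm_num
    rw [this]
    calc _ ≤ 16 * (ν * 1 : ℝ) := by nlinarith
      _ ≤ _ := by gcongr; linarith
  have hn4 : Real.pi ^ 2 / ((8 * ν ^ 6 : ℕ) * (1 / ν : ℝ) ^ 2 * (1 / ν : ℝ) ^ 2) ≤ 2 / ν := by
    push_cast
    rw [div_le_div_iff₀ (by positivity) hν0]
    have : 2 * (8 * (ν : ℝ) ^ 6 * (1 / ν) ^ 2 * (1 / ν) ^ 2) = 16 * (ν * ν) := by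
      field_simp; norm_num
    rw [this]
    calc _ ≤ 16 * (ν * 1 : ℝ) := by nlinarith
      _ ≤ _ := by gcongr; linarith
  refine ⟨8 * ν ^ 6, 2 * ν ^ 6, 1 / ν, Real.pi / 4 * (1 / ν ^ 5), by positivity,
    by nlinarith [Nat.zero_le (ν ^ 6)], fun c => ⟨?_, ?_⟩⟩
  · have h := sum_dftOsc_mul_sq_le (n := 8 * ν ^ 6) (m := 2 * ν ^ 6) (τ := 1 / ν) (R := ν / 2)
      (by positivity) (by omega) (by positivity) (by field_simp; norm_num) c
    rw [hθ] at h
    refine h.trans (le_trans ?_ hνε)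
    have := hexp (ν / 2) le_rfl
    have e : (9 : ℝ) / ν = 2 / ν + 2 * (2 / ν) + 3 / ν := by ring
    have : 0 ≤ 3 / (ν : ℝ) := by positivity
    linarith
  · have h := le_sum_dftOsc (n := 8 * ν ^ 6) (m := 2 * ν ^ 6) (τ := 1 / ν) (R := ν / 2)
      (a := 1 / ν) (by positivity) (by nlinarith [Nat.zero_le (ν ^ 6)]) (by positivity)
      (by positivity) (by rw [hθ, hmθ]; nlinarith) c
    rw [hθ, hmθ] at h
    refine h.trans (add_le_add le_rfl (le_trans ?_ hνε))
    have h1 := hexp (ν / 2) le_rfl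
    have h2 := hexp (Real.pi / 2 * ν - ν / 2 - 1 / ν - Real.pi / 4 * (1 / ν ^ 5)) (by nlinarith)
    have e : (9 : ℝ) / ν = 2 / ν + 2 / ν + (1 / ν + 1 / ν) + 2 / ν + 1 / ν := by ring
    have : 0 ≤ 1 / (ν : ℝ) := by positivity
    linarith

/-- A function with nonnegative real part has a nonnegative real quadratic form. -/
theorem re_inner_calculus_nonneg (Φ : C(unitInterval, ℂ) →⋆ₐ[ℂ] (H →L[ℂ] H))
    {f : C(unitInterval, ℂ)} (hf : ∀ c, 0 ≤ (f c).re) (η : H) : 0 ≤ (⟪η, Φ f η⟫_ℂ).re := by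
  let s : C(unitInterval, ℂ) := ⟨fun c => (√((f c).re) : ℝ), by fun_prop⟩
  have hs : f + star f = star s * s + star s * s := by
    ext c
    have := Real.mul_self_sqrt (hf c)
    simp only [ContinuousMap.add_apply, ContinuousMap.star_apply, ContinuousMap.mul_apply,
      ContinuousMap.coe_mk, RCLike.star_def, Complex.conj_ofReal, s, ← Complex.ofReal_mul, this]
    rw [Complex.add_conj]; push_cast; ring
  have h := congrArg (fun T : H →L[ℂ] H => (⟪η, T η⟫_ℂ).re) (congrArg Φ hs)
  simp only [map_add, add_apply, inner_add_right, Complex.add_re, calculus_mul_apply,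
    ← inner_calculus] at h
  rw [← inner_conj_symm (𝕜 := ℂ), Complex.conj_re, re_inner_self_complex,
    ← inner_conj_symm (𝕜 := ℂ), Complex.conj_re] at h
  have := sq_nonneg ‖Φ s η‖
  linarith

theorem sum_norm_sq_calculus {κ : Type*} (S : Finset κ) (Φ : C(unitInterval, ℂ) →⋆ₐ[ℂ] (H →L[ℂ] H))
    (g : κ → C(unitInterval, ℂ)) (η : H) :
    ∑ i ∈ S, ‖Φ (g i) η‖ ^ 2 = (⟪η, Φ (∑ i ∈ S, star (g i) * g i) η⟫_ℂ).re := by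
  rw [map_sum, sum_apply, inner_sum, Complex.re_sum]
  refine Finset.sum_congr rfl fun i _ => ?_
  rw [calculus_mul_apply, ← inner_calculus, re_inner_self_complex]

theorem UnitIntervalCalculus.re_star_mul_self (g : C(unitInterval, ℂ)) (c : unitInterval) :
    ((star g * g) c).re = ‖g c‖ ^ 2 := by
  rw [ContinuousMap.mul_apply, ContinuousMap.star_apply, RCLike.star_def, Complex.conj_mul',
    ← Complex.ofReal_pow, Complex.ofReal_re]

/-- A pointwise lower bound for a sum of squares passes to the functional calculus. -/
theorem le_sum_norm_sq_calculus {κ : Type*} (S : Finset κ)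
    (Φ : C(unitInterval, ℂ) →⋆ₐ[ℂ] (H →L[ℂ] H)) (g : κ → C(unitInterval, ℂ))
    (f : C(unitInterval, ℂ)) (ε : ℝ) (hg : ∀ c, (f c).re ≤ ∑ i ∈ S, ‖g i c‖ ^ 2 + ε) (η : H) :
    (⟪η, Φ f η⟫_ℂ).re ≤ ∑ i ∈ S, ‖Φ (g i) η‖ ^ 2 + ε * ‖η‖ ^ 2 := by
  have h := re_inner_calculus_nonneg Φ
    (f := ∑ i ∈ S, star (g i) * g i + algebraMap ℂ _ (ε : ℂ) - f) (fun c => by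
      rw [ContinuousMap.sub_apply, ContinuousMap.add_apply, Complex.sub_re, Complex.add_re,
        ContinuousMap.sum_apply, Complex.re_sum]
      simp only [re_star_mul_self]
      have := hg c
      simp only [Algebra.algebraMap_eq_smul_one, ContinuousMap.smul_apply, ContinuousMap.one_apply,
        smul_eq_mul, mul_one, Complex.ofReal_re]
      linarith) η
  rw [map_sub, map_add, sub_apply, add_apply, inner_sub_right, inner_add_right, Complex.sub_re,
    Complex.add_re, ← sum_norm_sq_calculus, AlgHomClass.commutes,
    ContinuousLinearMap.algebraMap_apply,
    inner_smul_right, Complex.re_ofReal_mul, re_inner_self_complex] at h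
  linarith

/-- A pointwise upper bound for a sum of squares passes to the functional calculus. -/
theorem sum_norm_sq_calculus_le {κ : Type*} (S : Finset κ)
    (Φ : C(unitInterval, ℂ) →⋆ₐ[ℂ] (H →L[ℂ] H)) (g : κ → C(unitInterval, ℂ))
    (f : C(unitInterval, ℂ)) (ε : ℝ) (hg : ∀ c, ∑ i ∈ S, ‖g i c‖ ^ 2 ≤ (f c).re + ε) (η : H) :
    ∑ i ∈ S, ‖Φ (g i) η‖ ^ 2 ≤ (⟪η, Φ f η⟫_ℂ).re + ε * ‖η‖ ^ 2 := by
  have h := re_inner_calculus_nonneg Φ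
    (f := f + algebraMap ℂ _ (ε : ℂ) - ∑ i ∈ S, star (g i) * g i) (fun c => by
      rw [ContinuousMap.sub_apply, ContinuousMap.add_apply, Complex.sub_re, Complex.add_re,
        ContinuousMap.sum_apply, Complex.re_sum]
      simp only [re_star_mul_self]
      have := hg c
      simp only [Algebra.algebraMap_eq_smul_one, ContinuousMap.smul_apply, ContinuousMap.one_apply,
        smul_eq_mul, mul_one, Complex.ofReal_re]
      linarith) η
  rw [map_sub, map_add, sub_apply, add_apply, inner_sub_right, inner_add_right, Complex.sub_re,
    Complex.add_re, ← sum_norm_sq_calculus, AlgHomClass.commutes,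
    ContinuousLinearMap.algebraMap_apply,
    inner_smul_right, Complex.re_ofReal_mul, re_inner_self_complex] at h
  linarith

/-- The continuous linear map into a finite Hilbert sum with given components. -/
noncomputable def columnOp {ι E F : Type*} [Fintype ι] [NormedAddCommGroup E]
    [InnerProductSpace ℂ E] [NormedAddCommGroup F] [InnerProductSpace ℂ F] (a : ι → E →L[ℂ] F) :
    E →L[ℂ] PiLp 2 (fun _ : ι => F) :=
  ((PiLp.continuousLinearEquiv 2 ℂ (fun _ : ι => F)).symm : _ →L[ℂ] _) ∘L ContinuousLinearMap.pi a

@[simp]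
theorem columnOp_apply {ι E F : Type*} [Fintype ι] [NormedAddCommGroup E]
    [InnerProductSpace ℂ E] [NormedAddCommGroup F] [InnerProductSpace ℂ F] (a : ι → E →L[ℂ] F)
    (η : E) (i : ι) : columnOp a η i = a i η := rfl

theorem norm_columnOp_apply_sq {ι E F : Type*} [Fintype ι] [NormedAddCommGroup E]
    [InnerProductSpace ℂ E] [NormedAddCommGroup F] [InnerProductSpace ℂ F] (a : ι → E →L[ℂ] F)
    (η : E) : ‖columnOp a η‖ ^ 2 = ∑ i, ‖a i η‖ ^ 2 := PiLp.norm_sq_eq_of_L2 _ _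

/-- The discrete Fourier coefficients of the modular flow. -/
noncomputable def dftFlow (U : ℝ → H →L[ℂ] H) (n : ℕ) (τ : ℝ) (j : ℤ) : H →L[ℂ] H :=
  (n : ℂ)⁻¹ • ∑ r ∈ Finset.range n, dftChar n (j * r) • U (r * τ)

/-- The truncated Toeplitz column of the modular flow, weighted by the column index. -/
noncomputable def leftFlow (U : ℝ → H →L[ℂ] H) (n m : ℕ) (τ θ : ℝ) :
    H →L[ℂ] PiLp 2 (fun _ : Fin m × Fin m => H) :=
  columnOp fun i => ((√(expWeight m θ i.2) : ℝ) : ℂ) • dftFlow U n τ ((i.1 : ℕ) - (i.2 : ℕ))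

/-- The truncated Toeplitz column of the modular flow, weighted by the row index. -/
noncomputable def rightFlow (U : ℝ → H →L[ℂ] H) (n m : ℕ) (τ θ : ℝ) :
    H →L[ℂ] PiLp 2 (fun _ : Fin m × Fin m => H) :=
  columnOp fun i => ((√(expWeight m θ i.1) : ℝ) : ℂ) • dftFlow U n τ ((i.1 : ℕ) - (i.2 : ℕ))

/-- The image of `√(1 - C) ρ` under `leftFlow`. -/
noncomputable def leftColumn (Φ : C(unitInterval, ℂ) →⋆ₐ[ℂ] (H →L[ℂ] H)) (U : ℝ → H →L[ℂ] H)
    (n m : ℕ) (τ θ : ℝ) : H →L[ℂ] PiLp 2 (fun _ : Fin m × Fin m => H) :=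
  leftFlow U n m τ θ ∘L Φ sqrtCoord'

/-- The image of `√C ρ` under `rightFlow`. -/
noncomputable def rightColumn (Φ : C(unitInterval, ℂ) →⋆ₐ[ℂ] (H →L[ℂ] H)) (U : ℝ → H →L[ℂ] H)
    (n m : ℕ) (τ θ : ℝ) : H →L[ℂ] PiLp 2 (fun _ : Fin m × Fin m => H) :=
  rightFlow U n m τ θ ∘L Φ sqrtCoord

namespace IsModularFlow

variable {N M : StarSubalgebra ℂ (H →L[ℂ] H)} {ψ : H} {C : H →L[ℂ] H} {A : H →L⋆[ℂ] H}
  {Φ : C(unitInterval, ℂ) →⋆ₐ[ℂ] (H →L[ℂ] H)} {U : ℝ → H →L[ℂ] H} {J : H →L⋆[ℂ] H}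

theorem dftFlow_osc (m : IsModularFlow N M ψ C A Φ U J) (n : ℕ) (τ : ℝ) (j : ℤ) (η : H) :
    dftFlow U n τ j (Φ (osc 0) η) = Φ (dftOsc n τ j) η := by
  simp [dftFlow, dftOsc, m.U_apply]

theorem dftFlow_calculus (m : IsModularFlow N M ψ C A Φ U J) (n : ℕ) (τ : ℝ) (j : ℤ)
    (f : C(unitInterval, ℂ)) (η : H) :
    dftFlow U n τ j (Φ f η) = Φ f (dftFlow U n τ j η) := by
  simp [dftFlow, m.U_calculus]

theorem sum_norm_dftFlow (m : IsModularFlow N M ψ C A Φ U J) {n : ℕ} (hn : 0 < n) (τ : ℝ) (l : ℤ)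
    (η : H) : ∑ k ∈ Finset.range n, ‖dftFlow U n τ (k - l) η‖ ^ 2 = ‖η‖ ^ 2 := by
  have := sum_norm_sq_dft hn l fun r => U (r * τ) η
  simp only [m.norm_U, Finset.sum_const, Finset.card_range, nsmul_eq_mul] at this
  rw [← mul_assoc, inv_mul_cancel₀ (by positivity), one_mul] at this
  simpa [dftFlow] using this

theorem sum_norm_dftFlow' (m : IsModularFlow N M ψ C A Φ U J) {n : ℕ} (hn : 0 < n) (τ : ℝ) (k : ℤ)
    (η : H) : ∑ l ∈ Finset.range n, ‖dftFlow U n τ (k - l) η‖ ^ 2 = ‖η‖ ^ 2 := by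
  have := sum_norm_sq_dft' hn k fun r => U (r * τ) η
  simp only [m.norm_U, Finset.sum_const, Finset.card_range, nsmul_eq_mul] at this
  rw [← mul_assoc, inv_mul_cancel₀ (by positivity), one_mul] at this
  simpa [dftFlow] using this

theorem norm_sqrtCoord_apply_le (Φ : C(unitInterval, ℂ) →⋆ₐ[ℂ] (H →L[ℂ] H)) (η : H) :
    ‖Φ sqrtCoord η‖ ≤ ‖η‖ ∧ ‖Φ sqrtCoord' η‖ ≤ ‖η‖ := by
  refine ⟨?_, ?_⟩ <;>
  · refine ((Φ _).le_of_opNorm_le ((norm_calculus_le Φ _).trans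
      ((ContinuousMap.norm_le _ zero_le_one).2 fun c => ?_)) η).trans_eq (one_mul _)
    simp only [sqrtCoord, sqrtCoord', ContinuousMap.coe_mk, Complex.norm_real, Real.norm_eq_abs,
      abs_of_nonneg (Real.sqrt_nonneg _)]
    exact Real.sqrt_le_one.2 (by linarith [c.2.1, c.2.2])

theorem norm_leftFlow_le (h : IsModularFlow N M ψ C A Φ U J) {n m : ℕ} (hm : 0 < m)
    (hmn : m ≤ n) (τ θ : ℝ) (ρ : H) : ‖leftFlow U n m τ θ ρ‖ ≤ ‖ρ‖ := by
  refine (sq_le_sq₀ (norm_nonneg _) (norm_nonneg _)).1 ?_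
  rw [leftFlow, norm_columnOp_apply_sq, Fintype.sum_prod_type_right]
  calc _ ≤ ∑ l : Fin m, expWeight m θ l * ‖ρ‖ ^ 2 := by
        refine Finset.sum_le_sum fun l _ => ?_
        simp only [smul_apply, norm_smul, mul_pow, Complex.norm_real, Real.norm_eq_abs, sq_abs,
          Real.sq_sqrt (expWeight_nonneg _ _ _), ← Finset.mul_sum]
        refine mul_le_mul_of_nonneg_left ?_ (expWeight_nonneg _ _ _)
        rw [Fin.sum_univ_eq_sum_range
          fun k => ‖dftFlow U n τ ((k : ℤ) - (l : ℕ)) ρ‖ ^ 2]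
        refine (Finset.sum_le_sum_of_subset_of_nonneg (Finset.range_subset_range.2 hmn)
          fun _ _ _ => sq_nonneg _).trans_eq ?_
        rw [h.sum_norm_dftFlow (hm.trans_le hmn)]
    _ = ‖ρ‖ ^ 2 := by
        rw [← Finset.sum_mul, Fin.sum_univ_eq_sum_range, sum_expWeight hm, one_mul]

theorem norm_leftColumn_le (h : IsModularFlow N M ψ C A Φ U J) {n m : ℕ} (hm : 0 < m)
    (hmn : m ≤ n) (τ θ : ℝ) (ρ : H) : ‖leftColumn Φ U n m τ θ ρ‖ ≤ ‖ρ‖ :=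
  (h.norm_leftFlow_le hm hmn τ θ _).trans (norm_sqrtCoord_apply_le Φ ρ).2

theorem norm_rightFlow_le (h : IsModularFlow N M ψ C A Φ U J) {n m : ℕ} (hm : 0 < m)
    (hmn : m ≤ n) (τ θ : ℝ) (ρ : H) : ‖rightFlow U n m τ θ ρ‖ ≤ ‖ρ‖ := by
  refine (sq_le_sq₀ (norm_nonneg _) (norm_nonneg _)).1 ?_
  rw [rightFlow, norm_columnOp_apply_sq, Fintype.sum_prod_type]
  calc _ ≤ ∑ k : Fin m, expWeight m θ k * ‖ρ‖ ^ 2 := by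
        refine Finset.sum_le_sum fun k _ => ?_
        simp only [smul_apply, norm_smul, mul_pow, Complex.norm_real, Real.norm_eq_abs, sq_abs,
          Real.sq_sqrt (expWeight_nonneg _ _ _), ← Finset.mul_sum]
        refine mul_le_mul_of_nonneg_left ?_ (expWeight_nonneg _ _ _)
        rw [Fin.sum_univ_eq_sum_range
          fun l => ‖dftFlow U n τ (((k : ℕ) : ℤ) - l) ρ‖ ^ 2]
        refine (Finset.sum_le_sum_of_subset_of_nonneg (Finset.range_subset_range.2 hmn)
          fun _ _ _ => sq_nonneg _).trans_eq ?_
        rw [h.sum_norm_dftFlow' (hm.trans_le hmn)]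
    _ = ‖ρ‖ ^ 2 := by
        rw [← Finset.sum_mul, Fin.sum_univ_eq_sum_range, sum_expWeight hm, one_mul]

theorem norm_rightColumn_le (h : IsModularFlow N M ψ C A Φ U J) {n m : ℕ} (hm : 0 < m)
    (hmn : m ≤ n) (τ θ : ℝ) (ρ : H) : ‖rightColumn Φ U n m τ θ ρ‖ ≤ ‖ρ‖ :=
  (h.norm_rightFlow_le hm hmn τ θ _).trans (norm_sqrtCoord_apply_le Φ ρ).1

end IsModularFlow

namespace IsModularFlow

variable {N M : StarSubalgebra ℂ (H →L[ℂ] H)} {ψ : H} {C : H →L[ℂ] H} {A : H →L⋆[ℂ] H}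
  {Φ : C(unitInterval, ℂ) →⋆ₐ[ℂ] (H →L[ℂ] H)} {U : ℝ → H →L[ℂ] H} {J : H →L⋆[ℂ] H}

theorem leftColumn_osc (h : IsModularFlow N M ψ C A Φ U J) (n m : ℕ) (τ θ : ℝ) (η : H)
    (i : Fin m × Fin m) : leftColumn Φ U n m τ θ (Φ (osc 0) η) i =
      Φ (((√(expWeight m θ i.2) : ℝ) : ℂ) •
        (sqrtCoord' * dftOsc n τ ((i.1 : ℕ) - (i.2 : ℕ)))) η := by
  rw [leftColumn, ContinuousLinearMap.comp_apply, leftFlow, columnOp_apply, smul_apply,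
    h.dftFlow_calculus, h.dftFlow_osc,
    map_smul, smul_apply, calculus_mul_apply]

theorem rightColumn_osc (h : IsModularFlow N M ψ C A Φ U J) (n m : ℕ) (τ θ : ℝ) (η : H)
    (i : Fin m × Fin m) : rightColumn Φ U n m τ θ (Φ (osc 0) η) i =
      Φ (((√(expWeight m θ i.1) : ℝ) : ℂ) •
        (sqrtCoord * dftOsc n τ ((i.1 : ℕ) - (i.2 : ℕ)))) η := by
  rw [rightColumn, ContinuousLinearMap.comp_apply, rightFlow, columnOp_apply, smul_apply,
    h.dftFlow_calculus, h.dftFlow_osc,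
    map_smul, smul_apply, calculus_mul_apply]

theorem sqrtCoord'_apply (c : unitInterval) : sqrtCoord' c = (√(1 - (c : ℝ)) : ℝ) := rfl

theorem sqrtCoord_apply (c : unitInterval) : sqrtCoord c = (√(c : ℝ) : ℝ) := rfl

/-- For suitable parameters both columns nearly agree and keep the norm of the vector. -/
theorem exists_columns (h : IsModularFlow N M ψ C A Φ U J) {ε : ℝ} (hε : 0 < ε) :
    ∃ n m : ℕ, ∃ τ θ : ℝ, 0 < m ∧ m ≤ n ∧ ∀ η,
      ‖leftColumn Φ U n m τ θ (Φ (osc 0) η) - rightColumn Φ U n m τ θ (Φ (osc 0) η)‖ ^ 2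
        ≤ ε * ‖η‖ ^ 2 ∧
      ∀ q : C(unitInterval, ℂ), (∀ c, (q c).re ≤ 1 / 2 - 3 * |(c : ℝ) - 1 / 2|) →
        (⟪Φ (osc 0) η, Φ q (Φ (osc 0) η)⟫_ℂ).re ≤
          ‖leftColumn Φ U n m τ θ (Φ (osc 0) η)‖ ^ 2 + ε * ‖η‖ ^ 2 := by
  obtain ⟨n, m, τ, θ, hm, hmn, hc⟩ := exists_toeplitz_parameters hε
  refine ⟨n, m, τ, θ, hm, hmn, fun η => ⟨?_, fun q hq => ?_⟩⟩
  · let g : Fin m × Fin m → C(unitInterval, ℂ) := fun i =>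
      ((√(expWeight m θ i.2) : ℝ) : ℂ) • (sqrtCoord' * dftOsc n τ ((i.1 : ℕ) - (i.2 : ℕ))) -
      ((√(expWeight m θ i.1) : ℝ) : ℂ) • (sqrtCoord * dftOsc n τ ((i.1 : ℕ) - (i.2 : ℕ)))
    have e : ∀ i, (leftColumn Φ U n m τ θ (Φ (osc 0) η) -
        rightColumn Φ U n m τ θ (Φ (osc 0) η)) i = Φ (g i) η := fun i => by
      rw [PiLp.sub_apply, h.leftColumn_osc, h.rightColumn_osc, ← sub_apply, ← map_sub]
    rw [PiLp.norm_sq_eq_of_L2, Finset.sum_congr rfl fun i _ => by rw [e i]]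
    refine (sum_norm_sq_calculus_le _ Φ g 0 ε (fun c => ?_) η).trans_eq (by simp)
    rw [ContinuousMap.zero_apply, Complex.zero_re, zero_add]
    refine le_trans (le_of_eq ?_) (hc c).1
    rw [Fintype.sum_prod_type, Finset.sum_range]
    refine Finset.sum_congr rfl fun k _ => ?_
    rw [Finset.sum_range]
    refine Finset.sum_congr rfl fun l _ => ?_
    have e2 : g (k, l) c =
      ((√(expWeight m θ l) * √(1 - (c : ℝ)) - √(expWeight m θ k) * √(c : ℝ) : ℝ) : ℂ)
        * dftOsc n τ ((k : ℕ) - (l : ℕ)) c := by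
      simp only [g, ContinuousMap.sub_apply, ContinuousMap.smul_apply, ContinuousMap.mul_apply,
        sqrtCoord_apply, sqrtCoord'_apply, smul_eq_mul]
      push_cast; ring
    rw [e2, norm_mul, Complex.norm_real, Real.norm_eq_abs, mul_pow, sq_abs, mul_comm]
  · have h1 : ⟪Φ (osc 0) η, Φ q (Φ (osc 0) η)⟫_ℂ = ⟪η, Φ (osc 0 * (q * osc 0)) η⟫_ℂ := by
      rw [inner_calculus, star_osc, neg_zero, calculus_mul_apply, calculus_mul_apply]
    rw [h1, PiLp.norm_sq_eq_of_L2,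
      Finset.sum_congr rfl fun i _ => by rw [h.leftColumn_osc n m τ θ η i]]
    refine le_sum_norm_sq_calculus _ Φ (fun i : Fin m × Fin m => ((√(expWeight m θ i.2) : ℝ) : ℂ) •
      (sqrtCoord' * dftOsc n τ ((i.1 : ℕ) - (i.2 : ℕ)))) _ ε (fun c => ?_) η
    have hc0 := c.2.1
    have hc1 : 0 ≤ 1 - (c : ℝ) := sub_nonneg.2 c.2.2
    refine le_trans (le_trans ?_ (hc c).2) (add_le_add (le_of_eq ?_) le_rfl)
    · have : ((osc 0 * (q * osc 0)) c).re = (c : ℝ) * (1 - c) * (q c).re := by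
        have e3 : (osc 0 * (q * osc 0)) c = (((c : ℝ) * (1 - c) : ℝ) : ℂ) * q c := by
          rw [← Real.mul_self_sqrt (mul_nonneg hc0 hc1)]
          simp only [ContinuousMap.mul_apply, osc_zero_apply]
          push_cast; ring
        rw [e3, Complex.re_ofReal_mul]
      rw [this]
      exact mul_le_mul_of_nonneg_left (hq c) (mul_nonneg hc0 hc1)
    · rw [Fintype.sum_prod_type, Finset.sum_range]
      refine Finset.sum_congr rfl fun k _ => ?_
      rw [Finset.sum_range]
      refine Finset.sum_congr rfl fun l _ => ?_
      simp only [ContinuousMap.smul_apply, ContinuousMap.mul_apply, sqrtCoord'_apply, norm_smul,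
        norm_mul, Complex.norm_real, Real.norm_eq_abs, mul_pow, sq_abs, Real.sq_sqrt hc1,
        Real.sq_sqrt (expWeight_nonneg m θ l)]
      ring

/-- A sequence of parameters along which the two columns agree in the limit. -/
theorem exists_column_sequence (h : IsModularFlow N M ψ C A Φ U J) :
    ∃ n d : ℕ → ℕ, ∃ τ θ : ℕ → ℝ, (∀ i, 0 < d i ∧ d i ≤ n i) ∧ ∀ ρ,
      Tendsto (fun i => ‖leftColumn Φ U (n i) (d i) (τ i) (θ i) ρ -
        rightColumn Φ U (n i) (d i) (τ i) (θ i) ρ‖) atTop (𝓝 0) ∧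
      ∀ q : C(unitInterval, ℂ), (∀ c, (q c).re ≤ 1 / 2 - 3 * |(c : ℝ) - 1 / 2|) → ∀ δ > 0,
        ∀ᶠ i in atTop, (⟪ρ, Φ q ρ⟫_ℂ).re ≤
          ‖leftColumn Φ U (n i) (d i) (τ i) (θ i) ρ‖ ^ 2 + δ := by
  choose n d τ θ hd hdn hη using
    fun i : ℕ => h.exists_columns (ε := 1 / ((i : ℝ) + 1)) (by positivity)
  have hlim : Tendsto (fun i : ℕ => 1 / ((i : ℝ) + 1)) atTop (𝓝 0) :=
    tendsto_one_div_add_atTop_nhds_zero_nat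
  refine ⟨n, d, τ, θ, fun i => ⟨hd i, hdn i⟩, fun ρ => ⟨?_, fun q hq δ hδ => ?_⟩⟩
  · rw [Metric.tendsto_nhds]
    intro δ hδ
    obtain ⟨η, hρ⟩ := Metric.denseRange_iff.1 h.dense ρ (δ / 4) (by positivity)
    rw [dist_eq_norm] at hρ
    have h0 : Tendsto (fun i : ℕ => 1 / ((i : ℝ) + 1) * ‖η‖ ^ 2) atTop (𝓝 0) := by
      simpa using hlim.mul_const (‖η‖ ^ 2)
    filter_upwards [h0.eventually (gt_mem_nhds (show 0 < (δ / 2) ^ 2 by positivity))] with i hi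
    have h1 := abs_lt_of_sq_lt_sq (((hη i η).1).trans_lt hi) (by positivity)
    rw [abs_of_nonneg (norm_nonneg _)] at h1
    have h2 := (h.norm_leftColumn_le (hd i) (hdn i) (τ i) (θ i) (ρ - Φ (osc 0) η)).trans hρ.le
    have h3 := (h.norm_rightColumn_le (hd i) (hdn i) (τ i) (θ i) (ρ - Φ (osc 0) η)).trans hρ.le
    have hρ' := (norm_nonneg (ρ - Φ (osc 0) η)).trans_lt hρ
    rw [dist_zero_right, norm_norm]
    have e : leftColumn Φ U (n i) (d i) (τ i) (θ i) ρ - rightColumn Φ U (n i) (d i) (τ i) (θ i) ρ =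
        (leftColumn Φ U (n i) (d i) (τ i) (θ i) (Φ (osc 0) η) -
          rightColumn Φ U (n i) (d i) (τ i) (θ i) (Φ (osc 0) η)) +
        (leftColumn Φ U (n i) (d i) (τ i) (θ i) (ρ - Φ (osc 0) η) -
          rightColumn Φ U (n i) (d i) (τ i) (θ i) (ρ - Φ (osc 0) η)) := by
      simp only [map_sub]; abel
    rw [e]
    refine ((norm_add_le _ _).trans (add_le_add le_rfl (norm_sub_le _ _))).trans_lt ?_
    linarith
  · have hcont : Continuous fun x => (⟪x, Φ q x⟫_ℂ).re :=
      Complex.continuous_re.comp (continuous_id.inner (Φ q).continuous)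
    have hcont' : Continuous fun x => 2 * ‖ρ‖ * ‖x - ρ‖ + ‖x - ρ‖ ^ 2 := by fun_prop
    obtain ⟨η, hη1, hη2⟩ := h.dense.exists_mem_open
      ((isOpen_lt (continuous_const (y := (⟪ρ, Φ q ρ⟫_ℂ).re - δ / 3)) hcont).inter
        (isOpen_lt hcont' (continuous_const (y := δ / 3))))
      ⟨ρ, by simp only [Set.mem_ofPred_eq]; linarith,
        by simp only [Set.mem_ofPred_eq, sub_self, norm_zero]; simpa using by positivity⟩
    simp only [Set.mem_ofPred_eq] at hη1 hη2
    have h0 : Tendsto (fun i : ℕ => 1 / ((i : ℝ) + 1) * ‖η‖ ^ 2) atTop (𝓝 0) := by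
      simpa using hlim.mul_const (‖η‖ ^ 2)
    filter_upwards [h0.eventually (gt_mem_nhds (show 0 < δ / 3 by positivity))] with i hi
    have h1 := (hη i η).2 q hq
    have h2 := h.norm_leftColumn_le (hd i) (hdn i) (τ i) (θ i) (Φ (osc 0) η - ρ)
    have h3 := h.norm_leftColumn_le (hd i) (hdn i) (τ i) (θ i) ρ
    have h4 : ‖leftColumn Φ U (n i) (d i) (τ i) (θ i) (Φ (osc 0) η)‖ ≤
        ‖leftColumn Φ U (n i) (d i) (τ i) (θ i) ρ‖ + ‖Φ (osc 0) η - ρ‖ := by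
      have := norm_add_le (leftColumn Φ U (n i) (d i) (τ i) (θ i) ρ)
        (leftColumn Φ U (n i) (d i) (τ i) (θ i) (Φ (osc 0) η - ρ))
      rw [← map_add, add_sub_cancel] at this
      linarith
    have h5 := pow_le_pow_left₀ (norm_nonneg _) h4 2
    have h6 := mul_le_mul_of_nonneg_right h3 (norm_nonneg (Φ (osc 0) η - ρ))
    nlinarith

theorem quadratic_weight_le {δ : ℝ} (hδ : 0 < δ) (c : unitInterval) :
    1 / 2 - 3 / 2 * δ - 3 / (2 * δ) * (1 / 2 - √((c : ℝ) * (1 - c))) ≤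
      1 / 2 - 3 * |(c : ℝ) - 1 / 2| := by
  have hc : 0 ≤ (c : ℝ) * (1 - c) := mul_nonneg c.2.1 (sub_nonneg.2 c.2.2)
  have hs := Real.sq_sqrt hc
  have hs0 := Real.sqrt_nonneg ((c : ℝ) * (1 - c))
  have hs1 : √((c : ℝ) * (1 - c)) ≤ 1 / 2 := by
    rw [Real.sqrt_le_left (by norm_num)]; nlinarith [sq_nonneg ((c : ℝ) - 1 / 2)]
  have ha : |(c : ℝ) - 1 / 2| ^ 2 ≤ 1 / 2 - √((c : ℝ) * (1 - c)) := by
    rw [sq_abs]; nlinarith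
  have key : 3 * |(c : ℝ) - 1 / 2| ≤ 3 / 2 * δ + 3 / (2 * δ) * |(c : ℝ) - 1 / 2| ^ 2 := by
    have : 3 / 2 * δ + 3 / (2 * δ) * |(c : ℝ) - 1 / 2| ^ 2 - 3 * |(c : ℝ) - 1 / 2| =
        3 / (2 * δ) * (δ - |(c : ℝ) - 1 / 2|) ^ 2 := by field_simp; ring
    have : 0 ≤ 3 / (2 * δ) * (δ - |(c : ℝ) - 1 / 2|) ^ 2 := by positivity
    linarith
  have := mul_le_mul_of_nonneg_left ha (show 0 ≤ 3 / (2 * δ) by positivity)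
  linarith

/-- A self-adjoint vector and its reflection are images of a common vector. -/
theorem exists_common_vector (h : IsCyclicPair N M ψ) (m : IsModularFlow N M ψ C A Φ U J)
    {x : H →L[ℂ] H} (hx : x ∈ N) (hs : IsSelfAdjoint x) :
    ∃ ρ, Φ sqrtCoord' ρ = x ψ ∧ Φ sqrtCoord ρ = J (x ψ) ∧ ‖ρ‖ ^ 2 = 2 * ‖x ψ‖ ^ 2 ∧
      (⟪ρ, Φ (osc 0) ρ⟫_ℂ).re = (⟪x ψ, J (x ψ)⟫_ℂ).re := by
  have h0 := m.sqrtCoord'_J h hx hs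
  have s1 : ∀ η, Φ sqrtCoord (Φ sqrtCoord η) + Φ sqrtCoord' (Φ sqrtCoord' η) = η := fun η => by
    rw [← calculus_mul_apply, ← calculus_mul_apply, ← add_apply, ← map_add, sqrtCoord_mul,
      sqrtCoord'_mul, add_sub_cancel, map_one, one_apply_eq_self]
  have star1 : star sqrtCoord = sqrtCoord := by
    ext c; simp [sqrtCoord_apply]
  have star2 : star sqrtCoord' = sqrtCoord' := by
    ext c; simp [sqrtCoord'_apply]
  set ρ := Φ sqrtCoord' (x ψ) + Φ sqrtCoord (J (x ψ)) with hρ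
  have e1 : Φ sqrtCoord' ρ = x ψ := by
    rw [hρ, map_add, commute_calculus Φ sqrtCoord' sqrtCoord, h0, add_comm, s1]
  have e2 : Φ sqrtCoord ρ = J (x ψ) := by
    rw [hρ, map_add, commute_calculus Φ sqrtCoord sqrtCoord', ← h0, add_comm, s1]
  refine ⟨ρ, e1, e2, ?_, ?_⟩
  · have e := congrArg (fun z => (⟪z, ρ⟫_ℂ).re) (s1 ρ)
    simp only [inner_add_left, Complex.add_re, inner_calculus, star1, star2, e1, e2] at e
    rw [← re_inner_self_complex, ← e]
    rw [re_inner_self_complex, re_inner_self_complex, m.norm_J]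
    ring
  · rw [← sqrtCoord_mul_sqrtCoord', mul_comm, calculus_mul_apply, ← star2, ← inner_calculus,
      e1, e2]

/-- The quadratic lower bound evaluated on a self-adjoint vector. -/
theorem le_re_inner_calculus (Φ : C(unitInterval, ℂ) →⋆ₐ[ℂ] (H →L[ℂ] H)) {δ : ℝ} (hδ : 0 < δ) :
    ∃ q : C(unitInterval, ℂ), (∀ c, (q c).re ≤ 1 / 2 - 3 * |(c : ℝ) - 1 / 2|) ∧ ∀ ρ,
      (⟪ρ, Φ q ρ⟫_ℂ).re = (1 / 2 - 3 / 2 * δ - 3 / (4 * δ)) * ‖ρ‖ ^ 2 +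
        3 / (2 * δ) * (⟪ρ, Φ (osc 0) ρ⟫_ℂ).re := by
  refine ⟨((1 / 2 - 3 / 2 * δ - 3 / (4 * δ) : ℝ) : ℂ) • 1 + ((3 / (2 * δ) : ℝ) : ℂ) • osc 0,
    fun c => ?_, fun ρ => ?_⟩
  · refine le_trans (le_of_eq ?_) (quadratic_weight_le hδ c)
    simp only [ContinuousMap.add_apply, ContinuousMap.smul_apply, ContinuousMap.one_apply,
      osc_zero_apply, smul_eq_mul, mul_one, Complex.add_re, Complex.ofReal_re,
      Complex.re_ofReal_mul]
    field_simp; ring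
  · rw [map_add, map_smul, map_smul, map_one, add_apply, smul_apply, smul_apply,
      one_apply_eq_self, inner_add_right, inner_smul_right, inner_smul_right, Complex.add_re,
      Complex.re_ofReal_mul, Complex.re_ofReal_mul, re_inner_self_complex]

end IsModularFlow

section Toeplitz

open scoped ComplexOrder

theorem nonneg_of_forall_inner_nonneg {E : Type*} [NormedAddCommGroup E] [InnerProductSpace ℂ E]
    {T : E →L[ℂ] E} (h : ∀ v, 0 ≤ ⟪v, T v⟫_ℂ) : 0 ≤ T := by
  rw [ContinuousLinearMap.nonneg_iff_isPositive, ContinuousLinearMap.isPositive_iff_complex]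
  intro v
  have h1 := Complex.nonneg_iff.1 (h v)
  have h2 : ⟪T v, v⟫_ℂ = ⟪v, T v⟫_ℂ := by
    rw [← inner_conj_symm, Complex.conj_eq_iff_im, ← h1.2]
  rw [h2]
  exact ⟨Complex.ext rfl h1.2, h1.1⟩

variable {m : ℕ}

/-- A matrix of operators acting on the row index. -/
noncomputable def rowOp {E : Type*} [NormedAddCommGroup E] [InnerProductSpace ℂ E]
    (a : Fin m → Fin m → E →L[ℂ] E) :
    PiLp 2 (fun _ : Fin m × Fin m => E) →L[ℂ] PiLp 2 (fun _ : Fin m × Fin m => E) :=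
  columnOp fun i => ∑ k, a i.1 k ∘L PiLp.proj 2 (fun _ : Fin m × Fin m => E) (k, i.2)

/-- A matrix of operators acting on the column index. -/
noncomputable def colOp {E : Type*} [NormedAddCommGroup E] [InnerProductSpace ℂ E]
    (a : Fin m → Fin m → E →L[ℂ] E) :
    PiLp 2 (fun _ : Fin m × Fin m => E) →L[ℂ] PiLp 2 (fun _ : Fin m × Fin m => E) :=
  columnOp fun i => ∑ l, a i.2 l ∘L PiLp.proj 2 (fun _ : Fin m × Fin m => E) (i.1, l)

theorem rowOp_apply {E : Type*} [NormedAddCommGroup E] [InnerProductSpace ℂ E]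
    (a : Fin m → Fin m → E →L[ℂ] E) (v : PiLp 2 (fun _ : Fin m × Fin m => E)) (i : Fin m × Fin m) :
    rowOp a v i = ∑ k, a i.1 k (v (k, i.2)) := by
  simp [rowOp]

theorem colOp_apply {E : Type*} [NormedAddCommGroup E] [InnerProductSpace ℂ E]
    (a : Fin m → Fin m → E →L[ℂ] E) (v : PiLp 2 (fun _ : Fin m × Fin m => E)) (i : Fin m × Fin m) :
    colOp a v i = ∑ l, a i.2 l (v (i.1, l)) := by
  simp [colOp]

theorem commute_rowOp_colOp {E : Type*} [NormedAddCommGroup E] [InnerProductSpace ℂ E]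
    {a b : Fin m → Fin m → E →L[ℂ] E} (h : ∀ k k' l l' η, a k k' (b l l' η) = b l l' (a k k' η)) :
    rowOp a * colOp b = colOp b * rowOp a := by
  ext v i
  simp only [mul_apply_eq_comp, rowOp_apply, colOp_apply, map_sum, h]
  exact Finset.sum_comm

/-- The Toeplitz matrix whose symbol is the orbit of `p` under the modular flow. -/
noncomputable def toeplitz {E : Type*} [NormedAddCommGroup E] [InnerProductSpace ℂ E]
    (U : ℝ → E →L[ℂ] E) (n : ℕ) (τ : ℝ) (σ : ℤ) (p : E →L[ℂ] E)
    (k l : Fin m) : E →L[ℂ] E :=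
  (n : ℂ)⁻¹ • ∑ r ∈ Finset.range n, dftChar n (σ * ((k : ℕ) - (l : ℕ)) * r) •
    (U (r * τ) * p * U (-(r * τ)))

theorem toeplitz_add {E : Type*} [NormedAddCommGroup E] [InnerProductSpace ℂ E]
    (U : ℝ → E →L[ℂ] E) (n : ℕ) (τ : ℝ) (σ : ℤ) (p q : E →L[ℂ] E) (k l : Fin m) :
    toeplitz U n τ σ (p + q) k l = toeplitz U n τ σ p k l + toeplitz U n τ σ q k l := by
  simp only [toeplitz, mul_add, add_mul, smul_add, Finset.sum_add_distrib]

theorem toeplitz_smul {E : Type*} [NormedAddCommGroup E] [InnerProductSpace ℂ E]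
    (U : ℝ → E →L[ℂ] E) (n : ℕ) (τ : ℝ) (σ : ℤ) (z : ℂ) (p : E →L[ℂ] E)
    (k l : Fin m) : toeplitz U n τ σ (z • p) k l = z • toeplitz U n τ σ p k l := by
  simp only [toeplitz, mul_smul_comm, smul_mul_assoc, smul_comm _ z, ← Finset.smul_sum]

namespace IsModularFlow

variable {N M : StarSubalgebra ℂ (H →L[ℂ] H)} {ψ : H} {C : H →L[ℂ] H} {A : H →L⋆[ℂ] H}
  {Φ : C(unitInterval, ℂ) →⋆ₐ[ℂ] (H →L[ℂ] H)} {U : ℝ → H →L[ℂ] H} {J : H →L⋆[ℂ] H}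

theorem sum_inner_toeplitz (h : IsModularFlow N M ψ C A Φ U J) (n : ℕ) (τ : ℝ) (σ : ℤ)
    (p : H →L[ℂ] H) (v : Fin m → H) :
    ∑ k, ⟪v k, ∑ l, toeplitz U n τ σ p k l (v l)⟫_ℂ = (n : ℂ)⁻¹ * ∑ r ∈ Finset.range n,
      ⟪∑ k : Fin m, dftChar n (-(σ * (k : ℕ) * r)) • U (-(r * τ)) (v k),
        p (∑ k : Fin m, dftChar n (-(σ * (k : ℕ) * r)) • U (-(r * τ)) (v k))⟫_ℂ := by
  simp only [toeplitz, smul_apply, sum_apply, mul_apply_eq_comp, inner_sum, sum_inner, map_sum,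
    map_smul, inner_smul_left, inner_smul_right, star_dftChar, h.inner_U, neg_neg, Finset.mul_sum]
  rw [Finset.sum_comm]
  conv_rhs => rw [Finset.sum_comm]
  refine Finset.sum_congr rfl fun l _ => ?_
  conv_rhs => rw [Finset.sum_comm]
  refine Finset.sum_congr rfl fun k _ => Finset.sum_congr rfl fun r _ => ?_
  rw [← mul_assoc (dftChar _ _) (dftChar _ _), ← dftChar_add]
  congr 4
  ring

theorem toeplitz_one (h : IsModularFlow N M ψ C A Φ U J) {n : ℕ} (hmn : m ≤ n) (τ : ℝ) {σ : ℤ}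
    (hσ : σ = 1 ∨ σ = -1) (k l : Fin m) : toeplitz U n τ σ 1 k l = if k = l then 1 else 0 := by
  have hn : 0 < n := k.pos.trans_le hmn
  have e : ∀ r : ℕ, U (r * τ) * 1 * U (-(r * τ)) = 1 := fun r => by
    ext η
    simp [mul_apply_eq_comp, h.U_U, h.U_zero]
  have e2 : ∑ r ∈ Finset.range n, dftChar n (σ * ((k : ℕ) - (l : ℕ)) * r) =
      if k = l then (n : ℂ) else 0 := by
    rcases hσ with rfl | rfl
    · simpa [Fin.ext_iff] using sum_dftChar (k.2.trans_le hmn) (l.2.trans_le hmn)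
    · simpa [Fin.ext_iff, eq_comm] using sum_dftChar (l.2.trans_le hmn) (k.2.trans_le hmn)
  simp only [toeplitz, e]
  rw [← Finset.sum_smul, e2, smul_smul]
  split_ifs
  · rw [inv_mul_cancel₀ (by exact_mod_cast hn.ne'), one_smul]
  · rw [mul_zero, zero_smul]

end IsModularFlow

/-- The Toeplitz operator with symbol `p`, acting on the row index. -/
noncomputable def rowToeplitz {E : Type*} [NormedAddCommGroup E] [InnerProductSpace ℂ E]
    (U : ℝ → E →L[ℂ] E) (n m : ℕ) (τ : ℝ) : (E →L[ℂ] E) →ₗ[ℂ]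
    (PiLp 2 (fun _ : Fin m × Fin m => E) →L[ℂ] PiLp 2 (fun _ : Fin m × Fin m => E)) where
  toFun p := rowOp (toeplitz U n τ 1 p)
  map_add' p q := by
    ext v i
    simp [rowOp_apply, toeplitz_add, Finset.sum_add_distrib]
  map_smul' z p := by
    ext v i
    simp [rowOp_apply, toeplitz_smul, Finset.smul_sum]

/-- The conjugate Toeplitz operator with symbol `p`, acting on the column index. -/
noncomputable def colToeplitz {E : Type*} [NormedAddCommGroup E] [InnerProductSpace ℂ E]
    (U : ℝ → E →L[ℂ] E) (n m : ℕ) (τ : ℝ) : (E →L[ℂ] E) →ₗ[ℂ]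
    (PiLp 2 (fun _ : Fin m × Fin m => E) →L[ℂ] PiLp 2 (fun _ : Fin m × Fin m => E)) where
  toFun p := colOp (toeplitz U n τ (-1) p)
  map_add' p q := by
    ext v i
    simp [colOp_apply, toeplitz_add, Finset.sum_add_distrib]
  map_smul' z p := by
    ext v i
    simp [colOp_apply, toeplitz_smul, Finset.smul_sum]

namespace IsModularFlow

variable {N M : StarSubalgebra ℂ (H →L[ℂ] H)} {ψ : H} {C : H →L[ℂ] H} {A : H →L⋆[ℂ] H}
  {Φ : C(unitInterval, ℂ) →⋆ₐ[ℂ] (H →L[ℂ] H)} {U : ℝ → H →L[ℂ] H} {J : H →L⋆[ℂ] H}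

theorem sum_inner_toeplitz_nonneg (h : IsModularFlow N M ψ C A Φ U J) (n : ℕ) (τ : ℝ) (σ : ℤ)
    {p : H →L[ℂ] H} (hp : 0 ≤ p) (v : Fin m → H) :
    0 ≤ ∑ k, ⟪v k, ∑ l, toeplitz U n τ σ p k l (v l)⟫_ℂ := by
  rw [h.sum_inner_toeplitz]
  refine mul_nonneg ?_ (Finset.sum_nonneg fun r _ => ?_)
  · rw [inv_nonneg]; exact_mod_cast Nat.zero_le n
  · exact ((ContinuousLinearMap.nonneg_iff_isPositive _).1 hp).inner_nonneg_right _

theorem rowToeplitz_nonneg (h : IsModularFlow N M ψ C A Φ U J) (n m : ℕ) (τ : ℝ)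
    {p : H →L[ℂ] H} (hp : 0 ≤ p) : 0 ≤ rowToeplitz U n m τ p := by
  refine nonneg_of_forall_inner_nonneg fun v => ?_
  rw [PiLp.inner_apply, Fintype.sum_prod_type_right]
  refine Finset.sum_nonneg fun l _ => ?_
  refine (h.sum_inner_toeplitz_nonneg n τ 1 hp fun k => v (k, l)).trans_eq ?_
  exact Finset.sum_congr rfl fun k _ => by rw [← rowOp_apply _ v (k, l)]; rfl

theorem colToeplitz_nonneg (h : IsModularFlow N M ψ C A Φ U J) (n m : ℕ) (τ : ℝ)
    {p : H →L[ℂ] H} (hp : 0 ≤ p) : 0 ≤ colToeplitz U n m τ p := by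
  refine nonneg_of_forall_inner_nonneg fun v => ?_
  rw [PiLp.inner_apply, Fintype.sum_prod_type]
  refine Finset.sum_nonneg fun k _ => ?_
  refine (h.sum_inner_toeplitz_nonneg n τ (-1) hp fun l => v (k, l)).trans_eq ?_
  exact Finset.sum_congr rfl fun l _ => by rw [← colOp_apply _ v (k, l)]; rfl

theorem rowToeplitz_one (h : IsModularFlow N M ψ C A Φ U J) {n m : ℕ} (hmn : m ≤ n) (τ : ℝ) :
    rowToeplitz U n m τ 1 = 1 := by
  ext v i
  rw [rowToeplitz, LinearMap.coe_mk, AddHom.coe_mk, rowOp_apply, one_apply_eq_self,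
    Finset.sum_eq_single i.1]
  · rw [h.toeplitz_one hmn τ (Or.inl rfl), if_pos rfl]; rfl
  · intro k _ hk
    rw [h.toeplitz_one hmn τ (Or.inl rfl), if_neg hk.symm]; rfl
  · simp

theorem colToeplitz_one (h : IsModularFlow N M ψ C A Φ U J) {n m : ℕ} (hmn : m ≤ n) (τ : ℝ) :
    colToeplitz U n m τ 1 = 1 := by
  ext v i
  rw [colToeplitz, LinearMap.coe_mk, AddHom.coe_mk, colOp_apply, one_apply_eq_self,
    Finset.sum_eq_single i.2]
  · rw [h.toeplitz_one hmn τ (Or.inr rfl), if_pos rfl]; rfl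
  · intro k _ hk
    rw [h.toeplitz_one hmn τ (Or.inr rfl), if_neg hk.symm]; rfl
  · simp

theorem flow_commute (h : IsCyclicPair N M ψ) (f : IsModularFlow N M ψ C A Φ U J)
    {x y : H →L[ℂ] H} (hx : x ∈ N) (hy : y ∈ N) (s t : ℝ) (η : H) :
    U s (y (U (-s) (U t (antiConj J x (U (-t) η))))) =
      U t (antiConj J x (U (-t) (U s (y (U (-s) η))))) := by
  have := congrArg (U s) (f.commute_flow h hx hy (t - s) (U (-s) η))
  simp only [f.U_U] at this ⊢
  convert this.symm using 4 <;> ring_nf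

theorem commute_rowToeplitz_colToeplitz (h : IsCyclicPair N M ψ)
    (f : IsModularFlow N M ψ C A Φ U J) {x y : H →L[ℂ] H} (hx : x ∈ N) (hy : y ∈ N) (n m : ℕ)
    (τ : ℝ) : rowToeplitz U n m τ y * colToeplitz U n m τ (antiConj J x) =
      colToeplitz U n m τ (antiConj J x) * rowToeplitz U n m τ y := by
  refine commute_rowOp_colOp fun k k' l l' η => ?_
  simp only [toeplitz, smul_apply, sum_apply, mul_apply_eq_comp, map_smul, map_sum,
    Finset.smul_sum]
  rw [Finset.sum_comm]
  refine Finset.sum_congr rfl fun r _ => Finset.sum_congr rfl fun s _ => ?_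
  rw [f.flow_commute h hx hy]
  simp only [smul_smul]
  congr 1
  ring

end IsModularFlow

/-- The vector of a truncated thermal superposition. -/
noncomputable def thermalVector {E : Type*} [NormedAddCommGroup E] [InnerProductSpace ℂ E] (m : ℕ)
    (θ : ℝ) (ψ : E) : PiLp 2 (fun _ : Fin m × Fin m => E) :=
  WithLp.toLp 2 fun i => if i.1 = i.2 then ((√(expWeight m θ i.1) : ℝ) : ℂ) • ψ else 0

theorem thermalVector_apply {E : Type*} [NormedAddCommGroup E] [InnerProductSpace ℂ E] (m : ℕ)
    (θ : ℝ) (ψ : E) (i : Fin m × Fin m) : thermalVector m θ ψ i =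
      if i.1 = i.2 then ((√(expWeight m θ i.1) : ℝ) : ℂ) • ψ else 0 := rfl

theorem norm_thermalVector {E : Type*} [NormedAddCommGroup E] [InnerProductSpace ℂ E] {m : ℕ}
    (hm : 0 < m) (θ : ℝ) (ψ : E) : ‖thermalVector m θ ψ‖ = ‖ψ‖ := by
  refine (sq_eq_sq₀ (norm_nonneg _) (norm_nonneg _)).1 ?_
  rw [PiLp.norm_sq_eq_of_L2, Fintype.sum_prod_type]
  have : ∀ k : Fin m, ∑ l, ‖thermalVector m θ ψ (k, l)‖ ^ 2 = expWeight m θ k * ‖ψ‖ ^ 2 := by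
    intro k
    rw [Finset.sum_eq_single k]
    · rw [thermalVector_apply, if_pos rfl, norm_smul, mul_pow, Complex.norm_real, Real.norm_eq_abs,
        sq_abs, Real.sq_sqrt (expWeight_nonneg _ _ _)]
    · intro l _ hl
      rw [thermalVector_apply, if_neg (Ne.symm hl), norm_zero]; norm_num
    · simp
  rw [Finset.sum_congr rfl fun k _ => this k, ← Finset.sum_mul,
    Fin.sum_univ_eq_sum_range fun k => expWeight m θ k, sum_expWeight hm, one_mul]

namespace IsModularFlow

variable {N M : StarSubalgebra ℂ (H →L[ℂ] H)} {ψ : H} {C : H →L[ℂ] H} {A : H →L⋆[ℂ] H}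
  {Φ : C(unitInterval, ℂ) →⋆ₐ[ℂ] (H →L[ℂ] H)} {U : ℝ → H →L[ℂ] H} {J : H →L⋆[ℂ] H}

theorem rowToeplitz_thermalVector (h : IsModularFlow N M ψ C A Φ U J) (n m : ℕ) (τ θ : ℝ)
    (p : H →L[ℂ] H) :
    rowToeplitz U n m τ p (thermalVector m θ ψ) = leftFlow U n m τ θ (p ψ) := by
  ext i
  rw [rowToeplitz, LinearMap.coe_mk, AddHom.coe_mk, rowOp_apply, Finset.sum_eq_single i.2,
    thermalVector_apply, if_pos rfl, leftFlow, columnOp_apply, map_smul, smul_apply]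
  · congr 1
    simp [toeplitz, dftFlow, h.U_vacuum, mul_apply_eq_comp]
  · intro k _ hk
    rw [thermalVector_apply, if_neg hk, map_zero]
  · simp

theorem colToeplitz_thermalVector (h : IsModularFlow N M ψ C A Φ U J) (n m : ℕ) (τ θ : ℝ)
    (p : H →L[ℂ] H) : colToeplitz U n m τ (antiConj J p) (thermalVector m θ ψ) =
      rightFlow U n m τ θ (J (p ψ)) := by
  ext i
  rw [colToeplitz, LinearMap.coe_mk, AddHom.coe_mk, colOp_apply, Finset.sum_eq_single i.1,
    thermalVector_apply, if_pos rfl, rightFlow, columnOp_apply, map_smul, smul_apply]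
  · congr 1
    simp [toeplitz, dftFlow, h.U_vacuum, mul_apply_eq_comp, antiConj_apply, h.J_vacuum]
  · intro k _ hk
    rw [thermalVector_apply, if_neg hk.symm, map_zero]
  · simp

theorem antiConj_nonneg (h : IsModularFlow N M ψ C A Φ U J) {p : H →L[ℂ] H} (hp : 0 ≤ p) :
    0 ≤ antiConj J p := by
  refine nonneg_of_forall_inner_nonneg fun v => ?_
  rw [antiConj_apply, ← inner_conj_symm, h.inner_J, inner_conj_symm]
  exact ((ContinuousLinearMap.nonneg_iff_isPositive _).1 hp).inner_nonneg_left _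

theorem antiConj_le_one (h : IsModularFlow N M ψ C A Φ U J) {p : H →L[ℂ] H} (hp : p ≤ 1) :
    antiConj J p ≤ 1 := by
  have : 1 - antiConj J p = antiConj J (1 - p) := by
    ext η
    simp [antiConj_apply, h.J_J]
  rw [← sub_nonneg, this]
  exact h.antiConj_nonneg (sub_nonneg.2 hp)

/-- Approximately tracial vector states into which the elements of `N` are mapped by unital
positive maps. -/
theorem exists_approximate_trace (hc : IsCyclicPair N M ψ) (h : IsModularFlow N M ψ C A Φ U J) :
    ∃ (d : ℕ → ℕ) (ξ : ∀ i, PiLp 2 (fun _ : Fin (d i) × Fin (d i) => H))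
      (X : ∀ i, (H →L[ℂ] H) →ₗ[ℂ] (PiLp 2 (fun _ : Fin (d i) × Fin (d i) => H) →L[ℂ]
        PiLp 2 (fun _ : Fin (d i) × Fin (d i) => H)))
      (Y : ∀ i, (H →L[ℂ] H) → (PiLp 2 (fun _ : Fin (d i) × Fin (d i) => H) →L[ℂ]
        PiLp 2 (fun _ : Fin (d i) × Fin (d i) => H))),
      (∀ i, ‖ξ i‖ = ‖ψ‖) ∧ (∀ i, X i 1 = 1) ∧ (∀ i p, 0 ≤ p → 0 ≤ X i p) ∧
      (∀ i p, 0 ≤ p → p ≤ 1 → 0 ≤ Y i p ∧ Y i p ≤ 1) ∧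
      (∀ i, ∀ p ∈ N, ∀ q ∈ N, X i p * Y i q = Y i q * X i p) ∧
      (∀ i p, ‖X i p (ξ i)‖ ≤ ‖p ψ‖) ∧
      (∀ p ∈ N, IsSelfAdjoint p →
        Tendsto (fun i => ‖X i p (ξ i) - Y i p (ξ i)‖) atTop (𝓝 0) ∧
        ∀ δ > 0, ∀ η > 0, ∀ᶠ i in atTop, ‖p ψ‖ ^ 2 - 3 * δ * ‖p ψ‖ ^ 2 -
          3 / (2 * δ) * (‖p ψ‖ ^ 2 - (⟪p ψ, J (p ψ)⟫_ℂ).re) ≤ ‖X i p (ξ i)‖ ^ 2 + η) := by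
  obtain ⟨n, d, τ, θ, hd, hρ⟩ := h.exists_column_sequence
  refine ⟨d, fun i => thermalVector (d i) (θ i) ψ, fun i => rowToeplitz U (n i) (d i) (τ i),
    fun i p => colToeplitz U (n i) (d i) (τ i) (antiConj J p),
    fun i => norm_thermalVector (hd i).1 _ _, fun i => h.rowToeplitz_one (hd i).2 _,
    fun i p => h.rowToeplitz_nonneg _ _ _, fun i p hp0 hp1 => ⟨h.colToeplitz_nonneg _ _ _
      (h.antiConj_nonneg hp0), ?_⟩, fun i p hp q hq =>
    h.commute_rowToeplitz_colToeplitz hc hq hp _ _ _, fun i p => ?_, fun p hp hs => ⟨?_, ?_⟩⟩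
  · have := h.colToeplitz_nonneg (n i) (d i) (τ i) (sub_nonneg.2 (h.antiConj_le_one hp1))
    rwa [map_sub, h.colToeplitz_one (hd i).2, sub_nonneg] at this
  · rw [h.rowToeplitz_thermalVector]
    exact h.norm_leftFlow_le (hd i).1 (hd i).2 _ _ _
  · obtain ⟨ρ, h1, h2, -, -⟩ := h.exists_common_vector hc hp hs
    have := (hρ ρ).1
    simp only [leftColumn, rightColumn, ContinuousLinearMap.comp_apply, h1, h2] at this
    simpa only [h.rowToeplitz_thermalVector, h.colToeplitz_thermalVector] using this
  · intro δ hδ η hη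
    obtain ⟨ρ, h1, h2, h3, h4⟩ := h.exists_common_vector hc hp hs
    obtain ⟨q, hq, hq'⟩ := le_re_inner_calculus Φ hδ
    filter_upwards [(hρ ρ).2 q hq η hη] with i hi
    rw [h.rowToeplitz_thermalVector, ← h1]
    refine le_trans (le_of_eq ?_) hi
    rw [hq', h3, h4, h1]
    field_simp
    ring

end IsModularFlow

end Toeplitz

section
open scoped ComplexOrder ENNReal

/-- The GNS representation of a positive functional. -/
theorem exists_gns.{u} {A : Type u} [CStarAlgebra A] (f : A →ₗ[ℂ] ℂ)
    (hf : ∀ a, 0 ≤ f (star a * a)) :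
    ∃ (K : Type u) (_ : NormedAddCommGroup K) (_ : InnerProductSpace ℂ K) (_ : CompleteSpace K)
      (Ω : K) (π : A →⋆ₐ[ℂ] (K →L[ℂ] K)), DenseRange (fun a => π a Ω) ∧
      ∀ a, ⟪Ω, π a Ω⟫_ℂ = f a := by
  let _ := CStarAlgebra.spectralOrder A
  have _ := CStarAlgebra.spectralOrderedRing A
  let F : A →ₚ[ℂ] ℂ := PositiveLinearMap.mk₀ f fun x hx => by
    obtain ⟨b, rfl⟩ := CStarAlgebra.nonneg_iff_eq_star_mul_self.1 hx
    exact hf b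
  have hF (a : A) : F a = f a := rfl
  have key (a : A) : F.gnsStarAlgHom a (F.toPreGNS 1 : F.PreGNS) = (F.toPreGNS a : F.PreGNS) := by
    rw [PositiveLinearMap.gnsStarAlgHom_apply]
    simp [PositiveLinearMap.gnsNonUnitalStarAlgHom_apply_coe]
  refine ⟨F.GNS, inferInstance, inferInstance, inferInstance, (F.toPreGNS 1 : F.PreGNS),
    F.gnsStarAlgHom, ?_, fun a => ?_⟩
  · simp only [key]
    exact UniformSpace.Completion.denseRange_coe.comp F.toPreGNS.surjective.denseRange
      (UniformSpace.Completion.continuous_coe _)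
  · rw [key, UniformSpace.Completion.inner_coe, PositiveLinearMap.preGNS_inner_def]
    simp [hF]

section
universe u
variable {E : ℕ → Type u} [∀ i, NormedAddCommGroup (E i)] [∀ i, InnerProductSpace ℂ (E i)]
  [∀ i, CompleteSpace (E i)]

theorem exists_limit_representation (ξ : ∀ i, E i) (hξ : ∀ i, ‖ξ i‖ = 1) [∀ i, Nontrivial (E i)] :
    ∃ (K : Type u) (_ : NormedAddCommGroup K) (_ : InnerProductSpace ℂ K) (_ : CompleteSpace K)
      (Ω : K) (π : lp (fun i => E i →L[ℂ] E i) ∞ →⋆ₐ[ℂ] (K →L[ℂ] K)),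
      DenseRange (fun a => π a Ω) ∧
      ∀ a, Tendsto (fun i => ⟪ξ i, a i (ξ i)⟫_ℂ) (hyperfilter ℕ) (𝓝 ⟪Ω, π a Ω⟫_ℂ) := by
  let A := lp (fun i => E i →L[ℂ] E i) ∞
  let _ : CStarAlgebra A := { }
  have hb (a : A) : ∃ z, Tendsto (fun i => ⟪ξ i, a i (ξ i)⟫_ℂ) (hyperfilter ℕ) (𝓝 z) := by
    have hc := isCompact_closedBall (0 : ℂ) ‖a‖
    have hm : ∀ i, ⟪ξ i, a i (ξ i)⟫_ℂ ∈ Metric.closedBall (0 : ℂ) ‖a‖ := fun i => by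
      rw [mem_closedBall_zero_iff]
      calc _ ≤ ‖ξ i‖ * ‖a i (ξ i)‖ := norm_inner_le_norm _ _
        _ ≤ ‖ξ i‖ * (‖a i‖ * ‖ξ i‖) := by gcongr; exact (a i).le_opNorm _
        _ = ‖a i‖ := by rw [hξ]; ring
        _ ≤ ‖a‖ := lp.norm_apply_le_norm (by simp) a i
    have := hc.ultrafilter_le_nhds ((hyperfilter ℕ).map fun i => ⟪ξ i, a i (ξ i)⟫_ℂ)
      (by rw [Filter.le_principal_iff]; exact Filter.mem_map.2 (Filter.univ_mem' hm))
    obtain ⟨z, -, hz⟩ := this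
    exact ⟨z, hz⟩
  choose f hf using hb
  let F : A →ₗ[ℂ] ℂ :=
    { toFun := f
      map_add' := fun a b => tendsto_nhds_unique (hf _) (((hf a).add (hf b)).congr fun i => by
        rw [show (a + b) i = a i + b i from rfl, add_apply, inner_add_right])
      map_smul' := fun c a => tendsto_nhds_unique (hf _) (((hf a).const_mul c).congr fun i => by
        rw [show (c • a) i = c • a i from rfl, smul_apply, inner_smul_right]) }
  obtain ⟨K, i1, i2, i3, Ω, π, hd, hπ⟩ := exists_gns F fun a =>
    ge_of_tendsto' (hf (star a * a)) fun i => by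
      have : (star a * a) i = star (a i) * a i := rfl
      rw [this, mul_apply_eq_comp, ← inner_apply_left_eq_star]
      exact RCLike.nonneg_iff.2 ⟨inner_self_nonneg, inner_self_im _⟩
  refine ⟨K, i1, i2, i3, Ω, π, hd, fun a => ?_⟩
  rw [hπ]
  exact hf a
end

theorem norm_le_one_of_nonneg_of_le_one {K : Type*} [NormedAddCommGroup K] [InnerProductSpace ℂ K]
    [CompleteSpace K] {T : K →L[ℂ] K} (h0 : 0 ≤ T) (h1 : T ≤ 1) : ‖T‖ ≤ 1 :=
  (CStarAlgebra.norm_le_one_iff_of_nonneg T h0).2 h1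

section
universe u
variable {E : ℕ → Type u} [∀ i, NormedAddCommGroup (E i)] [∀ i, InnerProductSpace ℂ (E i)]
  [∀ i, CompleteSpace (E i)]

/-- Families of contractions with asymptotically commuting action on unit vectors have a limit
family with a tracial vector state. -/
theorem exists_tracial_limit {ι : Type*} [Fintype ι] (ξ : ∀ i, E i) (hξ : ∀ i, ‖ξ i‖ = 1)
    {X Y : ι → ∀ i, E i →L[ℂ] E i} (hX0 : ∀ x i, 0 ≤ X x i) (hX1 : ∀ x i, X x i ≤ 1)
    (hY0 : ∀ x i, 0 ≤ Y x i) (hY1 : ∀ x i, Y x i ≤ 1)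
    (hXY : ∀ x y i, X x i * Y y i = Y y i * X x i)
    (hlim : ∀ x, Tendsto (fun i => ‖X x i (ξ i) - Y x i (ξ i)‖) atTop (𝓝 0)) :
    ∃ (K : Type u) (_ : NormedAddCommGroup K) (_ : InnerProductSpace ℂ K) (_ : CompleteSpace K)
      (Ω : K) (Z W : ι → K →L[ℂ] K), ‖Ω‖ = 1 ∧ (∀ x, 0 ≤ Z x) ∧
      (∀ t : ι → ℂ, (∀ i, ∑ x, t x • X x i = 1) → ∑ x, t x • Z x = 1) ∧
      (∀ t : ι → ℂ, Tendsto (fun i => ‖∑ x, t x • X x i (ξ i)‖ ^ 2) (hyperfilter ℕ)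
        (𝓝 (‖∑ x, t x • Z x Ω‖ ^ 2))) ∧
      (∀ x, 0 ≤ W x) ∧ (∀ x y, Commute (Z x) (W y)) ∧ ∀ x, Z x Ω = W x Ω := by
  have (i : ℕ) : Nontrivial (E i) :=
    ⟨ξ i, 0, fun h0 => by have := hξ i; rw [h0, norm_zero] at this; norm_num at this⟩
  obtain ⟨K, i1, i2, i3, Ω, π, hd, hπ⟩ := exists_limit_representation ξ hξ
  have hx (x) : ∃ a : lp (fun i => E i →L[ℂ] E i) ∞, ∀ i, a i = X x i :=
    ⟨⟨X x, memℓp_infty ⟨1, by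
      rintro _ ⟨i, rfl⟩
      exact norm_le_one_of_nonneg_of_le_one (hX0 x i) (hX1 x i)⟩⟩, fun i => rfl⟩
  have hy (x) : ∃ a : lp (fun i => E i →L[ℂ] E i) ∞, ∀ i, a i = Y x i :=
    ⟨⟨Y x, memℓp_infty ⟨1, by
      rintro _ ⟨i, rfl⟩
      exact norm_le_one_of_nonneg_of_le_one (hY0 x i) (hY1 x i)⟩⟩, fun i => rfl⟩
  choose x' hx' using hx
  choose y' hy' using hy
  have hn (a) : Tendsto (fun i => ‖a i (ξ i)‖ ^ 2) (hyperfilter ℕ) (𝓝 (‖π a Ω‖ ^ 2)) := by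
    have := (Complex.continuous_re.tendsto _).comp (hπ (star a * a))
    rw [map_mul, map_star, mul_apply_eq_comp, ← inner_apply_left_eq_star, re_inner_self_complex]
      at this
    refine this.congr fun i => ?_
    have e : (star a * a) i = star (a i) * a i := rfl
    simp only [Function.comp_apply]
    rw [e, mul_apply_eq_comp, ← inner_apply_left_eq_star, re_inner_self_complex]
  have hpos (a) (ha : ∀ i, 0 ≤ a i) : 0 ≤ π a := by
    refine nonneg_of_forall_inner_nonneg fun v => ?_
    refine hd.induction_on v (isClosed_le continuous_const (by fun_prop)) fun b => ?_
    have := hπ (star b * a * b)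
    rw [map_mul, map_mul, map_star, mul_apply_eq_comp, mul_apply_eq_comp,
      ← inner_apply_left_eq_star] at this
    refine ge_of_tendsto' this fun i => ?_
    have e : (star b * a * b) i = star (b i) * a i * b i := rfl
    rw [e, mul_apply_eq_comp, mul_apply_eq_comp, ← inner_apply_left_eq_star]
    exact ((ContinuousLinearMap.nonneg_iff_isPositive _).1 (ha i)).inner_nonneg_right _
  have hXp (x) : 0 ≤ π (x' x) := hpos _ fun i => by rw [hx']; exact hX0 x i
  have hYp (x) : 0 ≤ π (y' x) := hpos _ fun i => by rw [hy']; exact hY0 x i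
  have hsum (t : ι → ℂ) (i : ℕ) : (∑ x, t x • x' x) i = ∑ x, t x • X x i := by
    rw [lp.coeFn_sum, Finset.sum_apply]
    refine Finset.sum_congr rfl fun x _ => ?_
    rw [← hx']
    rfl
  refine ⟨K, i1, i2, i3, Ω, fun x => π (x' x), fun x => π (y' x), ?_, hXp,
    fun t ht => ?_, fun t => ?_,
    hYp, fun x y => ?_, fun x => ?_⟩
  · have := tendsto_nhds_unique (hn 1) (tendsto_const_nhds.congr fun i => by
      rw [show (1 : lp (fun i => E i →L[ℂ] E i) ∞) i = 1 from rfl, one_apply_eq_self, hξ])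
    rw [map_one, one_apply_eq_self] at this
    exact (sq_eq_sq₀ (norm_nonneg _) zero_le_one).1 this
  · simp only [← map_smul, ← map_sum]
    rw [show ∑ x, t x • x' x = 1 from lp.ext <| funext fun i => by rw [hsum, ht]; rfl, map_one]
  · have e : ∑ x, t x • π (x' x) Ω = π (∑ x, t x • x' x) Ω := by
      rw [map_sum, sum_apply]
      exact Finset.sum_congr rfl fun x _ => by rw [map_smul, smul_apply]
    rw [e]
    refine (hn _).congr fun i => ?_
    rw [hsum, sum_apply]
    rfl
  · change π (x' x) * π (y' y) = π (y' y) * π (x' x)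
    rw [← map_mul, ← map_mul]
    refine congrArg π (lp.ext <| funext fun i => ?_)
    have := hXY x y i
    rwa [← hx', ← hy'] at this
  · have h1 := (hn (x' x - y' x)).congr fun i => by
      rw [show (x' x - y' x) i = x' x i - y' x i from rfl, hx', hy', sub_apply]
    have h2 := ((hlim x).pow 2).mono_left Nat.hyperfilter_le_atTop
    have := tendsto_nhds_unique h1 h2
    rw [zero_pow two_ne_zero, sq_eq_zero_iff, norm_eq_zero, map_sub, sub_apply, sub_eq_zero] at this
    exact this
end

/-- A family of positive contractions in a von Neumann algebra with a cyclic and separating vector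
is modelled, up to the distance to the modular conjugation, by a family with a tracial state. -/
theorem IsModularFlow.exists_tracial_operators.{u} {H : Type u} [NormedAddCommGroup H]
    [InnerProductSpace ℂ H] [CompleteSpace H] {N M : StarSubalgebra ℂ (H →L[ℂ] H)} {ψ : H}
    {C : H →L[ℂ] H} {A : H →L⋆[ℂ] H} {Φ : C(unitInterval, ℂ) →⋆ₐ[ℂ] (H →L[ℂ] H)}
    {U : ℝ → H →L[ℂ] H} {J : H →L⋆[ℂ] H}
    (hc : IsCyclicPair N M ψ) (h : IsModularFlow N M ψ C A Φ U J) (hψ : ‖ψ‖ = 1)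
    {ι : Type*} [Fintype ι] {P : ι → H →L[ℂ] H} (hN : ∀ x, P x ∈ N) (hP0 : ∀ x, 0 ≤ P x)
    (hP1 : ∀ x, P x ≤ 1) :
    ∃ (K : Type u) (_ : NormedAddCommGroup K) (_ : InnerProductSpace ℂ K) (_ : CompleteSpace K)
      (Ω : K) (X Y : ι → K →L[ℂ] K), ‖Ω‖ = 1 ∧ (∀ x, 0 ≤ X x) ∧
      (∀ t : ι → ℂ, ∑ x, t x • P x = 1 → ∑ x, t x • X x = 1) ∧
      (∀ t : ι → ℂ, ‖∑ x, t x • X x Ω‖ ≤ ‖∑ x, t x • P x ψ‖) ∧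
      (∀ x, ∀ δ > 0, ‖P x ψ‖ ^ 2 - 3 * δ * ‖P x ψ‖ ^ 2 -
        3 / (2 * δ) * (‖P x ψ‖ ^ 2 - (⟪P x ψ, J (P x ψ)⟫_ℂ).re) ≤ ‖X x Ω‖ ^ 2) ∧
      (∀ x, 0 ≤ Y x) ∧ (∀ x y, Commute (X x) (Y y)) ∧ ∀ x, X x Ω = Y x Ω := by
  classical
  obtain ⟨d, ξ, X, Y, hξ, hX1, hX0, hY, hXY, hXn, hlim⟩ := h.exists_approximate_trace hc
  simp only [hψ] at hξ
  have hX1' (x i) : X i (P x) ≤ 1 := by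
    have := hX0 i _ (sub_nonneg.2 (hP1 x))
    rwa [map_sub, hX1, sub_nonneg] at this
  obtain ⟨K, i1, i2, i3, Ω, Z, W, hΩ, hZ0, hZ1, hZn, hZt⟩ := exists_tracial_limit ξ hξ
    (X := fun x i => X i (P x)) (Y := fun x i => Y i (P x)) (fun x i => hX0 i _ (hP0 x)) hX1'
    (fun x i => (hY i _ (hP0 x) (hP1 x)).1) (fun x i => (hY i _ (hP0 x) (hP1 x)).2)
    (fun x y i => hXY i _ (hN x) _ (hN y)) (fun x => (hlim _ (hN x) (.of_nonneg (hP0 x))).1)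
  refine ⟨K, i1, i2, i3, Ω, Z, W, hΩ, hZ0, fun t ht => hZ1 t fun i => ?_, fun t => ?_,
    fun x δ hδ => ?_, hZt⟩
  · rw [← hX1 i, ← ht, map_sum]
    exact Finset.sum_congr rfl fun x _ => (map_smul _ _ _).symm
  · refine (pow_le_pow_iff_left₀ (norm_nonneg _) (norm_nonneg _) two_ne_zero).1 ?_
    refine le_of_tendsto' (hZn t) fun i => pow_le_pow_left₀ (norm_nonneg _) ?_ 2
    have := hXn i (∑ x, t x • P x)
    rw [map_sum, sum_apply, sum_apply] at this
    refine (le_of_eq ?_).trans this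
    exact congrArg _ (Finset.sum_congr rfl fun x _ => by rw [map_smul, smul_apply])
  · refine le_of_forall_pos_le_add fun η hη => ?_
    have := (hZn (Pi.single x 1)).add_const η
    simp only [Pi.single_apply, ite_smul, zero_smul, one_smul, Finset.sum_ite_eq',
      Finset.mem_univ, if_true] at this
    exact ge_of_tendsto this <|
      ((hlim _ (hN x) (.of_nonneg (hP0 x))).2 δ hδ η hη).filter_mono Nat.hyperfilter_le_atTop
end

section
variable {K : Type*} [NormedAddCommGroup K] [InnerProductSpace ℂ K] [CompleteSpace K]

theorem commute_starProjection {W : Submodule ℂ K} [W.HasOrthogonalProjection] {s : K →L[ℂ] K}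
    (h1 : ∀ w ∈ W, s w ∈ W) (h2 : ∀ w ∈ W, star s w ∈ W) : Commute W.starProjection s := by
  have key {s : K →L[ℂ] K} (h : ∀ w ∈ W, s w ∈ W) :
      W.starProjection * s * W.starProjection = s * W.starProjection := by
    ext v
    simp only [mul_apply_eq_comp]
    exact Submodule.starProjection_eq_self_iff.2 (h _ (W.starProjection_apply_mem v))
  have h := congrArg star (key h2)
  simp only [star_mul, star_star, (isSelfAdjoint_starProjection W).star_eq] at h
  exact h.symm.trans ((mul_assoc _ _ _).symm.trans (key h1))

/-- The vector state of `Ω` is a trace on the von Neumann algebra `R` with commutant `S`. -/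
structure IsTracialVector (R S : StarSubalgebra ℂ (K →L[ℂ] K)) (Ω : K) : Prop where
  mem_iff : ∀ x, x ∈ R ↔ ∀ y ∈ S, Commute x y
  trace : ∀ x ∈ R, ∀ y ∈ R, ⟪Ω, (x * y) Ω⟫_ℂ = ⟪Ω, (y * x) Ω⟫_ℂ

/-- A vector state is tracial on the von Neumann algebra generated by self-adjoint operators which
act on the vector like operators commuting with all of them. -/
theorem exists_isTracialVector {ι : Type*} {Ω : K} {X Y : ι → K →L[ℂ] K}
    (hX : ∀ x, IsSelfAdjoint (X x)) (hY : ∀ x, IsSelfAdjoint (Y x))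
    (hXY : ∀ x y, Commute (X x) (Y y)) (hΩ : ∀ x, X x Ω = Y x Ω) :
    ∃ R S : StarSubalgebra ℂ (K →L[ℂ] K), IsTracialVector R S Ω ∧ ∀ x, X x ∈ R := by
  let S := StarSubalgebra.centralizer ℂ (Set.range X)
  let R := StarSubalgebra.centralizer ℂ (S : Set (K →L[ℂ] K))
  have mem_S (s) : s ∈ S ↔ ∀ x, Commute (X x) s := by
    simp only [S, StarSubalgebra.mem_centralizer_iff, Set.forall_mem_range, (hX _).star_eq,
      and_self]
    rfl
  have mem_R (x) : x ∈ R ↔ ∀ y ∈ S, Commute x y := by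
    simp only [R, StarSubalgebra.mem_centralizer_iff]
    exact ⟨fun h y hy => (h y hy).1.symm, fun h y hy => ⟨(h y hy).eq.symm,
      (h _ (star_mem hy)).eq.symm⟩⟩
  have comm (a) (ha : a ∈ StarAlgebra.adjoin ℂ (Set.range X)) (s) (hs : s ∈ S) : Commute a s := by
    induction ha using StarAlgebra.adjoin_induction generalizing s with
    | mem x hx => obtain ⟨x, rfl⟩ := hx; exact (mem_S s).1 hs x
    | algebraMap r => exact Algebra.commutes _ _
    | add _ _ _ _ h1 h2 => exact (h1 _ hs).add_left (h2 _ hs)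
    | mul _ _ _ _ h1 h2 => exact (h1 _ hs).mul_left (h2 _ hs)
    | star _ _ h => simpa using (h _ (star_mem hs)).star_star
  have partner (b) (hb : b ∈ StarAlgebra.adjoin ℂ (Set.range X)) :
      ∃ b' ∈ S, b' Ω = b Ω ∧ star b' Ω = star b Ω := by
    induction hb using StarAlgebra.adjoin_induction with
    | mem x hx =>
      obtain ⟨x, rfl⟩ := hx
      exact ⟨Y x, (mem_S _).2 fun y => hXY y x, (hΩ x).symm, by
        rw [(hX x).star_eq, (hY x).star_eq, hΩ]⟩
    | algebraMap r => exact ⟨algebraMap ℂ _ r, algebraMap_mem S r, rfl, rfl⟩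
    | add b c hb hc h1 h2 =>
      obtain ⟨b', hb', e1, e2⟩ := h1
      obtain ⟨c', hc', e3, e4⟩ := h2
      exact ⟨b' + c', add_mem hb' hc', by simp only [add_apply, e1, e3],
        by simp only [star_add, add_apply, e2, e4]⟩
    | mul b c hb hc h1 h2 =>
      obtain ⟨b', hb', e1, e2⟩ := h1
      obtain ⟨c', hc', e3, e4⟩ := h2
      refine ⟨c' * b', mul_mem hc' hb', ?_, ?_⟩
      · rw [mul_apply_eq_comp, e1, ← mul_apply_eq_comp, ← (comm b hb c' hc').eq,
          mul_apply_eq_comp, e3, mul_apply_eq_comp]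
      · rw [star_mul, star_mul, mul_apply_eq_comp, e4, ← mul_apply_eq_comp,
          ← (comm _ (star_mem hc) _ (star_mem hb')).eq, mul_apply_eq_comp, e2, mul_apply_eq_comp]
    | star b hb h =>
      obtain ⟨b', hb', e1, e2⟩ := h
      exact ⟨star b', star_mem hb', e2, by rwa [star_star, star_star]⟩
  have half (x) (hx : x ∈ R) (b) (hb : b ∈ StarAlgebra.adjoin ℂ (Set.range X)) :
      ⟪star x Ω, b Ω⟫_ℂ = ⟪star b Ω, x Ω⟫_ℂ := by
    obtain ⟨b', hb', e1, e2⟩ := partner b hb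
    rw [← e1, ← e2, inner_apply_left_eq_star, inner_apply_left_eq_star, star_star, star_star,
      ← mul_apply_eq_comp, ← mul_apply_eq_comp, ((mem_R x).1 hx b' hb').eq]
  have sub (a) (ha : a ∈ StarAlgebra.adjoin ℂ (Set.range X)) : a ∈ R :=
    (mem_R a).2 fun s hs => comm a ha s hs
  let W : Submodule ℂ K := (StarAlgebra.adjoin ℂ (Set.range X)).toSubalgebra.toSubmodule.map
    (ContinuousLinearMap.apply ℂ K Ω : (K →L[ℂ] K) →ₗ[ℂ] K)
  have hW (a) (ha : a ∈ StarAlgebra.adjoin ℂ (Set.range X)) : ∀ w ∈ W.topologicalClosure,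
      a w ∈ W.topologicalClosure := by
    intro w hw
    refine map_mem_closure (f := a) (s := (W : Set K)) a.continuous hw ?_
    rintro _ ⟨b, hb, rfl⟩
    exact ⟨a * b, mul_mem (S := StarSubalgebra ℂ (K →L[ℂ] K)) ha hb, rfl⟩
  have hΩW : Ω ∈ W.topologicalClosure :=
    W.le_topologicalClosure ⟨1, one_mem (StarAlgebra.adjoin ℂ (Set.range X)), rfl⟩
  have hcl (x) (hx : x ∈ R) : x Ω ∈ W.topologicalClosure := by
    have he : W.topologicalClosure.starProjection ∈ S := (mem_S _).2 fun x =>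
      have hm := StarAlgebra.subset_adjoin ℂ _ (Set.mem_range_self x)
      (commute_starProjection (hW _ hm) (hW _ (star_mem hm))).symm
    have := DFunLike.congr_fun ((mem_R x).1 hx _ he).eq Ω
    rw [mul_apply_eq_comp, mul_apply_eq_comp, Submodule.starProjection_eq_self_iff.2 hΩW] at this
    rw [this]
    exact Submodule.starProjection_apply_mem _ _
  have le (z) (hz : z ∈ R) : ‖star z Ω‖ ≤ ‖z Ω‖ := by
    have key : ∀ w ∈ W.topologicalClosure, ‖⟪star z Ω, w⟫_ℂ‖ ≤ ‖z Ω‖ * ‖w‖ := by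
      have hc : IsClosed {w | ‖⟪star z Ω, w⟫_ℂ‖ ≤ ‖z Ω‖ * ‖w‖} :=
        isClosed_le (by fun_prop) (by fun_prop)
      refine closure_minimal (s := (W : Set K)) ?_ hc
      rintro _ ⟨b, hb, rfl⟩
      have hb' : ‖star b Ω‖ = ‖b Ω‖ := by
        have := congrArg Complex.re (half (star b) (star_mem (sub b hb)) b hb)
        rw [star_star, re_inner_self_complex, re_inner_self_complex] at this
        exact (sq_eq_sq₀ (norm_nonneg _) (norm_nonneg _)).1 this.symm
      change ‖⟪star z Ω, b Ω⟫_ℂ‖ ≤ ‖z Ω‖ * ‖b Ω‖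
      rw [half z hz b hb, ← hb', mul_comm]
      exact norm_inner_le_norm _ _
    have := key _ (hcl _ (star_mem hz))
    rw [inner_self_eq_norm_sq_to_K, norm_pow, RCLike.norm_ofReal, abs_norm, sq] at this
    rcases (norm_nonneg (star z Ω)).eq_or_lt with h0 | h0
    · exact h0 ▸ norm_nonneg _
    · exact le_of_mul_le_mul_right this h0
  have eq (z) (hz : z ∈ R) : ‖star z Ω‖ = ‖z Ω‖ :=
    (le z hz).antisymm (by simpa using le _ (star_mem hz))
  have hre (x) (hx : x ∈ R) (y) (hy : y ∈ R) :
      (⟪star x Ω, y Ω⟫_ℂ).re = (⟪star y Ω, x Ω⟫_ℂ).re := by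
    have h1 := eq (star x + y) (add_mem (star_mem hx) hy)
    have h2 := eq x hx
    have h3 := eq y hy
    have h4 := @norm_add_sq ℂ _ _ _ _ (star x Ω) (y Ω)
    have h5 := @norm_add_sq ℂ _ _ _ _ (star y Ω) (x Ω)
    rw [star_add, star_star, add_apply, add_apply, add_comm] at h1
    rw [h1, h2, h3] at *
    simp only [RCLike.re_eq_complex_re] at h4 h5
    linarith
  refine ⟨R, S, ⟨mem_R, fun x hx y hy => ?_⟩, fun x =>
    sub _ (StarAlgebra.subset_adjoin ℂ _ (Set.mem_range_self x))⟩
  suffices ⟪star x Ω, y Ω⟫_ℂ = ⟪star y Ω, x Ω⟫_ℂ by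
    simpa only [inner_apply_left_eq_star, star_star, ← mul_apply_eq_comp] using this
  refine Complex.ext (hre x hx y hy) ?_
  have := hre x hx (Complex.I • y) (R.smul_mem hy _)
  simp only [smul_apply, inner_smul_right, star_smul, inner_smul_left] at this
  simpa using this

/-- The orthogonal projection onto the complement of the kernel. -/
noncomputable def supportProj (x : K →L[ℂ] K) : K →L[ℂ] K :=
  1 - (LinearMap.ker (x : K →ₗ[ℂ] K)).starProjection

theorem isStarProjection_supportProj (x : K →L[ℂ] K) : IsStarProjection (supportProj x) :=
  isStarProjection_starProjection.one_sub

theorem mul_supportProj (x : K →L[ℂ] K) : x * supportProj x = x := by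
  ext v
  have : x ((LinearMap.ker (x : K →ₗ[ℂ] K)).starProjection v) = 0 :=
    (LinearMap.ker (x : K →ₗ[ℂ] K)).starProjection_apply_mem v
  simp [supportProj, this]

theorem supportProj_apply_eq_zero {x : K →L[ℂ] K} {v : K} (h : x v = 0) : supportProj x v = 0 := by
  have : v ∈ LinearMap.ker (x : K →ₗ[ℂ] K) := h
  simp [supportProj, Submodule.starProjection_eq_self_iff.2 this]

theorem supportProj_mul_eq_zero {x y : K →L[ℂ] K} (h : x * y = 0) : supportProj x * y = 0 :=
  ContinuousLinearMap.ext fun v => supportProj_apply_eq_zero (DFunLike.congr_fun h v)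

theorem supportProj_mul_eq_self {x e : K →L[ℂ] K} (h : x * e = x) :
    supportProj x * e = supportProj x := by
  have := supportProj_mul_eq_zero (x := x) (y := 1 - e) (by rw [mul_sub, h, mul_one, sub_self])
  rwa [mul_sub, mul_one, sub_eq_zero, eq_comm] at this

namespace IsTracialVector
variable {R S : StarSubalgebra ℂ (K →L[ℂ] K)} {Ω : K}

theorem supportProj_mem (h : IsTracialVector R S Ω) {x : K →L[ℂ] K} (hx : x ∈ R) :
    supportProj x ∈ R := by
  refine sub_mem (one_mem R) ((h.mem_iff _).2 fun y hy => commute_starProjection ?_ ?_)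
  · intro w hw
    change x (y w) = 0
    rw [← mul_apply_eq_comp, ((h.mem_iff x).1 hx y hy).eq, mul_apply_eq_comp,
      show x w = 0 from hw, map_zero]
  · intro w hw
    change x (star y w) = 0
    rw [← mul_apply_eq_comp, ((h.mem_iff x).1 hx _ (star_mem hy)).eq, mul_apply_eq_comp,
      show x w = 0 from hw, map_zero]

theorem trace_one_sub_pow (h : IsTracialVector R S Ω) {x : K →L[ℂ] K} (hx : x ∈ R) (n : ℕ) :
    ⟪Ω, ((1 - star x * x) ^ n) Ω⟫_ℂ = ⟪Ω, ((1 - x * star x) ^ n) Ω⟫_ℂ := by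
  have key (n : ℕ) : x * (1 - star x * x) ^ n = (1 - x * star x) ^ n * x :=
    (SemiconjBy.pow_right (a := x) (by
      simp only [SemiconjBy, mul_sub, sub_mul, mul_one, one_mul, mul_assoc]) n)
  have hm : (1 - star x * x) ^ n ∈ R :=
    pow_mem (sub_mem (one_mem R) (mul_mem (star_mem hx) hx)) n
  induction n with
  | zero => simp
  | succ n ih =>
    have hm : (1 - star x * x) ^ n ∈ R :=
      pow_mem (sub_mem (one_mem R) (mul_mem (star_mem hx) hx)) n
    rw [pow_succ, pow_succ, mul_sub, mul_sub, mul_one, mul_one, sub_apply, sub_apply,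
      inner_sub_right, inner_sub_right, ih hm, ← mul_assoc, ← mul_assoc,
      h.trace _ (mul_mem hm (star_mem hx)) x hx, ← mul_assoc, key]

theorem tendsto_one_sub_pow {x : K →L[ℂ] K} (hx : ‖x‖ ≤ 1) (v : K) :
    Tendsto (fun n : ℕ => ((n : ℂ)⁻¹ • ∑ k ∈ Finset.range n, ((1 - star x * x) ^ k) v)) atTop
      (𝓝 (v - supportProj x v)) := by
  have h0 : 0 ≤ star x * x := star_mul_self_nonneg x
  have h1 : star x * x ≤ 1 := CStarAlgebra.norm_le_one_iff_of_nonneg _ h0 |>.1 (by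
    rw [CStarRing.norm_star_mul_self]; exact mul_le_one₀ hx (norm_nonneg _) hx)
  have hn : ‖1 - star x * x‖ ≤ 1 :=
    norm_le_one_of_nonneg_of_le_one (sub_nonneg.2 h1) (sub_le_self _ h0)
  have := ContinuousLinearMap.tendsto_birkhoffAverage_orthogonalProjection _ hn v
  have e : (1 - star x * x).eqLocus (1 : K →L[ℂ] K) = LinearMap.ker (x : K →ₗ[ℂ] K) := by
    ext w
    change (1 - star x * x) w = w ↔ x w = 0
    rw [sub_apply, one_apply_eq_self, mul_apply_eq_comp, sub_eq_self]
    refine ⟨fun hw => ?_, fun hw => by rw [hw, map_zero]⟩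
    have : ‖x w‖ ^ 2 = 0 := by
      rw [← re_inner_self_complex, inner_apply_left_eq_star, hw, inner_zero_right, Complex.zero_re]
    simpa using this
  have hproj (W₁ W₂ : Submodule ℂ K) [W₁.HasOrthogonalProjection] [W₂.HasOrthogonalProjection]
      (h : W₁ = W₂) : W₁.starProjection v = W₂.starProjection v := by subst h; rfl
  have hlim : v - supportProj x v =
      ((1 - star x * x).eqLocus (1 : K →L[ℂ] K)).starProjection v := by
    rw [hproj _ _ e]
    simp [supportProj]
  rw [hlim]
  refine this.congr fun n => ?_
  simp only [birkhoffAverage, birkhoffSum, id]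
  congr! 2 with k
  rw [← FunLike.coe_pow_eq_iterate]

/-- The two support projections of an element have the same trace. -/
theorem trace_supportProj (h : IsTracialVector R S Ω) {x : K →L[ℂ] K} (hx : x ∈ R)
    (hn : ‖x‖ ≤ 1) : ⟪Ω, supportProj (star x) Ω⟫_ℂ = ⟪Ω, supportProj x Ω⟫_ℂ := by
  have h1 := tendsto_const_nhds (x := Ω).inner (tendsto_one_sub_pow hn Ω) (𝕜 := ℂ)
  have h2 := tendsto_const_nhds (x := Ω).inner
    (tendsto_one_sub_pow (x := star x) (by rwa [norm_star]) Ω) (𝕜 := ℂ)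
  simp only [star_star, inner_smul_right, inner_sum, ← h.trace_one_sub_pow hx] at h1 h2
  have := tendsto_nhds_unique h1 h2
  simpa [inner_sub_right] using this.symm
end IsTracialVector

/-- The real part of the vector functional of `Ω`. -/
noncomputable def reState (Ω : K) : (K →L[ℂ] K) →ₗ[ℝ] ℝ where
  toFun x := (⟪Ω, x Ω⟫_ℂ).re
  map_add' x y := by rw [add_apply, inner_add_right, Complex.add_re]
  map_smul' t x := by
    have : (t • x) Ω = (t : ℂ) • x Ω := by simp
    rw [this, inner_smul_right, Complex.re_ofReal_mul, RingHom.id_apply, smul_eq_mul]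

theorem reState_apply {E : Type*} [NormedAddCommGroup E] [InnerProductSpace ℂ E] (Ω : E)
    (x : E →L[ℂ] E) : reState Ω x = (⟪Ω, x Ω⟫_ℂ).re := rfl

theorem reState_star_mul (Ω : K) (x y : K →L[ℂ] K) :
    reState Ω (star x * y) = (⟪x Ω, y Ω⟫_ℂ).re := by
  rw [reState_apply, mul_apply_eq_comp, inner_apply_left_eq_star]

theorem reState_star_mul_self (Ω : K) (x : K →L[ℂ] K) : reState Ω (star x * x) = ‖x Ω‖ ^ 2 := by
  rw [reState_star_mul, re_inner_self_complex]

theorem reState_star (Ω : K) (x : K →L[ℂ] K) : reState Ω (star x) = reState Ω x := by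
  rw [← mul_one (star x), reState_star_mul, one_apply_eq_self, reState_apply, ← inner_conj_symm,
    Complex.conj_re]

theorem reState_one {E : Type*} [NormedAddCommGroup E] [InnerProductSpace ℂ E] {Ω : E}
    (hΩ : ‖Ω‖ = 1) : reState Ω 1 = 1 := by
  rw [reState_apply, one_apply_eq_self, re_inner_self_complex, hΩ, one_pow]

theorem reState_nonneg {E : Type*} [NormedAddCommGroup E] [InnerProductSpace ℂ E] (Ω : E)
    {x : E →L[ℂ] E} (hx : 0 ≤ x) : 0 ≤ reState Ω x :=
  ((ContinuousLinearMap.nonneg_iff_isPositive _).1 hx).re_inner_nonneg_right Ω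

namespace IsTracialVector
variable {R S : StarSubalgebra ℂ (K →L[ℂ] K)} {Ω : K}

theorem reState_mul_comm (h : IsTracialVector R S Ω) {x y : K →L[ℂ] K} (hx : x ∈ R) (hy : y ∈ R) :
    reState Ω (x * y) = reState Ω (y * x) := congrArg Complex.re (h.trace x hx y hy)

theorem reState_star_mul_mul_nonneg (h : IsTracialVector R S Ω) {x y : K →L[ℂ] K} (hx : x ∈ R)
    (hy : y ∈ R) (hy0 : 0 ≤ y) : 0 ≤ reState Ω (star x * x * y) := by
  rw [mul_assoc, h.reState_mul_comm (star_mem hx) (mul_mem hx hy)]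
  exact reState_nonneg Ω (star_right_conjugate_nonneg hy0 x)

theorem reState_mul_nonneg (h : IsTracialVector R S Ω) {e y : K →L[ℂ] K} (he : IsStarProjection e)
    (heR : e ∈ R) (hy : y ∈ R) (hy0 : 0 ≤ y) : 0 ≤ reState Ω (e * y) := by
  have := h.reState_star_mul_mul_nonneg heR hy hy0
  rwa [he.isSelfAdjoint.star_eq, he.isIdempotentElem] at this

theorem cfcₙ_mem (h : IsTracialVector R S Ω) {x : K →L[ℂ] K} (hx : x ∈ R) (f : ℝ → ℝ) :
    cfcₙ f x ∈ R := (h.mem_iff _).2 fun y hy => ((h.mem_iff x).1 hx y hy).cfcₙ_real f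

/-- A self-adjoint element is cut by a spectral projection into a nonnegative and a nonpositive
part. -/
theorem exists_spectral_projection (h : IsTracialVector R S Ω) {x : K →L[ℂ] K} (hx : x ∈ R)
    (hs : IsSelfAdjoint x) :
    ∃ q ∈ R, IsStarProjection q ∧ Commute q x ∧ 0 ≤ q * x ∧ (1 - q) * x ≤ 0 := by
  have hm : x⁻ ∈ R := h.cfcₙ_mem hx _
  have hms : IsSelfAdjoint x⁻ := .of_nonneg (CFC.negPart_nonneg x)
  have hps : IsSelfAdjoint x⁺ := .of_nonneg (CFC.posPart_nonneg x)
  have he := isStarProjection_supportProj x⁻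
  have h1 : x⁻ * supportProj x⁻ = x⁻ := mul_supportProj _
  have h1' : supportProj x⁻ * x⁻ = x⁻ := by
    have := congrArg star h1
    rwa [star_mul, he.isSelfAdjoint.star_eq, hms.star_eq] at this
  have h2 : supportProj x⁻ * x⁺ = 0 := supportProj_mul_eq_zero (CFC.negPart_mul_posPart x)
  have h2' : x⁺ * supportProj x⁻ = 0 := by
    have := congrArg star h2
    rwa [star_mul, he.isSelfAdjoint.star_eq, hps.star_eq, star_zero] at this
  have hd := CFC.posPart_sub_negPart x hs
  have e1 : supportProj x⁻ * x = - x⁻ := by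
    rw [← zero_sub, ← h2]; nth_rw 3 [← h1']; rw [← mul_sub, hd]
  have e2 : x * supportProj x⁻ = - x⁻ := by
    rw [← zero_sub, ← h2']; nth_rw 3 [← h1]; rw [← sub_mul, hd]
  refine ⟨1 - supportProj x⁻, sub_mem (one_mem _) (h.supportProj_mem hm), he.one_sub, ?_, ?_, ?_⟩
  · exact (Commute.one_left x).sub_left (e1.trans e2.symm)
  · rw [sub_mul, one_mul, e1, sub_neg_eq_add]
    exact (CFC.posPart_nonneg x).trans_eq (sub_eq_iff_eq_add.1 hd)
  · rw [sub_sub_cancel, e1]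
    exact neg_nonpos.2 (CFC.negPart_nonneg x)

end IsTracialVector

theorem IsStarProjection.mul_eq_right_of_mul_eq_left {e f : K →L[ℂ] K} (he : IsStarProjection e)
    (hf : IsStarProjection f) (h : e * f = e) : f * e = e := by
  simpa [he.isSelfAdjoint.star_eq, hf.isSelfAdjoint.star_eq] using congrArg star h

theorem IsStarProjection.norm_le_one {e : K →L[ℂ] K} (he : IsStarProjection e) : ‖e‖ ≤ 1 :=
  norm_le_one_of_nonneg_of_le_one he.nonneg he.le_one

/-- The ranges of the subprojections `q' x` of `q x` for `x ∈ s` are linearly independent, and the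
projection `T` onto their closed span dominates all `q x`. -/
structure IsIndependentRefinement {ι : Type*} (R : StarSubalgebra ℂ (K →L[ℂ] K)) (Ω : K)
    (s : Finset ι) (q q' : ι → K →L[ℂ] K) (T : K →L[ℂ] K) : Prop where
  mem : ∀ x, q' x ∈ R
  proj : ∀ x, IsStarProjection (q' x)
  le : ∀ x ∈ s, q x * q' x = q' x
  mem_sup : T ∈ R
  proj_sup : IsStarProjection T
  sup_mul : ∀ x ∈ s, T * q x = q x
  state_sup : reState Ω T = ∑ x ∈ s, reState Ω (q' x)
  independent : ∀ η : ι → K, ∑ x ∈ s, q' x (η x) = 0 → ∀ x ∈ s, q' x (η x) = 0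
  sup_apply : ∀ η : K, (∀ x ∈ s, q' x η = 0) → T η = 0

theorem IsTracialVector.exists_isIndependentRefinement {R S : StarSubalgebra ℂ (K →L[ℂ] K)} {Ω : K}
    (h : IsTracialVector R S Ω) {ι : Type*} {q : ι → K →L[ℂ] K} (hq : ∀ x, q x ∈ R)
    (hp : ∀ x, IsStarProjection (q x)) (s : Finset ι) :
    ∃ q' T, IsIndependentRefinement R Ω s q q' T := by
  classical
  induction s using Finset.induction_on with
  | empty =>
    exact ⟨0, 0, fun _ => zero_mem _, fun _ => .zero _, by simp, zero_mem _, .zero _,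
      by simp, by simp,
      by simp, by simp⟩
  | insert a s ha ih =>
    obtain ⟨q', T, i⟩ := ih
    have hpa := (hp a).isIdempotentElem.eq
    have hsa := (hp a).isSelfAdjoint.star_eq
    have hpT := i.proj_sup.isIdempotentElem.eq
    have hsT := i.proj_sup.isSelfAdjoint.star_eq
    set x := (1 - T) * q a with hx
    have hxs : star x = q a * (1 - T) := by
      rw [hx, star_mul, star_sub, star_one, hsa, hsT]
    have hxR : x ∈ R := mul_mem (sub_mem (one_mem R) i.mem_sup) (hq a)
    have hxn : ‖x‖ ≤ 1 := (norm_mul_le _ _).trans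
      (mul_le_one₀ i.proj_sup.one_sub.norm_le_one (norm_nonneg _) (hp a).norm_le_one)
    have hxq : x * q a = x := by rw [hx, mul_assoc, hpa]
    set e := supportProj (star x) with he
    set f := supportProj x with hf
    have hep : IsStarProjection e := isStarProjection_supportProj _
    have hfp : IsStarProjection f := isStarProjection_supportProj _
    have heT : e * T = 0 := supportProj_mul_eq_zero (by
      rw [hxs, mul_assoc, sub_mul, one_mul, hpT, sub_self, mul_zero])
    have hTe : T * e = 0 := by
      simpa [hep.isSelfAdjoint.star_eq, hsT] using congrArg star heT
    have hex : e * x = x := by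
      simpa [← he, hep.isSelfAdjoint.star_eq] using congrArg star (mul_supportProj (star x))
    have hfq : f * q a = f := supportProj_mul_eq_self hxq
    have hqf : q a * f = f := hfp.mul_eq_right_of_mul_eq_left (hp a) hfq
    have hxf : x * f = x := mul_supportProj x
    have hTf : T * (q a - f) = q a - f := by
      have : (1 - T) * (q a - f) = 0 := by
        rw [mul_sub, ← hx, ← hqf, ← mul_assoc, ← hx, hxf, sub_self]
      rwa [sub_mul, one_mul, sub_eq_zero, eq_comm] at this
    have hfT : (q a - f) * T = q a - f := by
      simpa [hsa, hfp.isSelfAdjoint.star_eq, hsT] using congrArg star hTf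
    have hne : ∀ y ∈ s, y ≠ a := fun y hy h => ha (h ▸ hy)
    refine ⟨Function.update q' a f, T + e, fun y => ?_, fun y => ?_, fun y hy => ?_,
      add_mem i.mem_sup (h.supportProj_mem (star_mem hxR)), ⟨?_, ?_⟩, fun y hy => ?_, ?_,
      fun η hη => ?_, fun η hη => ?_⟩
    · rcases eq_or_ne y a with rfl | hy
      · rw [Function.update_self]; exact h.supportProj_mem hxR
      · rw [Function.update_of_ne hy]; exact i.mem y
    · rcases eq_or_ne y a with rfl | hy
      · rwa [Function.update_self]
      · rw [Function.update_of_ne hy]; exact i.proj y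
    · rcases Finset.mem_insert.1 hy with rfl | hy
      · rwa [Function.update_self]
      · rw [Function.update_of_ne (hne y hy)]; exact i.le y hy
    · rw [IsIdempotentElem, mul_add, add_mul, add_mul, hpT, heT, hTe, hep.isIdempotentElem.eq,
        add_zero, zero_add]
    · exact i.proj_sup.isSelfAdjoint.add hep.isSelfAdjoint
    · rcases Finset.mem_insert.1 hy with rfl | hy
      · have : e * q y = x := by
          rw [← hex, hx, sub_mul, one_mul, mul_sub, ← mul_assoc, heT, zero_mul, sub_zero]
        rw [add_mul, this, hx, sub_mul, one_mul, add_sub_cancel]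
      · rw [add_mul, i.sup_mul y hy, ← i.sup_mul y hy, ← mul_assoc, heT, zero_mul, add_zero]
    · rw [Finset.sum_insert ha, Function.update_self, map_add, i.state_sup, add_comm]
      congr 1
      · exact congrArg Complex.re (h.trace_supportProj hxR hxn)
      · exact Finset.sum_congr rfl fun y hy => by rw [Function.update_of_ne (hne y hy)]
    · have hsum : ∑ y ∈ s, Function.update q' a f y (η y) = ∑ y ∈ s, q' y (η y) :=
        Finset.sum_congr rfl fun y hy => by rw [Function.update_of_ne (hne y hy)]
      rw [Finset.sum_insert ha, Function.update_self, hsum] at hη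
      have h1 : T (∑ y ∈ s, q' y (η y)) = ∑ y ∈ s, q' y (η y) := by
        rw [map_sum]
        refine Finset.sum_congr rfl fun y hy => ?_
        rw [← mul_apply_eq_comp, ← i.le y hy, ← mul_assoc, i.sup_mul y hy]
      have h2 : T (f (η a)) = f (η a) := by
        rw [eq_neg_of_add_eq_zero_left hη, map_neg, h1]
      have h3 : f (η a) = 0 := by
        have : f (f (η a)) = 0 := supportProj_apply_eq_zero (by
          rw [hx, mul_apply_eq_comp, ← mul_apply_eq_comp (q a), hqf, sub_apply, one_apply_eq_self,
            h2, sub_self])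
        rwa [← mul_apply_eq_comp, hfp.isIdempotentElem.eq] at this
      rw [h3, zero_add] at hη
      intro y hy
      rcases Finset.mem_insert.1 hy with rfl | hy
      · rwa [Function.update_self]
      · rw [Function.update_of_ne (hne y hy)]
        exact i.independent η hη y hy
    · have hT : T η = 0 := i.sup_apply η fun y hy => by
        simpa [Function.update_of_ne (hne y hy)] using hη y (Finset.mem_insert_of_mem hy)
      have hfη : f η = 0 := by simpa using hη a (Finset.mem_insert_self a s)
      have hqη : q a η = 0 := by
        have := DFunLike.congr_fun hfT η
        rw [mul_apply_eq_comp, hT, map_zero, sub_apply, hfη, sub_zero] at this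
        exact this.symm
      have : e η = 0 := supportProj_apply_eq_zero (by
        rw [hxs, mul_apply_eq_comp, sub_apply, one_apply_eq_self, hT, sub_zero, hqη])
      rw [add_apply, hT, this, add_zero]

theorem eq_of_mul_eq_mul_of_denseRange {E : Type*} [NormedAddCommGroup E] [InnerProductSpace ℂ E]
    {a b T : E →L[ℂ] E} (hT : DenseRange T) (h : a * T = b * T) : a = b :=
  ContinuousLinearMap.coeFn_injective
    (hT.equalizer a.continuous b.continuous (funext fun v => DFunLike.congr_fun h v))

theorem IsTracialVector.exists_orthogonalization {R S : StarSubalgebra ℂ (K →L[ℂ] K)} {Ω : K}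
    (h : IsTracialVector R S Ω) {ι : Type*} [Fintype ι] {q : ι → K →L[ℂ] K} (hq : ∀ x, q x ∈ R)
    (hp : ∀ x, IsStarProjection (q x))
    (hi : ∀ η : ι → K, ∑ x, q x (η x) = 0 → ∀ x, q x (η x) = 0)
    (hz : ∀ η : K, (∀ x, q x η = 0) → η = 0) :
    ∃ (T : K →L[ℂ] K) (w : ι → K →L[ℂ] K), 0 ≤ T ∧ T * T = ∑ x, q x ∧ (∀ x, w x ∈ R) ∧
      (∀ x, w x * T = q x) ∧ ∑ x, star (w x) * w x = 1 ∧ (∀ x, q x * w x = w x) ∧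
      (∀ x, w x * star (w x) = q x) ∧ ∀ x y, x ≠ y → w x * star (w y) = 0 := by
  classical
  have hS0 : 0 ≤ ∑ x, q x := Finset.sum_nonneg fun x _ => (hp x).nonneg
  have hSR : ∑ x, q x ∈ R := sum_mem fun x _ => hq x
  set T := CFC.sqrt (∑ x, q x) with hTdef
  have hT0 : 0 ≤ T := CFC.sqrt_nonneg _
  have hTT : T * T = ∑ x, q x := CFC.sqrt_mul_sqrt_self _ hS0
  have hTs : star T = T := (IsSelfAdjoint.of_nonneg hT0).star_eq
  have hcomm (y : K →L[ℂ] K) (hy : y ∈ S) : Commute T y := by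
    rw [hTdef, CFC.sqrt_eq_cfc]
    exact Commute.cfc_nnreal ((h.mem_iff _).1 hSR y hy) _
  have hnorm (v : K) : ‖T v‖ ^ 2 = ∑ x, ‖q x v‖ ^ 2 := by
    rw [← reState_star_mul_self, hTs, hTT, map_sum]
    refine Finset.sum_congr rfl fun x _ => ?_
    rw [← reState_star_mul_self, (hp x).isSelfAdjoint.star_eq, (hp x).isIdempotentElem.eq]
  have hle (x : ι) (v : K) : ‖q x v‖ ≤ 1 * ‖T v‖ := by
    rw [one_mul]
    refine (sq_le_sq₀ (norm_nonneg _) (norm_nonneg _)).1 ?_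
    rw [hnorm]
    exact Finset.single_le_sum (f := fun x => ‖q x v‖ ^ 2) (fun _ _ => sq_nonneg _)
      (Finset.mem_univ x)
  have hd : DenseRange T := by
    have : (LinearMap.range T.toLinearMap).topologicalClosure = ⊤ := by
      rw [Submodule.topologicalClosure_eq_top_iff, Submodule.eq_bot_iff]
      intro η hη
      have h0 : T η = 0 := by
        rw [← inner_self_eq_zero (𝕜 := ℂ), inner_apply_left_eq_star, hTs, ← inner_conj_symm]
        exact (congrArg _ (hη _ ⟨T η, rfl⟩)).trans (map_zero _)
      refine hz η fun x => norm_le_zero_iff.1 ((hle x η).trans ?_)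
      rw [h0, norm_zero, mul_zero]
    exact Submodule.dense_iff_topologicalClosure_eq_top.2 this
  let w (x : ι) : K →L[ℂ] K := (q x).toLinearMap.extendOfNorm T.toLinearMap
  have hw (x : ι) : w x * T = q x := ContinuousLinearMap.ext fun v =>
    LinearMap.extendOfNorm_eq (f := (q x).toLinearMap) (e := T.toLinearMap) hd ⟨1, hle x⟩ v
  have hw' (x : ι) : T * star (w x) = q x := by
    simpa [hTs, (hp x).isSelfAdjoint.star_eq] using congrArg star (hw x)
  have hqw (x : ι) : q x * w x = w x := eq_of_mul_eq_mul_of_denseRange hd (by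
    rw [mul_assoc, hw, (hp x).isIdempotentElem.eq])
  have hsum : ∑ x, star (w x) * w x = 1 := by
    have h1 : T * ∑ x, star (w x) * w x = T := eq_of_mul_eq_mul_of_denseRange hd (by
      rw [hTT, Finset.mul_sum, Finset.sum_mul]
      refine Finset.sum_congr rfl fun x _ => ?_
      rw [← mul_assoc, hw', mul_assoc, hw, (hp x).isIdempotentElem.eq])
    refine eq_of_mul_eq_mul_of_denseRange hd ?_
    simpa [hTs] using congrArg star h1
  have hww (x y : ι) (η : K) : (w x * star (w y)) η = if x = y then q y η else 0 := by
    have h1 : ∑ x, q x ((w x * star (w y)) η - if x = y then η else 0) = 0 := by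
      simp only [map_sub, Finset.sum_sub_distrib, apply_ite (q _), map_zero, Finset.sum_ite_eq',
        Finset.mem_univ, if_true]
      rw [sub_eq_zero]
      calc ∑ x, q x ((w x * star (w y)) η) = ((T * ∑ x, star (w x) * w x) * star (w y)) η := by
            rw [Finset.mul_sum, Finset.sum_mul, sum_apply]
            refine Finset.sum_congr rfl fun x _ => ?_
            rw [← mul_apply_eq_comp, ← mul_assoc, ← mul_assoc, hw']
        _ = q y η := by rw [hsum, mul_one, hw']
    have h2 := hi _ h1 x
    rw [map_sub, sub_eq_zero, ← mul_apply_eq_comp, ← mul_assoc, hqw] at h2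
    rw [h2]
    split_ifs with hxy
    · rw [hxy]
    · rw [map_zero]
  refine ⟨T, w, hT0, hTT, fun x => (h.mem_iff _).2 fun y hy => ?_, hw, hsum, hqw,
    fun x => ContinuousLinearMap.ext fun η => ?_,
    fun x y hxy => ContinuousLinearMap.ext fun η => ?_⟩
  · refine eq_of_mul_eq_mul_of_denseRange hd ?_
    rw [mul_assoc, ← (hcomm y hy).eq, ← mul_assoc, hw, mul_assoc, hw,
      ((h.mem_iff _).1 (hq x) y hy).eq]
  · rw [hww, if_pos rfl]
  · rw [hww, if_neg hxy, zero_apply]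

namespace IsTracialVector
variable {R S : StarSubalgebra ℂ (K →L[ℂ] K)} {Ω : K}

theorem exists_almost_orthogonal_projections (h : IsTracialVector R S Ω) (hΩ : ‖Ω‖ = 1)
    {ι : Type*} [Fintype ι] [DecidableEq ι] {X : ι → K →L[ℂ] K} (hX : ∀ x, X x ∈ R)
    (hX0 : ∀ x, 0 ≤ X x) (hX1 : ∑ x, X x = 1) {κ : ℝ} (hκ : 1 - κ ≤ ∑ x, ‖X x Ω‖ ^ 2) :
    ∃ (q : ι → K →L[ℂ] K) (u v : ℝ), (∀ x, q x ∈ R) ∧ (∀ x, IsStarProjection (q x)) ∧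
      0 ≤ u ∧ 0 ≤ v ∧ u + v ≤ 2 * κ ∧ ∑ x, reState Ω (q x * X x) = 1 - u ∧
      ∑ x, reState Ω (q x) = 1 - u + v ∧
      ∑ x, ∑ y ∈ Finset.univ.erase x, reState Ω (q x * q y) ≤ 2 * v := by
  have hle (x : ι) : X x ≤ 1 := by
    rw [← hX1]
    exact Finset.single_le_sum (fun y _ => hX0 y) (Finset.mem_univ x)
  have hXs (x : ι) : IsSelfAdjoint (X x) := .of_nonneg (hX0 x)
  choose q hqR hqp hqc hq0 hq1 using fun x => h.exists_spectral_projection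
    (sub_mem (add_mem (hX x) (hX x)) (one_mem R)) (((hXs x).add (hXs x)).sub (.one _))
  have hc (x : ι) : Commute (q x) (X x) := by
    have h2 : Commute (q x) (X x + X x) := by
      simpa using (hqc x).add_right (Commute.one_right (q x))
    have h3 : (2 : ℂ) • (q x * X x) = (2 : ℂ) • (X x * q x) := by
      have := h2.eq
      rwa [mul_add, add_mul, ← two_smul ℂ, ← two_smul ℂ] at this
    exact smul_right_injective _ two_ne_zero h3
  have hu (x : ι) : 0 ≤ reState Ω ((1 - q x) * X x) :=
    h.reState_mul_nonneg (hqp x).one_sub (sub_mem (one_mem R) (hqR x)) (hX x) (hX0 x)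
  have hv (x : ι) : 0 ≤ reState Ω (q x * (1 - X x)) :=
    h.reState_mul_nonneg (hqp x) (hqR x) (sub_mem (one_mem R) (hX x)) (sub_nonneg.2 (hle x))
  have hone : ∑ x, reState Ω (X x) = 1 := by rw [← map_sum, hX1, reState_one hΩ]
  have hqX : ∑ x, reState Ω (q x * X x) = 1 - ∑ x, reState Ω ((1 - q x) * X x) := by
    rw [← hone, ← Finset.sum_sub_distrib]
    refine Finset.sum_congr rfl fun x _ => ?_
    rw [← map_sub, sub_mul, one_mul, sub_sub_cancel]
  have huv (x : ι) : reState Ω ((1 - q x) * X x) + reState Ω (q x * (1 - X x)) ≤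
      2 * (reState Ω (X x) - ‖X x Ω‖ ^ 2) := by
    have h1 : 0 ≤ (1 - X x) * (q x * (X x + X x - 1)) :=
      Commute.mul_nonneg (sub_nonneg.2 (hle x)) (hq0 x)
        (((Commute.one_left _).sub_left ((hc x).symm.mul_right
          (((Commute.refl _).add_right (.refl _)).sub_right (.one_right _)))))
    have h2 : 0 ≤ X x * -((1 - q x) * (X x + X x - 1)) :=
      Commute.mul_nonneg (hX0 x) (neg_nonneg.2 (hq1 x)) (Commute.neg_right
        (((Commute.one_right _).sub_right (hc x).symm).mul_right
          (((Commute.refl _).add_right (.refl _)).sub_right (.one_right _))))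
    have h3 : (1 - X x) * (q x * (X x + X x - 1)) + X x * -((1 - q x) * (X x + X x - 1)) =
        (X x - star (X x) * X x) + (X x - star (X x) * X x) -
          ((1 - q x) * X x + q x * (1 - X x)) := by
      rw [(hXs x).star_eq]
      have e1 : X x * q x = q x * X x := (hc x).eq.symm
      have e2 : X x * (q x * X x) = q x * (X x * X x) := by rw [← mul_assoc, e1, mul_assoc]
      simp only [mul_sub, sub_mul, mul_add, mul_one, one_mul, mul_neg, e1, e2]
      abel
    have h4 := reState_nonneg Ω (add_nonneg h1 h2)
    rw [h3, map_sub, map_add, map_add, map_sub, reState_star_mul_self] at h4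
    linarith
  have hq2 (x : ι) : 0 ≤ X x + X x - q x := by
    have h1 : 0 ≤ (1 - q x) * X x := Commute.mul_nonneg (hqp x).one_sub.nonneg (hX0 x)
      ((Commute.one_left _).sub_left (hc x))
    have h2 : X x + X x - q x = q x * (X x + X x - 1) + ((1 - q x) * X x + (1 - q x) * X x) := by
      noncomm_ring
    rw [h2]
    exact add_nonneg (hq0 x) (add_nonneg h1 h1)
  refine ⟨q, ∑ x, reState Ω ((1 - q x) * X x), ∑ x, reState Ω (q x * (1 - X x)), hqR, hqp,
    Finset.sum_nonneg fun x _ => hu x, Finset.sum_nonneg fun x _ => hv x, ?_, hqX, ?_, ?_⟩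
  · rw [← Finset.sum_add_distrib]
    refine (Finset.sum_le_sum fun x _ => huv x).trans ?_
    rw [← Finset.mul_sum, Finset.sum_sub_distrib, hone]
    linarith
  · rw [← hqX, ← Finset.sum_add_distrib]
    refine Finset.sum_congr rfl fun x _ => ?_
    rw [← map_add, mul_sub, mul_one, add_sub_cancel]
  · rw [Finset.mul_sum]
    refine Finset.sum_le_sum fun x _ => ?_
    have h1 : 1 - X x = ∑ y ∈ Finset.univ.erase x, X y := by
      rw [← hX1, ← Finset.add_sum_erase _ _ (Finset.mem_univ x), add_sub_cancel_left]
    rw [h1, Finset.mul_sum, map_sum, Finset.mul_sum]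
    refine Finset.sum_le_sum fun y _ => ?_
    have := h.reState_mul_nonneg (hqp x) (hqR x)
      (sub_mem (add_mem (hX y) (hX y)) (hqR y)) (hq2 y)
    rw [mul_sub, mul_add, map_sub, map_add] at this
    linarith
end IsTracialVector

theorem norm_le_norm_add_apply {E : Type*} [NormedAddCommGroup E] [InnerProductSpace ℂ E]
    {T : E →L[ℂ] E} (hT : 0 ≤ T) (y : E) : ‖y‖ ≤ ‖y + T y‖ := by
  have h1 := reState_nonneg y hT
  rw [reState_apply] at h1
  have h2 : ‖y + T y‖ ^ 2 = ‖y‖ ^ 2 + 2 * (⟪y, T y⟫_ℂ).re + ‖T y‖ ^ 2 :=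
    norm_add_sq (𝕜 := ℂ) y (T y)
  refine (sq_le_sq₀ (norm_nonneg _) (norm_nonneg _)).1 ?_
  nlinarith [sq_nonneg ‖T y‖]

namespace IsTracialVector
variable {R S : StarSubalgebra ℂ (K →L[ℂ] K)} {Ω : K}

theorem reState_mul_mono (h : IsTracialVector R S Ω) {e x y : K →L[ℂ] K}
    (he : IsStarProjection e) (heR : e ∈ R) (hx : x ∈ R) (hy : y ∈ R) (hxy : x ≤ y) :
    reState Ω (e * x) ≤ reState Ω (e * y) := by
  have := h.reState_mul_nonneg he heR (sub_mem hy hx) (sub_nonneg.2 hxy)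
  rw [mul_sub, map_sub] at this
  linarith

/-- Almost orthogonal projections can be replaced by nearby ones with linearly independent
ranges, together with the complementary projection. -/
theorem exists_isometry (h : IsTracialVector R S Ω) (hΩ : ‖Ω‖ = 1)
    {ι : Type*} [Fintype ι] {X : ι → K →L[ℂ] K} (hX : ∀ x, X x ∈ R)
    (hX0 : ∀ x, 0 ≤ X x) (hX1 : ∑ x, X x = 1) {κ : ℝ} (hκ : 1 - κ ≤ ∑ x, ‖X x Ω‖ ^ 2) :
    ∃ w q : Option ι → K →L[ℂ] K, (∀ x, w x ∈ R) ∧ (∀ x, q x ∈ R) ∧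
      ∑ x, star (w x) * w x = 1 ∧ (∀ x, q x * w x = w x) ∧
      (∀ x, w x * star (w x) = q x) ∧ (∀ x y, x ≠ y → w x * star (w y) = 0) ∧
      ∑ x, ‖(w x - q x) Ω‖ ^ 2 ≤ 4 * κ ∧ 1 - 4 * κ ≤ ∑ x, reState Ω (q (some x) * X x) ∧ 0 ≤ κ := by
  classical
  obtain ⟨q, u, v, hqR, hqp, hu, hv, huv, hqX, hqs, hqo⟩ :=
    h.exists_almost_orthogonal_projections hΩ hX hX0 hX1 hκ
  obtain ⟨q', T, i⟩ := h.exists_isIndependentRefinement hqR hqp Finset.univ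
  have hpT := i.proj_sup.isIdempotentElem.eq
  have hsT := i.proj_sup.isSelfAdjoint.star_eq
  have hsub (x : ι) : IsStarProjection (q x - q' x) := by
    have e1 : q x * q' x = q' x := i.le x (Finset.mem_univ x)
    have e2 : q' x * q x = q' x := by
      simpa [(hqp x).isSelfAdjoint.star_eq, (i.proj x).isSelfAdjoint.star_eq] using congrArg star e1
    refine ⟨?_, (hqp x).isSelfAdjoint.sub (i.proj x).isSelfAdjoint⟩
    rw [IsIdempotentElem, mul_sub, sub_mul, sub_mul, e1, e2, (hqp x).isIdempotentElem.eq,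
      (i.proj x).isIdempotentElem.eq, sub_self, sub_zero]
  have hle (x : ι) : q' x ≤ q x := sub_nonneg.1 (hsub x).nonneg
  have hTq' (x : ι) : T * q' x = q' x := by
    rw [← i.le x (Finset.mem_univ x), ← mul_assoc, i.sup_mul x (Finset.mem_univ x)]
  have hTz : T * (1 - T) = 0 := by rw [mul_sub, mul_one, hpT, sub_self]
  let p (o : Option ι) : K →L[ℂ] K := o.elim (1 - T) q'
  have hpR (o : Option ι) : p o ∈ R := by
    cases o with
    | none => exact sub_mem (one_mem R) i.mem_sup
    | some x => exact i.mem x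
  obtain ⟨C, w, hC0, hCC, hwR, hwC, hww, hpw, hwp, hwo⟩ := h.exists_orthogonalization hpR
    (fun o => by
      cases o with
      | none => exact i.proj_sup.one_sub
      | some x => exact i.proj x)
    (fun η hη => by
      rw [Fintype.sum_option] at hη
      change (1 - T) (η none) + ∑ x, q' x (η (some x)) = 0 at hη
      have h1 : ∑ x, q' x (η (some x)) = 0 := by
        have := congrArg T hη
        rw [map_add, map_zero, map_sum, ← mul_apply_eq_comp, hTz, zero_apply, zero_add] at this
        rw [← this]
        exact Finset.sum_congr rfl fun x _ => by rw [← mul_apply_eq_comp, hTq']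
      rw [h1, add_zero] at hη
      intro o
      cases o with
      | none => exact hη
      | some x => exact i.independent (fun x => η (some x)) h1 x (Finset.mem_univ x))
    (fun η hη => by
      have h1 : T η = 0 := i.sup_apply η fun x _ => hη (some x)
      have h2 : (1 - T) η = 0 := hη none
      rwa [sub_apply, h1, one_apply_eq_self, sub_zero] at h2)
  have hS' : reState Ω ((∑ x, q' x) * ∑ x, q' x) ≤ ∑ x, reState Ω (q' x) + 2 * v := by
    rw [Finset.sum_mul, map_sum]
    refine le_trans ?_ (add_le_add_right hqo _)
    rw [← Finset.sum_add_distrib]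
    refine Finset.sum_le_sum fun x _ => ?_
    rw [Finset.mul_sum, map_sum, ← Finset.add_sum_erase _ _ (Finset.mem_univ x),
      (i.proj x).isIdempotentElem.eq]
    refine add_le_add_right (Finset.sum_le_sum fun y _ => ?_) _
    refine (h.reState_mul_mono (i.proj x) (i.mem x) (i.mem y) (hqR y) (hle y)).trans ?_
    rw [h.reState_mul_comm (i.mem x) (hqR y), h.reState_mul_comm (hqR x) (hqR y)]
    exact h.reState_mul_mono (hqp y) (hqR y) (i.mem x) (hqR x) (hle x)
  have hsq (F : ι → K →L[ℂ] K) (hFs : ∀ x, IsStarProjection (F x)) (hF : ∀ x, T * F x = F x) :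
      ‖(T - ∑ x, F x) Ω‖ ^ 2 = reState Ω T - 2 * ∑ x, reState Ω (F x) +
        reState Ω ((∑ x, F x) * ∑ x, F x) := by
    have e0 : star (∑ x, F x) = ∑ x, F x := by
      rw [star_sum]; exact Finset.sum_congr rfl fun x _ => (hFs x).isSelfAdjoint.star_eq
    have e1 : T * ∑ x, F x = ∑ x, F x := by
      rw [Finset.mul_sum]; exact Finset.sum_congr rfl fun x _ => hF x
    have e2 : (∑ x, F x) * T = ∑ x, F x := by
      simpa [e0, hsT] using congrArg star e1
    rw [← reState_star_mul_self, star_sub, e0, hsT, mul_sub, sub_mul, sub_mul, hpT, e1, e2,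
      map_sub, map_sub, map_sub, map_sum]
    ring
  have hTlow : 1 - u - v ≤ reState Ω T := by
    have h1 := hsq q hqp fun x => i.sup_mul x (Finset.mem_univ x)
    have h2 : reState Ω ((∑ x, q x) * ∑ x, q x) ≤ ∑ x, reState Ω (q x) + 2 * v := by
      rw [Finset.sum_mul, map_sum]
      refine le_trans (le_of_eq ?_) (add_le_add_right hqo _)
      rw [← Finset.sum_add_distrib]
      refine Finset.sum_congr rfl fun x _ => ?_
      rw [Finset.mul_sum, map_sum, ← Finset.add_sum_erase _ _ (Finset.mem_univ x),
        (hqp x).isIdempotentElem.eq]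
    have := sq_nonneg ‖(T - ∑ x, q x) Ω‖
    linarith
  have hC1 : ‖(1 - C) Ω‖ ^ 2 ≤ 2 * v := by
    have h1 : ‖(1 - C) Ω‖ ≤ ‖(T - ∑ x, q' x) Ω‖ := by
      refine (norm_le_norm_add_apply hC0 _).trans (le_of_eq ?_)
      congr 1
      have : C * C = 1 - T + ∑ x, q' x := by rw [hCC, Fintype.sum_option]; rfl
      have := DFunLike.congr_fun this Ω
      simp only [mul_apply_eq_comp, add_apply, sub_apply, one_apply_eq_self, map_sub] at this ⊢
      rw [this]
      abel
    have h2 := hsq q' i.proj hTq'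
    have h3 := i.state_sup
    have := pow_le_pow_left₀ (norm_nonneg _) h1 2
    linarith
  refine ⟨w, p, hwR, hpR, hww, hpw, hwp, hwo, ?_, ?_, by linarith⟩
  · have h1 : ∑ o, ‖(w o - p o) Ω‖ ^ 2 = ‖(1 - C) Ω‖ ^ 2 := by
      simp_rw [← reState_star_mul_self]
      rw [← map_sum]
      have : ∀ o, w o - p o = w o * (1 - C) := fun o => by rw [mul_sub, mul_one, hwC]
      simp only [this, star_mul]
      calc reState Ω (∑ o, star (1 - C) * star (w o) * (w o * (1 - C)))
          = reState Ω (star (1 - C) * (∑ o, star (w o) * w o) * (1 - C)) := by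
            rw [Finset.mul_sum, Finset.sum_mul]
            simp only [mul_assoc]
        _ = _ := by rw [hww, mul_one]
    linarith
  · have h1 : ∑ x, reState Ω (q x * X x) - ∑ x, reState Ω (q' x * X x) ≤
        ∑ x, reState Ω (q x) - ∑ x, reState Ω (q' x) := by
      rw [← Finset.sum_sub_distrib, ← Finset.sum_sub_distrib]
      refine Finset.sum_le_sum fun x _ => ?_
      have hX1' : X x ≤ 1 := by
        rw [← hX1]; exact Finset.single_le_sum (fun y _ => hX0 y) (Finset.mem_univ x)
      have := h.reState_mul_mono (hsub x) (sub_mem (hqR x) (i.mem x)) (hX x) (one_mem R) hX1'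
      rw [mul_one, sub_mul, map_sub, map_sub] at this
      exact this
    have h2 := i.state_sup
    change _ ≤ ∑ x, reState Ω (q' x * X x)
    linarith

theorem exists_near_pvm (h : IsTracialVector R S Ω) (hΩ : ‖Ω‖ = 1)
    {ι : Type*} [Fintype ι] [Nonempty ι] {X : ι → K →L[ℂ] K} (hX : ∀ x, X x ∈ R)
    (hX0 : ∀ x, 0 ≤ X x) (hX1 : ∑ x, X x = 1) {κ : ℝ} (hκ : 1 - κ ≤ ∑ x, ‖X x Ω‖ ^ 2) :
    ∃ r : ι → K →L[ℂ] K, (∀ x, r x ∈ R) ∧ (∀ x, IsStarProjection (r x)) ∧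
      (∀ x y, x ≠ y → r x * r y = 0) ∧ ∑ x, r x = 1 ∧
      1 - 7 * √κ ≤ ∑ x, reState Ω (r x * X x) := by
  classical
  obtain ⟨w, q, hwR, hqR, hww, hqw, hwq, hwo, hwd, hqX, hκ0⟩ := h.exists_isometry hΩ hX hX0 hX1 hκ
  let g (o : Option ι) : K →L[ℂ] K := star (w o) * w o
  have hgR (o : Option ι) : g o ∈ R := mul_mem (star_mem (hwR o)) (hwR o)
  have hgs (o : Option ι) : IsSelfAdjoint (g o) := .star_mul_self _
  have hgo (o o' : Option ι) (hne : o ≠ o') : g o * g o' = 0 := by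
    change star (w o) * w o * (star (w o') * w o') = 0
    rw [mul_assoc, ← mul_assoc (w o), hwo o o' hne, zero_mul, mul_zero]
  have hgp (o : Option ι) : g o * g o = g o := by
    change star (w o) * w o * (star (w o) * w o) = _
    rw [mul_assoc, ← mul_assoc (w o), hwq, hqw]
  obtain ⟨a⟩ := ‹Nonempty ι›
  let r (x : ι) : K →L[ℂ] K := g (some x) + if x = a then g none else 0
  have hpn (x : ι) : 0 ≤ reState Ω (g (some x) * X x) :=
    h.reState_mul_nonneg ⟨hgp _, hgs _⟩ (hgR _) (hX x) (hX0 x)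
  have hrX (x : ι) : reState Ω (g (some x) * X x) ≤ reState Ω (r x * X x) := by
    change _ ≤ reState Ω ((g (some x) + if x = a then g none else 0) * X x)
    rw [add_mul, map_add]
    split_ifs
    · have := h.reState_mul_nonneg ⟨hgp none, hgs none⟩ (hgR _) (hX x) (hX0 x)
      linarith
    · rw [zero_mul, map_zero, add_zero]
  have hXsum : ∑ x, reState Ω (X x) = 1 := by rw [← map_sum, hX1, reState_one hΩ]
  refine ⟨r, fun x => ?_, fun x => ⟨?_, ?_⟩, fun x y hxy => ?_, ?_, ?_⟩
  · refine add_mem (hgR _) ?_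
    split_ifs
    · exact hgR _
    · exact zero_mem R
  · change (g (some x) + if x = a then g none else 0) *
      (g (some x) + if x = a then g none else 0) = (g (some x) + if x = a then g none else 0)
    split_ifs
    · rw [mul_add, add_mul, add_mul, hgp, hgp, hgo _ _ (by simp), hgo _ _ (by simp), add_zero,
        zero_add]
    · rw [add_zero, hgp]
  · refine (hgs _).add ?_
    split_ifs
    · exact hgs _
    · exact .zero _
  · change (g (some x) + if x = a then g none else 0) *
      (g (some y) + if y = a then g none else 0) = 0
    rw [mul_add, add_mul, add_mul, hgo _ _ (by simpa using hxy)]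
    split_ifs with h1 h2 h2
    · exact absurd (h2.trans h1.symm) (Ne.symm hxy)
    all_goals simp [hgo]
  · change ∑ x, (g (some x) + if x = a then g none else 0) = 1
    rw [Finset.sum_add_distrib, Finset.sum_ite_eq', if_pos (Finset.mem_univ a), add_comm,
      ← Fintype.sum_option g, hww]
  · refine le_trans ?_ (Finset.sum_le_sum fun x _ => hrX x)
    have hm : 1 - 4 * κ - 2 * √κ ≤ ∑ x, reState Ω (w (some x) * X x) := by
      have h1 (x : ι) : reState Ω (q (some x) * X x) - reState Ω (w (some x) * X x) ≤
          ‖X x Ω‖ * ‖(w (some x) - q (some x)) Ω‖ := by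
        have e : reState Ω (w (some x) * X x) - reState Ω (q (some x) * X x) =
            (⟪X x Ω, (w (some x) - q (some x)) Ω⟫_ℂ).re := by
          rw [← map_sub, ← sub_mul, h.reState_mul_comm (sub_mem (hwR _) (hqR _)) (hX x),
            ← (IsSelfAdjoint.of_nonneg (hX0 x)).star_eq, reState_star_mul]
          rw [(IsSelfAdjoint.of_nonneg (hX0 x)).star_eq]
        have h2 := (abs_le.1 ((Complex.abs_re_le_norm _).trans (norm_inner_le_norm (𝕜 := ℂ)
          (X x Ω) ((w (some x) - q (some x)) Ω)))).1
        linarith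
      have h2 := Finset.sum_le_sum fun x (_ : x ∈ Finset.univ) => h1 x
      rw [Finset.sum_sub_distrib] at h2
      have h3 := Real.sum_mul_le_sqrt_mul_sqrt Finset.univ (fun x => ‖X x Ω‖)
        (fun x => ‖(w (some x) - q (some x)) Ω‖)
      have h4 : √(∑ x, ‖X x Ω‖ ^ 2) ≤ 1 := by
        rw [Real.sqrt_le_one, ← hXsum]
        refine Finset.sum_le_sum fun x _ => ?_
        have hX1' : X x ≤ 1 := by
          rw [← hX1]; exact Finset.single_le_sum (fun y _ => hX0 y) (Finset.mem_univ x)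
        have := reState_nonneg Ω (Commute.mul_nonneg (hX0 x) (sub_nonneg.2 hX1')
          ((Commute.one_right _).sub_right (.refl _)))
        rw [mul_sub, mul_one, map_sub] at this
        nth_rw 2 [← (IsSelfAdjoint.of_nonneg (hX0 x)).star_eq] at this
        rw [reState_star_mul_self] at this
        linarith
      have h5 : √(∑ x, ‖(w (some x) - q (some x)) Ω‖ ^ 2) ≤ 2 * √κ := by
        rw [show (2 : ℝ) * √κ = √(4 * κ) by
          rw [Real.sqrt_mul (by norm_num), show (4 : ℝ) = 2 ^ 2 by norm_num,
            Real.sqrt_sq (by norm_num)]]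
        refine Real.sqrt_le_sqrt (le_trans ?_ hwd)
        rw [Fintype.sum_option]
        exact le_add_of_nonneg_left (sq_nonneg _)
      have h6 := mul_le_mul h4 h5 (Real.sqrt_nonneg _) zero_le_one
      linarith
    have hg : 2 * ∑ x, reState Ω (w (some x) * X x) - 1 ≤ ∑ x, reState Ω (g (some x) * X x) := by
      rw [← hXsum, Finset.mul_sum, ← Finset.sum_sub_distrib]
      refine Finset.sum_le_sum fun x _ => ?_
      have h1 := h.reState_star_mul_mul_nonneg (sub_mem (hwR (some x)) (one_mem R)) (hX x) (hX0 x)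
      have h2 : reState Ω (star (w (some x)) * X x) = reState Ω (w (some x) * X x) := by
        rw [← reState_star, star_mul, star_star, (IsSelfAdjoint.of_nonneg (hX0 x)).star_eq,
          h.reState_mul_comm (hX x) (hwR _)]
      have h3 : star (w (some x) - 1) * (w (some x) - 1) * X x =
          g (some x) * X x - star (w (some x)) * X x - w (some x) * X x + X x := by
        change _ = star (w (some x)) * w (some x) * X x - _ - _ + _
        rw [star_sub, star_one]
        noncomm_ring
      rw [h3, map_add, map_sub, map_sub, h2] at h1
      linarith
    have hs := Real.sq_sqrt hκ0
    have hs0 := Real.sqrt_nonneg κ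
    rcases le_total √κ (3 / 8) with hle | hle
    · nlinarith
    · have := Finset.sum_nonneg fun x (_ : x ∈ Finset.univ) => hpn x
      linarith
end IsTracialVector

end

/-- Compression of operators to the cyclic subspace of a star subalgebra. -/
theorem exists_compression.{u} {H : Type u} [NormedAddCommGroup H] [InnerProductSpace ℂ H]
    [CompleteSpace H] (T : StarSubalgebra ℂ (H →L[ℂ] H)) (ψ : H) :
    ∃ (E : Type u) (_ : NormedAddCommGroup E) (_ : InnerProductSpace ℂ E) (_ : CompleteSpace E)
      (c : (H →L[ℂ] H) →ₗ[ℂ] (E →L[ℂ] E)) (π : H →L[ℂ] E), (∀ x, 0 ≤ x → 0 ≤ c x) ∧ c 1 = 1 ∧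
      (∀ x, c (star x) = star (c x)) ∧ (∀ t ∈ T, ∀ x, c (x * t) = c x * c t) ∧
      (∀ t ∈ T, ∀ x, c (t * x) = c t * c x) ∧ (∀ x, c x (π ψ) = π (x ψ)) ∧
      (∀ x, ⟪π ψ, c x (π ψ)⟫_ℂ = ⟪ψ, x ψ⟫_ℂ) ∧ (DenseRange fun t : T => π ((t : H →L[ℂ] H) ψ)) ∧
      Function.Surjective π := by
  obtain ⟨W, hW⟩ : ∃ W : Submodule ℂ H, W = (T.toSubalgebra.toSubmodule.map
    (ContinuousLinearMap.apply ℂ H ψ).toLinearMap).topologicalClosure := ⟨_, rfl⟩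
  have : CompleteSpace W := by
    rw [hW]; exact (Submodule.isClosed_topologicalClosure _).completeSpace_coe
  have hcl {v : H} : v ∈ W ↔ v ∈ closure {v | ∃ t ∈ T, t ψ = v} := by rw [hW]; rfl
  let V : W →L[ℂ] H := W.subtypeL
  let π : H →L[ℂ] W := W.orthogonalProjectionOnto
  have hVπ : ContinuousLinearMap.adjoint V = π := Submodule.adjoint_subtypeL W
  have hπV : ContinuousLinearMap.adjoint π = V := Submodule.adjoint_orthogonalProjectionOnto W
  have hπ (w : W) : π (V w) = w := W.orthogonalProjectionOnto_mem_subspace_eq_self w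
  have hin {v : H} (hv : v ∈ W) : V (π v) = v :=
    congrArg Subtype.val (W.orthogonalProjectionOnto_mem_subspace_eq_self ⟨v, hv⟩)
  have hmem {t : H →L[ℂ] H} (ht : t ∈ T) : t ψ ∈ W :=
    hcl.2 (subset_closure ⟨t, ht, rfl⟩)
  have hψ : V (π ψ) = ψ := hin (hmem (one_mem T))
  have hinv {t : H →L[ℂ] H} (ht : t ∈ T) (w : W) : V (π (t (V w))) = t (V w) := by
    refine hin (hcl.2 (map_mem_closure t.continuous (hcl.1 w.2) ?_))
    rintro _ ⟨s, hs, rfl⟩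
    exact ⟨t * s, mul_mem (S := StarSubalgebra ℂ (H →L[ℂ] H)) ht hs, rfl⟩
  let c : (H →L[ℂ] H) →ₗ[ℂ] (W →L[ℂ] W) :=
    { toFun := fun x => π ∘L x ∘L V
      map_add' := fun x y => by ext; simp
      map_smul' := fun t x => by ext; simp }
  have hstar (x : H →L[ℂ] H) : c (star x) = star (c x) := by
    change π ∘L ContinuousLinearMap.adjoint x ∘L V = ContinuousLinearMap.adjoint (π ∘L x ∘L V)
    rw [ContinuousLinearMap.adjoint_comp, ContinuousLinearMap.adjoint_comp, hVπ, hπV]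
    rfl
  have hr (t : H →L[ℂ] H) (ht : t ∈ T) (x : H →L[ℂ] H) : c (x * t) = c x * c t := by
    ext w
    change (π (x (t (V w))) : H) = π (x (V (π (t (V w)))))
    rw [hinv ht]
  refine ⟨W, inferInstance, inferInstance, inferInstance, c, π, fun x hx => ?_, ?_, hstar, hr,
    fun t ht x => ?_, fun x => ?_, fun x => ?_, fun w => ?_, fun w => ⟨V w, hπ w⟩⟩
  · rw [ContinuousLinearMap.nonneg_iff_isPositive] at hx ⊢
    have := hx.conj_adjoint π
    rwa [hπV] at this
  · exact ContinuousLinearMap.ext hπ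
  · rw [← star_star (c (t * x)), ← hstar, star_mul, hr _ (star_mem ht)]
    refine (star_mul _ _).trans ?_
    rw [← hstar, ← hstar, star_star, star_star]
  · change π (x (V (π ψ))) = _
    rw [hψ]
  · change ⟪π ψ, π (x (V (π ψ)))⟫_ℂ = _
    rw [hψ, ← ContinuousLinearMap.adjoint_inner_left, hπV, hψ]
  · have h1 : V w ∈ closure (Set.range fun t : T => (t : H →L[ℂ] H) ψ) := by
      refine closure_mono ?_ (hcl.1 w.2)
      rintro _ ⟨s, hs, rfl⟩
      exact ⟨⟨s, hs⟩, rfl⟩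
    have h2 := map_mem_closure π.continuous h1 (t := Set.range fun t : T => π ((t : H →L[ℂ] H) ψ))
      (by rintro _ ⟨s, rfl⟩; exact ⟨s, rfl⟩)
    rwa [hπ] at h2

/-- Commuting families of operators can be compressed to a space on which the state vector is
cyclic for a von Neumann algebra and its commutant, without changing the correlation. -/
theorem exists_isCyclicPair.{u} {H : Type u} [NormedAddCommGroup H] [InnerProductSpace ℂ H]
    [CompleteSpace H] {α β : Type*} {P : α → H →L[ℂ] H} {Q : β → H →L[ℂ] H}
    (hP : ∀ a, 0 ≤ P a) (hPQ : ∀ a b, Commute (P a) (Q b)) {ψ : H}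
    (hψ : ‖ψ‖ = 1) :
    ∃ (E : Type u) (_ : NormedAddCommGroup E) (_ : InnerProductSpace ℂ E) (_ : CompleteSpace E)
      (N M : StarSubalgebra ℂ (E →L[ℂ] E)) (φ : E) (c : (H →L[ℂ] H) →ₗ[ℂ] (E →L[ℂ] E)),
      IsCyclicPair N M φ ∧ ‖φ‖ = 1 ∧ c 1 = 1 ∧ (∀ x, 0 ≤ x → 0 ≤ c x) ∧ (∀ a, c (P a) ∈ N) ∧
      (∀ b, c (Q b) ∈ M) ∧ ∀ a b, ⟪φ, (c (P a) * c (Q b)) φ⟫_ℂ = ⟪ψ, (P a * Q b) ψ⟫_ℂ := by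
  let T : StarSubalgebra ℂ (H →L[ℂ] H) := StarAlgebra.adjoin ℂ (Set.range P)
  have hPT (a : α) : P a ∈ T := StarAlgebra.subset_adjoin ℂ _ ⟨a, rfl⟩
  obtain ⟨E₁, _, _, _, c₁, π₁, hpos₁, hone₁, hstar₁, hr₁, hl₁, hv₁, hi₁, hd₁, hs₁⟩ :=
    exists_compression T ψ
  let T' : StarSubalgebra ℂ (E₁ →L[ℂ] E₁) :=
    StarSubalgebra.centralizer ℂ (Set.range fun a => c₁ (P a))
  have hT' (y : E₁ →L[ℂ] E₁) : y ∈ T' ↔ ∀ a, Commute (c₁ (P a)) y := by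
    rw [StarSubalgebra.mem_centralizer_iff]
    refine ⟨fun h a => (h _ ⟨a, rfl⟩).1, ?_⟩
    rintro h _ ⟨a, rfl⟩
    refine ⟨h a, ?_⟩
    rw [(IsSelfAdjoint.of_nonneg (hpos₁ _ (hP a))).star_eq]
    exact h a
  have hQT' (b : β) : c₁ (Q b) ∈ T' := (hT' _).2 fun a => by
    rw [Commute, SemiconjBy, ← hl₁ _ (hPT a), ← hr₁ _ (hPT a), (hPQ a b).eq]
  have hcT (t : H →L[ℂ] H) (ht : t ∈ T) : ∀ y ∈ T', Commute (c₁ t) y := by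
    induction ht using StarAlgebra.adjoin_induction with
    | mem x hx =>
      obtain ⟨a, rfl⟩ := hx
      exact fun y hy => (hT' y).1 hy a
    | algebraMap r =>
      intro y _
      rw [Algebra.algebraMap_eq_smul_one, map_smul, hone₁]
      exact (Commute.one_left y).smul_left r
    | add x z _ _ hx hz => exact fun y hy => by rw [map_add]; exact (hx y hy).add_left (hz y hy)
    | mul x z hxT _ hx hz =>
      exact fun y hy => by rw [hl₁ x hxT]; exact (hx y hy).mul_left (hz y hy)
    | star x _ hx =>
      intro y hy
      rw [hstar₁]
      have := (hx (star y) (star_mem hy)).star_star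
      rwa [star_star] at this
  obtain ⟨E₂, _, _, _, c₂, π₂, hpos₂, hone₂, hstar₂, hr₂, hl₂, hv₂, hi₂, hd₂, hs₂⟩ :=
    exists_compression T' (π₁ ψ)
  let N : StarSubalgebra ℂ (E₂ →L[ℂ] E₂) := StarSubalgebra.centralizer ℂ (c₂ '' T')
  have hN {x : E₁ →L[ℂ] E₁} (hx : ∀ y ∈ T', Commute x y) : c₂ x ∈ N := by
    rw [StarSubalgebra.mem_centralizer_iff]
    have key (y : E₁ →L[ℂ] E₁) (hy : y ∈ T') : c₂ y * c₂ x = c₂ x * c₂ y := by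
      rw [← hl₂ y hy, ← hr₂ y hy, (hx y hy).eq]
    rintro _ ⟨y, hy, rfl⟩
    refine ⟨key y hy, ?_⟩
    rw [← hstar₂]
    exact key _ (star_mem hy)
  let M : StarSubalgebra ℂ (E₂ →L[ℂ] E₂) := StarSubalgebra.centralizer ℂ (N : Set (E₂ →L[ℂ] E₂))
  have hM (x : E₂ →L[ℂ] E₂) : x ∈ M ↔ ∀ y ∈ N, Commute x y := by
    rw [StarSubalgebra.mem_centralizer_iff]
    exact ⟨fun h y hy => (h y hy).1.symm, fun h y hy => ⟨(h y hy).symm.eq,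
      (h _ (star_mem hy)).symm.eq⟩⟩
  have hcM {y : E₁ →L[ℂ] E₁} (hy : y ∈ T') : c₂ y ∈ M := (hM _).2 fun z hz =>
    ((StarSubalgebra.mem_centralizer_iff ℂ).1 hz _ ⟨y, hy, rfl⟩).1
  have hinner (x : H →L[ℂ] H) : ⟪π₂ (π₁ ψ), c₂ (c₁ x) (π₂ (π₁ ψ))⟫_ℂ = ⟪ψ, x ψ⟫_ℂ := by
    rw [hi₂, hi₁]
  refine ⟨E₂, _, _, ‹_›, N, M, π₂ (π₁ ψ), c₂ ∘ₗ c₁, ⟨hM, ?_, ?_⟩, ?_, ?_,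
    fun x hx => hpos₂ _ (hpos₁ _ hx), fun a => hN (hcT _ (hPT a)), fun b => hcM (hQT' b),
    fun a b => ?_⟩
  · have h1 : DenseRange fun t : T => π₂ (π₁ ((t : H →L[ℂ] H) ψ)) :=
      hs₂.denseRange.comp hd₁ π₂.continuous
    refine h1.mono ?_
    rintro _ ⟨t, rfl⟩
    refine ⟨⟨c₂ (c₁ t), hN (hcT _ t.2)⟩, ?_⟩
    change c₂ (c₁ t) (π₂ (π₁ ψ)) = _
    rw [hv₂, hv₁]
  · refine hd₂.mono ?_
    rintro _ ⟨t, rfl⟩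
    exact ⟨⟨c₂ t, hcM t.2⟩, hv₂ _⟩
  · have := congrArg Complex.re (hinner 1)
    rw [hone₁, hone₂, one_apply_eq_self, one_apply_eq_self, re_inner_self_complex,
      re_inner_self_complex, hψ, one_pow] at this
    exact (pow_eq_one_iff_of_nonneg (norm_nonneg _) two_ne_zero).1 this
  · change c₂ (c₁ 1) = 1
    rw [hone₁, hone₂]
  · change ⟪_, (c₂ (c₁ (P a)) * c₂ (c₁ (Q b))) _⟫_ℂ = _
    rw [← hr₂ _ (hQT' b), ← hl₁ _ (hPT a), hinner]

namespace IsModularFlow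

variable {N M : StarSubalgebra ℂ (H →L[ℂ] H)} {ψ : H} {C : H →L[ℂ] H} {A : H →L⋆[ℂ] H}
  {Φ : C(unitInterval, ℂ) →⋆ₐ[ℂ] (H →L[ℂ] H)} {U : ℝ → H →L[ℂ] H} {J : H →L⋆[ℂ] H}

theorem re_inner_J_le (m : IsModularFlow N M ψ C A Φ U J) (η : H) :
    (⟪η, J η⟫_ℂ).re ≤ ‖η‖ ^ 2 := by
  refine (re_inner_le_norm (𝕜 := ℂ) η (J η)).trans ?_
  rw [m.norm_J, sq]

/-- The pairing of the two algebras is dominated by the self-polarity of each of them. -/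
theorem two_mul_re_inner_le (h : IsCyclicPair N M ψ) (m : IsModularFlow N M ψ C A Φ U J)
    {x y : H →L[ℂ] H} (hx : x ∈ N) (hxs : IsSelfAdjoint x) (hy : y ∈ M) (hys : IsSelfAdjoint y) :
    2 * (⟪x ψ, y ψ⟫_ℂ).re ≤ (⟪x ψ, J (x ψ)⟫_ℂ).re + (⟪y ψ, J (y ψ)⟫_ℂ).re := by
  obtain ⟨ρ, hρ', hρ, -, hρq⟩ := m.exists_common_vector h hx hxs
  have h0 := m.sqrtCoord_J h hy hys
  have s1 : ∀ η, Φ sqrtCoord (Φ sqrtCoord η) + Φ sqrtCoord' (Φ sqrtCoord' η) = η := fun η => by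
    rw [← calculus_mul_apply, ← calculus_mul_apply, ← add_apply, ← map_add, sqrtCoord_mul,
      sqrtCoord'_mul, add_sub_cancel, map_one, one_apply_eq_self]
  have star1 : star sqrtCoord = sqrtCoord := by
    ext c; simp [sqrtCoord_apply]
  have star2 : star sqrtCoord' = sqrtCoord' := by
    ext c; simp [sqrtCoord'_apply]
  set χ := Φ sqrtCoord (y ψ) + Φ sqrtCoord' (J (y ψ)) with hχd
  have hχ : Φ sqrtCoord χ = y ψ := by
    rw [hχd, map_add, commute_calculus Φ sqrtCoord sqrtCoord', h0, s1]
  have hχ' : Φ sqrtCoord' χ = J (y ψ) := by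
    rw [hχd, map_add, commute_calculus Φ sqrtCoord' sqrtCoord, ← h0, s1]
  have hT : ∀ η, Φ (osc 0) η = Φ sqrtCoord' (Φ sqrtCoord η) := fun η => by
    rw [← calculus_mul_apply, mul_comm, sqrtCoord_mul_sqrtCoord']
  have e1 : ⟪ρ, Φ (osc 0) χ⟫_ℂ = ⟪x ψ, y ψ⟫_ℂ := by
    rw [hT, ← star2, ← inner_calculus, hρ', hχ]
  have e2 : ⟪χ, Φ (osc 0) ρ⟫_ℂ = ⟪y ψ, x ψ⟫_ℂ := by
    rw [hT, commute_calculus, ← star1, ← inner_calculus, hρ', hχ]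
  have e3 : ⟪χ, Φ (osc 0) χ⟫_ℂ = ⟪J (y ψ), y ψ⟫_ℂ := by
    rw [hT, ← star2, ← inner_calculus, hχ', hχ]
  have key := re_inner_calculus_nonneg Φ (f := osc 0) (fun c => by
    rw [← sqrtCoord_mul_sqrtCoord', ContinuousMap.mul_apply, sqrtCoord_apply, sqrtCoord'_apply,
      ← Complex.ofReal_mul, Complex.ofReal_re]
    positivity) (ρ - χ)
  rw [map_sub, inner_sub_left, inner_sub_right, inner_sub_right, e1, e2, e3] at key
  simp only [Complex.sub_re] at key
  have c1 : (⟪y ψ, x ψ⟫_ℂ).re = (⟪x ψ, y ψ⟫_ℂ).re := inner_re_symm (𝕜 := ℂ) _ _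
  have c2 : (⟪J (y ψ), y ψ⟫_ℂ).re = (⟪y ψ, J (y ψ)⟫_ℂ).re := inner_re_symm (𝕜 := ℂ) _ _
  linarith

theorem re_inner_J_nonneg (h : IsCyclicPair N M ψ) (m : IsModularFlow N M ψ C A Φ U J)
    {x y : H →L[ℂ] H} (hx : x ∈ N) (hx0 : 0 ≤ x) (hy : y ∈ N) (hy0 : 0 ≤ y) :
    0 ≤ (⟪x ψ, J (y ψ)⟫_ℂ).re := by
  have hc : Commute x (antiConj J y) := by
    ext ζ
    have := m.commute_flow h hy hx 0 ζ
    simpa [m.U_zero] using this.symm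
  have h1 := hc.mul_nonneg hx0 (m.antiConj_nonneg hy0)
  have h2 := ((ContinuousLinearMap.nonneg_iff_isPositive _).1 h1).re_inner_nonneg_right ψ
  rwa [mul_apply_eq_comp, antiConj_apply, m.J_vacuum, ← (IsSelfAdjoint.of_nonneg hx0).star_eq,
    ← inner_apply_left_eq_star] at h2

end IsModularFlow

open Classical in
/-- The coarse-graining of a family along a map of its indices. -/
noncomputable def coarseGrain {α β T : Type*} [Fintype α] [AddCommMonoid T] (p : α → β) (X : α → T)
    (b : β) : T :=
  ∑ a with p a = b, X a

section

variable {α β : Type*} [Fintype α]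

theorem sum_coarseGrain [Fintype β] {T : Type*} [AddCommMonoid T] (p : α → β) (X : α → T) :
    ∑ b, coarseGrain p X b = ∑ a, X a := by
  classical
  unfold coarseGrain
  convert Finset.sum_fiberwise Finset.univ p X

theorem coarseGrain_apply {E : Type*} [NormedAddCommGroup E] [InnerProductSpace ℂ E] (p : α → β)
    (X : α → E →L[ℂ] E) (v : E) (b : β) :
    coarseGrain p X b v = coarseGrain p (fun a => X a v) b := by
  simp [coarseGrain, sum_apply]

theorem map_coarseGrain {E : Type*} [AddCommMonoid E] {T F : Type*} [AddCommMonoid T]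
    [FunLike F E T] [AddMonoidHomClass F E T] (f : F) (p : α → β) (X : α → E) (b : β) :
    f (coarseGrain p X b) = coarseGrain p (fun a => f (X a)) b := by
  simp [coarseGrain, map_sum]

theorem coarseGrain_nonneg {X : α → H →L[ℂ] H} (h : ∀ a, 0 ≤ X a) (p : α → β) (b : β) :
    0 ≤ coarseGrain p X b :=
  Finset.sum_nonneg fun a _ => h a

theorem coarseGrain_mem {R : StarSubalgebra ℂ (H →L[ℂ] H)} {X : α → H →L[ℂ] H}
    (h : ∀ a, X a ∈ R) (p : α → β) (b : β) : coarseGrain p X b ∈ R :=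
  sum_mem fun a _ => h a

theorem coarseGrain_isStarProjection {X : α → H →L[ℂ] H} (h : ∀ a, IsStarProjection (X a))
    (h0 : ∀ a a', a ≠ a' → X a * X a' = 0) (p : α → β) (b : β) :
    IsStarProjection (coarseGrain p X b) := by
  classical
  refine ⟨?_, ?_⟩
  · rw [IsIdempotentElem, coarseGrain, Finset.sum_mul_sum]
    refine Finset.sum_congr rfl fun a ha => ?_
    rw [Finset.sum_eq_single_of_mem a ha fun a' _ h' => h0 a a' h'.symm, (h a).isIdempotentElem]
  · exact isSelfAdjoint_sum _ fun a _ => (h a).isSelfAdjoint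

variable {E : Type*} [NormedAddCommGroup E] [InnerProductSpace ℂ E]

theorem sum_re_inner_coarseGrain_left [Fintype β] (p : α → β) (v : α → E) (w : β → E) :
    ∑ b, (⟪coarseGrain p v b, w b⟫_ℂ).re = ∑ a, (⟪v a, w (p a)⟫_ℂ).re := by
  classical
  rw [← sum_coarseGrain p fun a => (⟪v a, w (p a)⟫_ℂ).re]
  refine Finset.sum_congr rfl fun b _ => ?_
  simp only [coarseGrain, sum_inner, Complex.re_sum]
  refine Finset.sum_congr rfl fun a ha => ?_
  rw [(Finset.mem_filter.1 ha).2]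

open Classical in
theorem sum_re_inner_coarseGrain [Fintype β] (p : α → β) (v w : α → E) :
    ∑ b, (⟪coarseGrain p v b, coarseGrain p w b⟫_ℂ).re =
      ∑ a, ∑ a', if p a' = p a then (⟪v a, w a'⟫_ℂ).re else 0 := by
  rw [sum_re_inner_coarseGrain_left]
  refine Finset.sum_congr rfl fun a _ => ?_
  rw [coarseGrain, inner_sum, Complex.re_sum, Finset.sum_filter]

theorem sum_re_inner_le_coarseGrain [Fintype β] (p : α → β) {v w : α → E}
    (h : ∀ a a', 0 ≤ (⟪v a, w a'⟫_ℂ).re) :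
    ∑ a, (⟪v a, w a⟫_ℂ).re ≤ ∑ b, (⟪coarseGrain p v b, coarseGrain p w b⟫_ℂ).re := by
  classical
  rw [sum_re_inner_coarseGrain]
  refine Finset.sum_le_sum fun a _ => ?_
  refine le_trans ?_ (Finset.single_le_sum (fun a' _ => ?_) (Finset.mem_univ a))
  · rw [if_pos rfl]
  · split_ifs
    exacts [h a a', le_rfl]

/-- If a family of coarse-grainings separates the indices, the off-diagonal mass is controlled by
the off-diagonal masses of the coarse-grainings. -/
theorem offDiagonal_le_sum_coarseGrain {ι : Type*} {β : ι → Type*} [∀ j, Fintype (β j)]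
    (p : ∀ j, α → β j) {v w : α → E} (h : ∀ a a', 0 ≤ (⟪v a, w a'⟫_ℂ).re) (s : Finset ι)
    (hs : ∀ a a', a ≠ a' → ⟪v a, w a'⟫_ℂ = 0 ∨ ∃ j ∈ s, p j a ≠ p j a') :
    (⟪∑ a, v a, ∑ a, w a⟫_ℂ).re - ∑ a, (⟪v a, w a⟫_ℂ).re ≤
      ∑ j ∈ s, ((⟪∑ a, v a, ∑ a, w a⟫_ℂ).re -
        ∑ b, (⟪coarseGrain (p j) v b, coarseGrain (p j) w b⟫_ℂ).re) := by
  classical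
  have e0 : (⟪∑ a, v a, ∑ a, w a⟫_ℂ).re = ∑ a, ∑ a', (⟪v a, w a'⟫_ℂ).re := by
    simp only [sum_inner, inner_sum, Complex.re_sum]
    exact Finset.sum_comm
  have e1 : ∑ a, (⟪v a, w a⟫_ℂ).re = ∑ a, ∑ a', if a' = a then (⟪v a, w a'⟫_ℂ).re else 0 := by
    simp
  simp only [sum_re_inner_coarseGrain, e0]
  rw [e1]
  simp only [← Finset.sum_sub_distrib]
  conv_rhs => rw [Finset.sum_comm]
  refine Finset.sum_le_sum fun a _ => ?_
  conv_rhs => rw [Finset.sum_comm]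
  refine Finset.sum_le_sum fun a' _ => ?_
  have hnn : ∀ j ∈ s, 0 ≤ (⟪v a, w a'⟫_ℂ).re -
      if p j a' = p j a then (⟪v a, w a'⟫_ℂ).re else 0 := fun j _ => by
    split_ifs
    · simp
    · simpa using h a a'
  by_cases haa : a' = a
  · rw [if_pos haa, sub_self]
    exact Finset.sum_nonneg hnn
  · rw [if_neg haa, sub_zero]
    rcases hs a a' (Ne.symm haa) with h0 | ⟨j, hj, hp⟩
    · rw [h0, Complex.zero_re] at hnn ⊢
      exact Finset.sum_nonneg hnn
    · refine le_trans ?_ (Finset.single_le_sum hnn hj)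
      rw [if_neg (Ne.symm hp), sub_zero]

theorem sum_norm_sub_sq (v w : α → E) : ∑ a, ‖v a - w a‖ ^ 2 =
    ∑ a, ‖v a‖ ^ 2 + ∑ a, ‖w a‖ ^ 2 - 2 * ∑ a, (⟪v a, w a⟫_ℂ).re := by
  rw [Finset.mul_sum, ← Finset.sum_add_distrib, ← Finset.sum_sub_distrib]
  refine Finset.sum_congr rfl fun a _ => ?_
  rw [norm_sub_sq (𝕜 := ℂ)]
  simp only [RCLike.re_to_complex]
  ring

theorem norm_apply_sq_le_re_inner {X : H →L[ℂ] H} (h0 : 0 ≤ X) (h1 : X ≤ 1) (v : H) :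
    ‖X v‖ ^ 2 ≤ (⟪v, X v⟫_ℂ).re := by
  have h2 : 0 ≤ X * (1 - X) :=
    ((Commute.one_right X).sub_right (Commute.refl X)).mul_nonneg h0 (sub_nonneg.2 h1)
  have h3 := ((ContinuousLinearMap.nonneg_iff_isPositive _).1 h2).re_inner_nonneg_right v
  have h4 : ⟪v, X (X v)⟫_ℂ = ⟪X v, X v⟫_ℂ := by
    rw [inner_apply_left_eq_star, (IsSelfAdjoint.of_nonneg h0).star_eq]
  rw [mul_sub, mul_one, sub_apply, inner_sub_right, mul_apply_eq_comp, h4, map_sub,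
    RCLike.re_to_complex, RCLike.re_to_complex, re_inner_self_complex] at h3
  linarith

theorem sum_norm_apply_sq_le {X : α → H →L[ℂ] H} (h0 : ∀ a, 0 ≤ X a) (h1 : ∑ a, X a = 1) (v : H) :
    ∑ a, ‖X a v‖ ^ 2 ≤ ‖v‖ ^ 2 := by
  have hle : ∀ a, X a ≤ 1 := fun a =>
    (Finset.single_le_sum (fun a _ => h0 a) (Finset.mem_univ a)).trans_eq h1
  refine (Finset.sum_le_sum fun a _ => norm_apply_sq_le_re_inner (h0 a) (hle a) v).trans_eq ?_
  rw [← Complex.re_sum, ← inner_sum, ← sum_apply, h1, one_apply_eq_self, re_inner_self_complex]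

end

theorem norm_sub_sq_le_three {E : Type*} [NormedAddCommGroup E] (x y z w : E) :
    ‖x - w‖ ^ 2 ≤ 3 * (‖x - y‖ ^ 2 + ‖y - z‖ ^ 2 + ‖z - w‖ ^ 2) := by
  have h : ‖x - w‖ ≤ ‖x - y‖ + ‖y - z‖ + ‖z - w‖ := by
    refine (norm_sub_le_norm_sub_add_norm_sub x z w).trans ?_
    gcongr
    exact norm_sub_le_norm_sub_add_norm_sub x y z
  refine (pow_le_pow_left₀ (norm_nonneg _) h 2).trans ?_
  nlinarith [sq_nonneg (‖x - y‖ - ‖y - z‖), sq_nonneg (‖y - z‖ - ‖z - w‖),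
    sq_nonneg (‖x - y‖ - ‖z - w‖)]

theorem norm_sub_sq_le_two {E : Type*} [NormedAddCommGroup E] (x y z : E) :
    ‖x - z‖ ^ 2 ≤ 2 * (‖x - y‖ ^ 2 + ‖z - y‖ ^ 2) := by
  have h : ‖x - z‖ ≤ ‖x - y‖ + ‖z - y‖ := by
    rw [norm_sub_rev z]; exact norm_sub_le_norm_sub_add_norm_sub x y z
  refine (pow_le_pow_left₀ (norm_nonneg _) h 2).trans ?_
  nlinarith [sq_nonneg (‖x - y‖ - ‖z - y‖)]

/-- A measurement and an outcome-consistent measurement are close after coarse-graining. -/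
theorem sum_norm_coarseGrain_sub_sq_le {α β : Type*} [Fintype α] [Fintype β]
    {P : α → H →L[ℂ] H} {Q : β → H →L[ℂ] H} (hP0 : ∀ a, 0 ≤ P a) (hP1 : ∑ a, P a = 1)
    (hQ0 : ∀ b, 0 ≤ Q b) (hQ1 : ∑ b, Q b = 1) {ψ : H} (hψ : ‖ψ‖ = 1) {p : α → β} {e : ℝ}
    (he : 1 - e ≤ ∑ a, (⟪P a ψ, Q (p a) ψ⟫_ℂ).re) :
    ∑ b, ‖coarseGrain p (fun a => P a ψ) b - Q b ψ‖ ^ 2 ≤ 2 * e := by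
  have h1 := sum_norm_apply_sq_le (coarseGrain_nonneg hP0 p)
    ((sum_coarseGrain p P).trans hP1) ψ
  have h2 := sum_norm_apply_sq_le hQ0 hQ1 ψ
  simp only [coarseGrain_apply] at h1
  rw [sum_norm_sub_sq, sum_re_inner_coarseGrain_left]
  rw [hψ] at h1 h2
  linarith

namespace IsModularFlow

variable {N M : StarSubalgebra ℂ (H →L[ℂ] H)} {ψ : H} {C : H →L[ℂ] H} {A : H →L⋆[ℂ] H}
  {Φ : C(unitInterval, ℂ) →⋆ₐ[ℂ] (H →L[ℂ] H)} {U : ℝ → H →L[ℂ] H} {J : H →L⋆[ℂ] H}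

theorem le_sum_re_inner_J (h : IsCyclicPair N M ψ) (m : IsModularFlow N M ψ C A Φ U J)
    (hψ : ‖ψ‖ = 1) {α β : Type*} [Fintype α] [Fintype β]
    {P : α → H →L[ℂ] H} {Q : β → H →L[ℂ] H} (hP : ∀ a, P a ∈ N) (hP0 : ∀ a, 0 ≤ P a)
    (hQ : ∀ b, Q b ∈ M) (hQ0 : ∀ b, 0 ≤ Q b) (hQ1 : ∑ b, Q b = 1) {p : α → β} {e : ℝ}
    (he : 1 - e ≤ ∑ a, (⟪P a ψ, Q (p a) ψ⟫_ℂ).re) :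
    1 - 2 * e ≤ ∑ b, (⟪coarseGrain p (fun a => P a ψ) b,
      coarseGrain p (fun a => J (P a ψ)) b⟫_ℂ).re := by
  have h2 := sum_norm_apply_sq_le hQ0 hQ1 ψ
  rw [hψ] at h2
  have h3 : ∑ b, (⟪Q b ψ, J (Q b ψ)⟫_ℂ).re ≤ ∑ b, ‖Q b ψ‖ ^ 2 :=
    Finset.sum_le_sum fun b _ => m.re_inner_J_le _
  have h4 : 2 * ∑ b, (⟪coarseGrain p (fun a => P a ψ) b, Q b ψ⟫_ℂ).re ≤
      ∑ b, (⟪coarseGrain p (fun a => P a ψ) b, J (coarseGrain p (fun a => P a ψ) b)⟫_ℂ).re +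
      ∑ b, (⟪Q b ψ, J (Q b ψ)⟫_ℂ).re := by
    rw [Finset.mul_sum, ← Finset.sum_add_distrib]
    refine Finset.sum_le_sum fun b _ => ?_
    rw [← coarseGrain_apply]
    exact m.two_mul_re_inner_le h (coarseGrain_mem hP p b)
      (IsSelfAdjoint.of_nonneg (coarseGrain_nonneg hP0 p b)) (hQ b)
      (IsSelfAdjoint.of_nonneg (hQ0 b))
  rw [sum_re_inner_coarseGrain_left] at h4
  simp only [map_coarseGrain J] at h4
  linarith

/-- If consistent partners separate the outcomes of a measurement, the measurement is nearly
self-polar. -/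
theorem le_sum_re_inner_J_diagonal (h : IsCyclicPair N M ψ) (m : IsModularFlow N M ψ C A Φ U J)
    (hψ : ‖ψ‖ = 1) {α ι : Type*} [Fintype α] {β : ι → Type*} [∀ j, Fintype (β j)]
    {P : α → H →L[ℂ] H} {Q : ∀ j, β j → H →L[ℂ] H} (hP : ∀ a, P a ∈ N) (hP0 : ∀ a, 0 ≤ P a)
    (hP1 : ∑ a, P a = 1) (hQ : ∀ j b, Q j b ∈ M) (hQ0 : ∀ j b, 0 ≤ Q j b)
    (hQ1 : ∀ j, ∑ b, Q j b = 1) {p : ∀ j, α → β j} {e : ι → ℝ} {s : Finset ι}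
    (he : ∀ j ∈ s, 1 - e j ≤ ∑ a, (⟪P a ψ, Q j (p j a) ψ⟫_ℂ).re)
    (hs : ∀ a a', a ≠ a' → P a = 0 ∨ P a' = 0 ∨ ∃ j ∈ s, p j a ≠ p j a') :
    1 - ∑ j ∈ s, 2 * e j ≤ ∑ a, (⟪P a ψ, J (P a ψ)⟫_ℂ).re := by
  have h1 : (⟪∑ a, P a ψ, ∑ a, J (P a ψ)⟫_ℂ).re = 1 := by
    rw [← map_sum, ← sum_apply, hP1, one_apply_eq_self, m.J_vacuum, re_inner_self_complex, hψ,
      one_pow]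
  have h2 := offDiagonal_le_sum_coarseGrain p (v := fun a => P a ψ) (w := fun a => J (P a ψ))
    (fun a a' => m.re_inner_J_nonneg h (hP a) (hP0 a) (hP a') (hP0 a')) s (fun a a' haa => by
      rcases hs a a' haa with h0 | h0 | h0
      · left; simp [h0]
      · left; simp [h0]
      · exact Or.inr h0)
  rw [h1] at h2
  have h3 : ∑ j ∈ s, (1 - ∑ b, (⟪coarseGrain (p j) (fun a => P a ψ) b,
      coarseGrain (p j) (fun a => J (P a ψ)) b⟫_ℂ).re) ≤ ∑ j ∈ s, 2 * e j :=
    Finset.sum_le_sum fun j hj => by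
      have := m.le_sum_re_inner_J h hψ hP hP0 (hQ j) (hQ0 j) (hQ1 j) (he j hj)
      linarith
  linarith

end IsModularFlow

theorem sum_norm_apply_sq_eq {α : Type*} [Fintype α] {r : α → H →L[ℂ] H}
    (hr : ∀ a, IsStarProjection (r a)) (h1 : ∑ a, r a = 1) (v : H) :
    ∑ a, ‖r a v‖ ^ 2 = ‖v‖ ^ 2 := by
  have : ∀ a, ‖r a v‖ ^ 2 = (⟪v, r a v⟫_ℂ).re := fun a => by
    rw [← re_inner_self_complex, inner_apply_left_eq_star, (hr a).isSelfAdjoint.star_eq,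
      ← mul_apply_eq_comp, (hr a).isIdempotentElem]
  simp only [this]
  rw [← Complex.re_sum, ← inner_sum, ← sum_apply, h1, one_apply_eq_self, re_inner_self_complex]

theorem IsTracialVector.sum_norm_coarseGrain_sub_sq_le {R S : StarSubalgebra ℂ (H →L[ℂ] H)} {Ω : H}
    (h : IsTracialVector R S Ω) (hΩ : ‖Ω‖ = 1) {α β : Type*} [Fintype α] [Fintype β]
    {X r : α → H →L[ℂ] H} (hX : ∀ a, X a ∈ R) (hX0 : ∀ a, 0 ≤ X a) (hX1 : ∑ a, X a = 1)
    (hr : ∀ a, r a ∈ R) (hrp : ∀ a, IsStarProjection (r a)) (hr1 : ∑ a, r a = 1) (p : α → β)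
    {e : ℝ} (he : 1 - e ≤ ∑ a, reState Ω (r a * X a)) :
    ∑ b, ‖coarseGrain p (fun a => r a Ω) b - coarseGrain p (fun a => X a Ω) b‖ ^ 2 ≤ 2 * e := by
  have hre : ∀ a a', reState Ω (r a * X a') = (⟪r a Ω, X a' Ω⟫_ℂ).re := fun a a' => by
    rw [← reState_star_mul, (hrp a).isSelfAdjoint.star_eq]
  have h1 := sum_norm_apply_sq_le (coarseGrain_nonneg (fun a => (hrp a).nonneg) p)
    ((sum_coarseGrain p r).trans hr1) Ω
  have h2 := sum_norm_apply_sq_le (coarseGrain_nonneg hX0 p) ((sum_coarseGrain p X).trans hX1) Ω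
  simp only [coarseGrain_apply] at h1 h2
  have h3 := sum_re_inner_le_coarseGrain p (v := fun a => r a Ω) (w := fun a => X a Ω)
    fun a a' => by
      rw [← hre]
      exact h.reState_mul_nonneg (hrp a) (hr a) (hX a') (hX0 a')
  simp only [hre] at he
  rw [sum_norm_sub_sq]
  rw [hΩ] at h1 h2
  linarith

/-- Rounding the second player's answers to coarse-grainings of the first player's measurements. -/
theorem IsTracialVector.exists_partner_pvm {R S : StarSubalgebra ℂ (H →L[ℂ] H)} {Ω : H}
    (h : IsTracialVector R S Ω) (hΩ : ‖Ω‖ = 1) {I J : Type*} [Fintype I] [Fintype J] [Nonempty I]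
    {A : I → Type*} [∀ i, Fintype (A i)] {B : J → Type*} [∀ j, Fintype (B j)]
    {X r : ∀ i, A i → H →L[ℂ] H} (hX : ∀ i a, X i a ∈ R) (hX0 : ∀ i a, 0 ≤ X i a)
    (hX1 : ∀ i, ∑ a, X i a = 1) (hr : ∀ i a, r i a ∈ R) (hrp : ∀ i a, IsStarProjection (r i a))
    (hr0 : ∀ i a a', a ≠ a' → r i a * r i a' = 0) (hr1 : ∀ i, ∑ a, r i a = 1)
    (p : ∀ i j, A i → B j) {β : I → ℝ} (hβ : ∀ i, 1 - β i ≤ ∑ a, reState Ω (r i a * X i a))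
    {μ e : I → J → ℝ} (hμ0 : ∀ i j, 0 ≤ μ i j) (hμ1 : ∑ i, ∑ j, μ i j = 1)
    (he : ∀ i i' j, 0 < μ i j → 0 < μ i' j → ∑ b, ‖coarseGrain (p i j) (fun a => X i a Ω) b -
      coarseGrain (p i' j) (fun a => X i' a Ω) b‖ ^ 2 ≤ 4 * (e i j + e i' j)) :
    ∃ s : ∀ j, B j → H →L[ℂ] H, (∀ j b, s j b ∈ R) ∧ (∀ j b, IsStarProjection (s j b)) ∧
      (∀ j, ∑ b, s j b = 1) ∧ 1 - ∑ i, ∑ j, μ i j * (6 * β i + 12 * e i j) ≤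
        ∑ i, ∑ j, μ i j * ∑ a, reState Ω (r i a * s j (p i j a)) := by
  classical
  have hmin : ∀ j, ∃ k, ∀ i, 0 < μ i j → 0 < μ k j ∧ 3 * β k + 6 * e k j ≤ 3 * β i + 6 * e i j := by
    intro j
    rcases (Finset.univ.filter fun i => 0 < μ i j).eq_empty_or_nonempty with h0 | h0
    · exact ⟨Classical.arbitrary I, fun i hi =>
        absurd (Finset.mem_filter.2 ⟨Finset.mem_univ i, hi⟩) (by rw [h0]; simp)⟩
    · obtain ⟨k, hk, hk'⟩ := Finset.exists_min_image _ (fun i => 3 * β i + 6 * e i j) h0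
      exact ⟨k, fun i hi => ⟨(Finset.mem_filter.1 hk).2,
        hk' i (Finset.mem_filter.2 ⟨Finset.mem_univ i, hi⟩)⟩⟩
  choose k hk using hmin
  refine ⟨fun j => coarseGrain (p (k j) j) (r (k j)), fun j b => coarseGrain_mem (hr _) _ b,
    fun j b => coarseGrain_isStarProjection (hrp _) (hr0 _) _ b,
    fun j => (sum_coarseGrain _ _).trans (hr1 _), ?_⟩
  have key : ∀ i j, μ i j * (1 - (6 * β i + 12 * e i j)) ≤ μ i j * ∑ a, reState Ω (r i a *
      coarseGrain (p (k j) j) (r (k j)) (p i j a)) := by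
    intro i j
    rcases (hμ0 i j).eq_or_lt with h0 | h0
    · rw [← h0, zero_mul, zero_mul]
    refine mul_le_mul_of_nonneg_left ?_ h0.le
    obtain ⟨hkj, hle⟩ := hk j i h0
    have h1 := h.sum_norm_coarseGrain_sub_sq_le hΩ (hX i) (hX0 i) (hX1 i) (hr i) (hrp i) (hr1 i)
      (p i j) (hβ i)
    have h2 := h.sum_norm_coarseGrain_sub_sq_le hΩ (hX (k j)) (hX0 (k j)) (hX1 (k j)) (hr (k j))
      (hrp (k j)) (hr1 (k j)) (p (k j) j) (hβ (k j))
    have h3 := he i (k j) j h0 hkj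
    have h4 := Finset.sum_le_sum fun b (_ : b ∈ Finset.univ) => norm_sub_sq_le_three
      (coarseGrain (p i j) (fun a => r i a Ω) b) (coarseGrain (p i j) (fun a => X i a Ω) b)
      (coarseGrain (p (k j) j) (fun a => X (k j) a Ω) b)
      (coarseGrain (p (k j) j) (fun a => r (k j) a Ω) b)
    rw [← Finset.mul_sum, Finset.sum_add_distrib, Finset.sum_add_distrib, sum_norm_sub_sq,
      sum_re_inner_coarseGrain_left] at h4
    have e1 := sum_norm_apply_sq_eq (coarseGrain_isStarProjection (hrp i) (hr0 i) (p i j))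
      ((sum_coarseGrain _ _).trans (hr1 _)) Ω
    have e2 := sum_norm_apply_sq_eq (coarseGrain_isStarProjection (hrp (k j)) (hr0 (k j))
      (p (k j) j)) ((sum_coarseGrain _ _).trans (hr1 _)) Ω
    simp only [coarseGrain_apply, hΩ] at e1 e2
    have e3 : ∑ a, reState Ω (r i a * coarseGrain (p (k j) j) (r (k j)) (p i j a)) =
        ∑ a, (⟪r i a Ω, coarseGrain (p (k j) j) (fun a => r (k j) a Ω) (p i j a)⟫_ℂ).re :=
      Finset.sum_congr rfl fun a _ => by
        rw [← coarseGrain_apply, ← reState_star_mul, (hrp i a).isSelfAdjoint.star_eq]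
    simp only [norm_sub_rev (coarseGrain (p (k j) j) (fun a => X (k j) a Ω) _)
      (coarseGrain (p (k j) j) (fun a => r (k j) a Ω) _)] at h4
    rw [e3]
    linarith
  calc _ = ∑ i, ∑ j, μ i j * (1 - (6 * β i + 12 * e i j)) := by
        simp only [mul_sub, mul_one, Finset.sum_sub_distrib, hμ1]
    _ ≤ _ := Finset.sum_le_sum fun i _ => Finset.sum_le_sum fun j _ => key i j

theorem one_sub_sqrt_le_of_forall_pos {S T Z : ℝ} (hT : 0 ≤ T) (hTS : T ≤ S) (hS : S ≤ 1)
    (h : ∀ δ > 0, S - 3 * δ * S - 3 / (2 * δ) * (S - T) ≤ Z) : 1 - 3 * √(2 * (1 - T)) ≤ Z := by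
  rcases (hTS.trans hS).eq_or_lt with rfl | hT1
  · obtain rfl : S = 1 := le_antisymm hS hTS
    rw [sub_self, mul_zero, Real.sqrt_zero, mul_zero, sub_zero]
    refine le_of_forall_pos_le_add fun δ hδ => ?_
    have := h (δ / 3) (by positivity)
    linarith
  · set q := √((1 - T) / 2) with hq
    have hq0 : 0 < q := Real.sqrt_pos.2 (by linarith)
    have hqq : q * q = (1 - T) / 2 := Real.mul_self_sqrt (by linarith)
    have h2 : √(2 * (1 - T)) = 2 * q := by
      rw [show 2 * (1 - T) = (2 * q) * (2 * q) by linarith, Real.sqrt_mul_self (by positivity)]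
    have hq1 : q ≤ 1 := by nlinarith
    refine le_trans ?_ (h q hq0)
    have h3 : 3 / (2 * q) * (S - T) = 3 * q - 3 / (2 * q) * (1 - S) := by
      rw [show S - T = 2 * (q * q) - (1 - S) by linarith]
      field_simp
    have h4 : 1 ≤ 3 / (2 * q) := by
      rw [le_div_iff₀ (by positivity)]; linarith
    have h5 := mul_le_mul_of_nonneg_right h4 (sub_nonneg.2 hS)
    rw [h2, h3]
    nlinarith

theorem sum_mul_sqrt_le {ι : Type*} (s : Finset ι) {w x : ι → ℝ} (hw : ∀ i, 0 ≤ w i)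
    (hw1 : ∑ i ∈ s, w i = 1) (hx : ∀ i, 0 ≤ x i) :
    ∑ i ∈ s, w i * √(x i) ≤ √(∑ i ∈ s, w i * x i) := by
  have h := Real.sum_sqrt_mul_sqrt_le s hw fun i => mul_nonneg (hw i) (hx i)
  rw [hw1, Real.sqrt_one, one_mul] at h
  refine (Finset.sum_congr rfl fun i _ => ?_).trans_le h
  rw [Real.sqrt_mul (hw i), ← mul_assoc, Real.mul_self_sqrt (hw i)]

theorem error_le_rpow {x : ℝ} (h0 : 0 ≤ x) (h1 : x ≤ 1) :
    42 * √(3 * √(4 * x)) + 12 * x ≤ 148 * x ^ ((1 : ℝ) / 4) := by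
  set t := x ^ ((1 : ℝ) / 4) with ht
  have ht0 : 0 ≤ t := Real.rpow_nonneg h0 _
  have ht1 : t ≤ 1 := Real.rpow_le_one h0 h1 (by norm_num)
  have hx : x = t ^ 4 := by
    rw [ht, ← Real.rpow_natCast, ← Real.rpow_mul h0]; norm_num
  have e1 : √(4 * x) = 2 * t ^ 2 := by
    rw [hx, show 4 * t ^ 4 = (2 * t ^ 2) ^ 2 by ring, Real.sqrt_sq (by positivity)]
  have e2 : √(3 * √(4 * x)) ≤ 5 / 2 * t := by
    rw [e1, Real.sqrt_le_left (by positivity)]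
    nlinarith [sq_nonneg t]
  have e3 : x ≤ t := by
    rw [hx]; exact pow_le_of_le_one ht0 ht1 (by norm_num)
  linarith

theorem sum_indicator_smul {α ι V : Type*} [Fintype ι] [DecidableEq ι] [AddCommMonoid V]
    [Module ℂ V] (g : α → ι) (s : Finset α) (v : ι → V) :
    ∑ x, (∑ a ∈ s, if x = g a then (1 : ℂ) else 0) • v x = ∑ a ∈ s, v (g a) := by
  simp only [Finset.sum_smul, ite_smul, one_smul, zero_smul]
  rw [Finset.sum_comm]
  simp

/-- A near-perfect strategy in a cyclic pair of algebras whose first player's outcomes are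
separated by the game can be replaced by a near-perfect tracial strategy. -/
theorem IsCyclicPair.exists_tracial_strategy.{u} {H : Type u} [NormedAddCommGroup H]
    [InnerProductSpace ℂ H] [CompleteSpace H] {N M : StarSubalgebra ℂ (H →L[ℂ] H)} {ψ : H}
    (h : IsCyclicPair N M ψ) (hψ : ‖ψ‖ = 1) {I J : Type*} [Fintype I] [Fintype J] [Nonempty I]
    {A : I → Type*} [∀ i, Fintype (A i)] [∀ i, Nonempty (A i)]
    {B : J → Type*} [∀ j, Fintype (B j)] {P : ∀ i, A i → H →L[ℂ] H} {Q : ∀ j, B j → H →L[ℂ] H}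
    (hP : ∀ i a, P i a ∈ N) (hP0 : ∀ i a, 0 ≤ P i a) (hP1 : ∀ i, ∑ a, P i a = 1)
    (hQ : ∀ j b, Q j b ∈ M) (hQ0 : ∀ j b, 0 ≤ Q j b) (hQ1 : ∀ j, ∑ b, Q j b = 1)
    (p : ∀ i j, A i → B j) {μ e : I → J → ℝ} (hμ0 : ∀ i j, 0 ≤ μ i j)
    (hμ1 : ∑ i, ∑ j, μ i j = 1)
    (hsep : ∀ i a a', a ≠ a' → P i a = 0 ∨ P i a' = 0 ∨ ∃ j, 0 < μ i j ∧ p i j a ≠ p i j a')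
    (he0 : ∀ i j, 0 ≤ e i j) (he : ∀ i j, 1 - e i j ≤ ∑ a, (⟪P i a ψ, Q j (p i j a) ψ⟫_ℂ).re)
    {L ε : ℝ} (hL1 : 1 ≤ L) (hL : ∀ i j, 0 < μ i j → ∑ j', μ i j' ≤ L * μ i j)
    (hε : ∑ i, ∑ j, μ i j * e i j ≤ ε) :
    ∃ (K : Type u) (_ : NormedAddCommGroup K) (_ : InnerProductSpace ℂ K) (_ : CompleteSpace K)
      (R S : StarSubalgebra ℂ (K →L[ℂ] K)) (Ω : K) (r : ∀ i, A i → K →L[ℂ] K)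
      (s : ∀ j, B j → K →L[ℂ] K), IsTracialVector R S Ω ∧ ‖Ω‖ = 1 ∧
      (∀ i a, r i a ∈ R) ∧ (∀ i a, IsStarProjection (r i a)) ∧ (∀ i, ∑ a, r i a = 1) ∧
      (∀ j b, s j b ∈ R) ∧ (∀ j b, IsStarProjection (s j b)) ∧ (∀ j, ∑ b, s j b = 1) ∧
      1 - 148 * (L * ε) ^ ((1 : ℝ) / 4) ≤
        ∑ i, ∑ j, μ i j * ∑ a, reState Ω (r i a * s j (p i j a)) := by
  classical
  obtain ⟨C, D, Φ, U, F, m⟩ := h.exists_isModularFlow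
  obtain ⟨K, _, _, _, Ω, X, Y, hΩ, hX0, hX1, hXle, hXpol, hY0, hXY, hXΩ⟩ :=
    m.exists_tracial_operators h hψ (ι := Σ i, A i) (P := fun x => P x.1 x.2)
      (fun x => hP _ _) (fun x => hP0 _ _) fun x =>
        (Finset.single_le_sum (fun a _ => hP0 x.1 a) (Finset.mem_univ x.2)).trans_eq (hP1 x.1)
  have hX1' : ∀ i, ∑ a, X ⟨i, a⟩ = 1 := fun i => by
    rw [← sum_indicator_smul (Sigma.mk i) Finset.univ X]
    refine hX1 _ ?_
    rw [sum_indicator_smul]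
    exact hP1 i
  obtain ⟨R, S, hR, hXR⟩ := exists_isTracialVector
    (fun x => IsSelfAdjoint.of_nonneg (hX0 x)) (fun x => IsSelfAdjoint.of_nonneg (hY0 x)) hXY hXΩ
  set T : I → ℝ := fun i => ∑ a, (⟪P i a ψ, F (P i a ψ)⟫_ℂ).re with hT
  have hT0 : ∀ i, 0 ≤ T i := fun i => Finset.sum_nonneg fun a _ =>
    m.re_inner_J_nonneg h (hP i a) (hP0 i a) (hP i a) (hP0 i a)
  have hTS : ∀ i, T i ≤ ∑ a, ‖P i a ψ‖ ^ 2 := fun i =>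
    Finset.sum_le_sum fun a _ => m.re_inner_J_le _
  have hS1 : ∀ i, ∑ a, ‖P i a ψ‖ ^ 2 ≤ 1 := fun i => by
    simpa [hψ] using sum_norm_apply_sq_le (hP0 i) (hP1 i) ψ
  have hZ : ∀ i, 1 - 3 * √(2 * (1 - T i)) ≤ ∑ a, ‖X ⟨i, a⟩ Ω‖ ^ 2 := fun i => by
    refine one_sub_sqrt_le_of_forall_pos (hT0 i) (hTS i) (hS1 i) fun δ hδ => ?_
    refine le_trans (le_of_eq ?_) (Finset.sum_le_sum fun a _ => hXpol ⟨i, a⟩ δ hδ)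
    simp only [hT, Finset.sum_sub_distrib, ← Finset.mul_sum]
  have hr := fun i => hR.exists_near_pvm hΩ (fun a => hXR ⟨i, a⟩) (fun a => hX0 ⟨i, a⟩) (hX1' i)
    (hZ i)
  choose r hrR hrp hr0 hr1 hrX using hr
  obtain ⟨s, hsR, hsp, hs1, hval⟩ := hR.exists_partner_pvm hΩ (fun i a => hXR ⟨i, a⟩)
    (fun i a => hX0 ⟨i, a⟩) hX1' hrR hrp hr0 hr1 p hrX hμ0 hμ1 (e := e) (fun i i' j _ _ => by
      have h1 := sum_norm_coarseGrain_sub_sq_le (hP0 i) (hP1 i) (hQ0 j) (hQ1 j) hψ (he i j)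
      have h2 := sum_norm_coarseGrain_sub_sq_le (hP0 i') (hP1 i') (hQ0 j) (hQ1 j) hψ (he i' j)
      have h3 := Finset.sum_le_sum fun b (_ : b ∈ Finset.univ) => norm_sub_sq_le_two
        (coarseGrain (p i j) (fun a => P i a ψ) b) (Q j b ψ)
        (coarseGrain (p i' j) (fun a => P i' a ψ) b)
      rw [← Finset.mul_sum, Finset.sum_add_distrib] at h3
      refine le_trans (Finset.sum_le_sum fun b _ => ?_) (h3.trans (by linarith))
      refine pow_le_pow_left₀ (norm_nonneg _) ?_ 2
      have h4 := hXle fun x => (∑ a with p i j a = b, if x = ⟨i, a⟩ then 1 else 0) -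
        ∑ a with p i' j a = b, if x = ⟨i', a⟩ then 1 else 0
      simp only [sub_smul, Finset.sum_sub_distrib] at h4
      rw [sum_indicator_smul (Sigma.mk i), sum_indicator_smul (Sigma.mk i'),
        sum_indicator_smul (Sigma.mk i), sum_indicator_smul (Sigma.mk i')] at h4
      unfold coarseGrain
      convert h4)
  refine ⟨K, _, _, _, R, S, Ω, r, s, hR, hΩ, hrR, hrp, hr1, hsR, hsp, hs1, ?_⟩
  have hε0 : 0 ≤ ε := le_trans (Finset.sum_nonneg fun i _ => Finset.sum_nonneg fun j _ =>
    mul_nonneg (hμ0 i j) (he0 i j)) hε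
  rcases le_or_gt (L * ε) 1 with hx | hx
  · refine le_trans ?_ hval
    have hw0 : ∀ i, 0 ≤ ∑ j, μ i j := fun i => Finset.sum_nonneg fun j _ => hμ0 i j
    have hT1 : ∀ i, 0 ≤ 1 - T i := fun i => by linarith [hTS i, hS1 i]
    have hκ : ∑ i, (∑ j, μ i j) * (1 - T i) ≤ 2 * (L * ε) := by
      have h1 : ∀ i, (∑ j, μ i j) * (1 - T i) ≤ ∑ j, 2 * L * (μ i j * e i j) := fun i => by
        have h2 := m.le_sum_re_inner_J_diagonal h hψ (hP i) (hP0 i) (hP1 i) hQ hQ0 hQ1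
          (p := p i) (e := e i) (s := Finset.univ.filter fun j => 0 < μ i j)
          (fun j _ => he i j) (fun a a' haa => by simpa using hsep i a a' haa)
        have h3 : 1 - T i ≤ ∑ j with 0 < μ i j, 2 * e i j := by linarith
        refine (mul_le_mul_of_nonneg_left h3 (hw0 i)).trans ?_
        rw [Finset.mul_sum]
        refine (Finset.sum_le_sum (g := fun j => 2 * L * (μ i j * e i j)) fun j hj => ?_).trans
          (Finset.sum_le_sum_of_subset_of_nonneg (Finset.filter_subset _ _) fun j _ _ => ?_)
        · have := mul_le_mul_of_nonneg_right (hL i j (Finset.mem_filter.1 hj).2) (he0 i j)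
          linarith
        · have := mul_nonneg (hμ0 i j) (he0 i j)
          positivity
      refine (Finset.sum_le_sum fun i _ => h1 i).trans ?_
      simp only [← Finset.mul_sum]
      nlinarith
    have h1 : ∑ i, (∑ j, μ i j) * √(3 * √(2 * (1 - T i))) ≤ √(3 * √(4 * (L * ε))) := by
      refine (sum_mul_sqrt_le _ hw0 hμ1 fun i => by positivity).trans (Real.sqrt_le_sqrt ?_)
      simp only [mul_left_comm _ (3 : ℝ), ← Finset.mul_sum]
      refine mul_le_mul_of_nonneg_left ?_ (by norm_num)
      refine (sum_mul_sqrt_le _ hw0 hμ1 fun i => mul_nonneg two_pos.le (hT1 i)).trans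
        (Real.sqrt_le_sqrt ?_)
      simp only [mul_left_comm _ (2 : ℝ), ← Finset.mul_sum]
      linarith
    have h2 : ∑ i, ∑ j, μ i j * (6 * (7 * √(3 * √(2 * (1 - T i)))) + 12 * e i j) =
        42 * ∑ i, (∑ j, μ i j) * √(3 * √(2 * (1 - T i))) + 12 * ∑ i, ∑ j, μ i j * e i j := by
      simp only [Finset.mul_sum, Finset.sum_mul, ← Finset.sum_add_distrib]
      exact Finset.sum_congr rfl fun i _ => Finset.sum_congr rfl fun j _ => by ring
    have h3 := error_le_rpow (mul_nonneg (zero_le_one.trans hL1) hε0) hx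
    have h4 : ε ≤ L * ε := le_mul_of_one_le_left hε0 hL1
    rw [h2]
    linarith
  · have h1 : 1 ≤ (L * ε) ^ ((1 : ℝ) / 4) := Real.one_le_rpow hx.le (by norm_num)
    have h2 : 0 ≤ ∑ i, ∑ j, μ i j * ∑ a, reState Ω (r i a * s j (p i j a)) :=
      Finset.sum_nonneg fun i _ => Finset.sum_nonneg fun j _ => mul_nonneg (hμ0 i j) <|
        Finset.sum_nonneg fun a _ =>
          hR.reState_mul_nonneg (hrp i a) (hrR i a) (hsR j _) (hsp j _).nonneg
    linarith

/-- Outcomes which no question of positive weight distinguishes can be merged. -/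
theorem exists_separating_merging {α J : Type*} [Nonempty α] {B : J → Type*} [∀ j, Nonempty (B j)]
    (p : ∀ j, α → B j) (s : Set J) : ∃ ρ : α → α, (∀ j ∈ s, ∀ a, p j (ρ a) = p j a) ∧
      ∀ a a', ρ a ≠ ρ a' → ∃ j ∈ s, p j (ρ a) ≠ p j (ρ a') := by
  classical
  let f : α → ∀ j : s, B j := fun a j => p j a
  have hf : ∀ a, f (Function.invFun f (f a)) = f a := fun a => Function.invFun_eq ⟨a, rfl⟩
  have hρ : ∀ j ∈ s, ∀ a, p j (Function.invFun f (f a)) = p j a := fun j hj a =>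
    congrFun (hf a) ⟨j, hj⟩
  refine ⟨fun a => Function.invFun f (f a), hρ, fun a a' h => ?_⟩
  by_contra! hne
  refine h (congrArg _ (funext fun j => ?_))
  have := hne j j.2
  rwa [hρ j j.2, hρ j j.2] at this

theorem exists_of_coarseGrain_ne_zero {α β T : Type*} [Fintype α] [AddCommMonoid T] {p : α → β}
    {X : α → T} {b : β} (h : coarseGrain p X b ≠ 0) : ∃ a, p a = b := by
  classical
  obtain ⟨a, ha, -⟩ := Finset.exists_ne_zero_of_sum_ne_zero h
  exact ⟨a, (Finset.mem_filter.1 ha).2⟩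

theorem IsTracialVector.ofReal_reState_mul {R S : StarSubalgebra ℂ (H →L[ℂ] H)} {Ω : H}
    (h : IsTracialVector R S Ω) {x y : H →L[ℂ] H} (hx : x ∈ R) (hy : y ∈ R)
    (hxs : IsSelfAdjoint x) (hys : IsSelfAdjoint y) :
    (reState Ω (x * y) : ℂ) = ⟪Ω, (x * y) Ω⟫_ℂ := by
  have h1 : (starRingEnd ℂ) ⟪Ω, (x * y) Ω⟫_ℂ = ⟪Ω, (x * y) Ω⟫_ℂ := by
    rw [inner_conj_symm, inner_apply_left_eq_star, star_mul, hxs.star_eq, hys.star_eq,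
      h.trace y hy x hx]
  rw [reState_apply]
  exact Complex.conj_eq_iff_re.1 h1

end

/-- Let `G` be an arbitrary (possibly degenerate) projection game and `c` a
commuting operator correlation with `w_G(c) ≥ 1 - ε`.  With
`L = max_{(i,j) : μ(i,j) > 0} μ(i)/μ(i,j)`, there is a tracial correlation `c'` (in GNS
form: a Hilbert space `K`, a unit vector `ξ`, PVMs of projections, the vector state of
`ξ` tracial on the generated unital *-subalgebra) with
`w_G(c') ≥ 1 - 148 (L ε)^{1/4}`. -/
theorem almost_perfect_commuting_operator_strategy_near_tracial_degenerate
    {I J : Type} [Fintype I] [Fintype J] [Nonempty I] [Nonempty J]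
    {A : I → Type} [∀ i, Fintype (A i)] [∀ i, Nonempty (A i)]
    {B : J → Type} [∀ j, Fintype (B j)] [∀ j, Nonempty (B j)]
    (μ : I → J → ℝ) (hμ0 : ∀ i j, 0 ≤ μ i j) (hμ1 : ∑ i, ∑ j, μ i j = 1)
    (p : ∀ i j, A i → B j)
    -- `L` is the maximum of `μ(i)/μ(i,j)` over pairs with `μ(i,j) > 0`
    (L : ℝ)
    (hL : IsGreatest {x : ℝ | ∃ i j, 0 < μ i j ∧ x = (∑ j', μ i j') / μ i j} L)
    -- `c` is a commuting operator correlation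
    {H : Type} [NormedAddCommGroup H] [InnerProductSpace ℂ H] [CompleteSpace H]
    (P : ∀ i, A i → H →L[ℂ] H) (Q : ∀ j, B j → H →L[ℂ] H)
    (hP : ∀ i a, (P i a).IsPositive) (hPsum : ∀ i, ∑ a, P i a = 1)
    (hQ : ∀ j b, (Q j b).IsPositive) (hQsum : ∀ j, ∑ b, Q j b = 1)
    (hcomm : ∀ i j a b, P i a * Q j b = Q j b * P i a)
    (ψ : H) (hψ : ‖ψ‖ = 1)
    (c : ∀ i j, A i → B j → ℝ)
    (hc : ∀ i j a b, (c i j a b : ℂ) = @inner ℂ H _ ψ ((P i a * Q j b) ψ))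
    -- the strategy wins with probability at least `1 - ε`
    (ε : ℝ)
    (hw : 1 - ε ≤ ∑ i, ∑ j, μ i j * ∑ a, c i j a (p i j a)) :
    ∃ (K : Type) (_ : NormedAddCommGroup K) (_ : InnerProductSpace ℂ K)
      (_ : CompleteSpace K) (ξ : K)
      (r : ∀ i, A i → K →L[ℂ] K) (s : ∀ j, B j → K →L[ℂ] K)
      (c' : ∀ i j, A i → B j → ℝ),
      ‖ξ‖ = 1 ∧
      (∀ i a, IsSelfAdjoint (r i a) ∧ r i a * r i a = r i a) ∧ (∀ i, ∑ a, r i a = 1) ∧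
      (∀ j b, IsSelfAdjoint (s j b) ∧ s j b * s j b = s j b) ∧ (∀ j, ∑ b, s j b = 1) ∧
      (∀ x y : K →L[ℂ] K,
        x ∈ StarAlgebra.adjoin ℂ ({T | ∃ i a, T = r i a} ∪ {T | ∃ j b, T = s j b}) →
        y ∈ StarAlgebra.adjoin ℂ ({T | ∃ i a, T = r i a} ∪ {T | ∃ j b, T = s j b}) →
        @inner ℂ K _ ξ ((x * y) ξ) = @inner ℂ K _ ξ ((y * x) ξ)) ∧
      (∀ i j a b, (c' i j a b : ℂ) = @inner ℂ K _ ξ ((r i a * s j b) ξ)) ∧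
      1 - 148 * (L * ε) ^ ((1 : ℝ)/4)
        ≤ ∑ i, ∑ j, μ i j * ∑ a, c' i j a (p i j a) := by
  classical
  have hP0 : ∀ i a, 0 ≤ P i a := fun i a => (ContinuousLinearMap.nonneg_iff_isPositive _).2 (hP i a)
  have hQ0 : ∀ j b, 0 ≤ Q j b := fun j b => (ContinuousLinearMap.nonneg_iff_isPositive _).2 (hQ j b)
  have hmerge := fun i => exists_separating_merging (p i) {j | 0 < μ i j}
  choose ρ hρ hρsep using hmerge
  have hcomm' : ∀ i a j b, Commute (coarseGrain (ρ i) (P i) a) (Q j b) := fun i a j b =>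
    Commute.sum_left _ _ _ fun x _ => hcomm i j x b
  obtain ⟨E, _, _, _, N, M, φ, d, hcyc, hφ, hd1, hd0, hdN, hdM, hdinner⟩ :=
    exists_isCyclicPair (P := fun x : Σ i, A i => coarseGrain (ρ x.1) (P x.1) x.2)
      (Q := fun y : Σ j, B j => Q y.1 y.2) (fun x => coarseGrain_nonneg (hP0 _) _ _)
      (fun x y => hcomm' _ _ _ _) hψ
  have hdP0 : ∀ i a, 0 ≤ d (coarseGrain (ρ i) (P i) a) := fun i a =>
    hd0 _ (coarseGrain_nonneg (hP0 i) _ _)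
  have hdQ0 : ∀ j b, 0 ≤ d (Q j b) := fun j b => hd0 _ (hQ0 j b)
  have hdP1 : ∀ i, ∑ a, d (coarseGrain (ρ i) (P i) a) = 1 := fun i => by
    rw [← map_sum, sum_coarseGrain, hPsum, hd1]
  have hdQ1 : ∀ j, ∑ b, d (Q j b) = 1 := fun j => by rw [← map_sum, hQsum, hd1]
  set e : I → J → ℝ := fun i j => 1 - ∑ a,
    (@inner ℂ E _ (d (coarseGrain (ρ i) (P i) a) φ) (d (Q j (p i j a)) φ)).re with he
  have he' : ∀ i j, 1 - e i j ≤ ∑ a,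
      (@inner ℂ E _ (d (coarseGrain (ρ i) (P i) a) φ) (d (Q j (p i j a)) φ)).re := fun i j => by
    rw [he, sub_sub_cancel]
  have he0 : ∀ i j, 0 ≤ e i j := fun i j => by
    have h1 := sum_norm_coarseGrain_sub_sq_le (hdP0 i) (hdP1 i) (hdQ0 j) (hdQ1 j) hφ (he' i j)
    have h2 : 0 ≤ 2 * e i j := le_trans (Finset.sum_nonneg fun b _ => sq_nonneg _) h1
    linarith
  have hinner : ∀ i j a, (@inner ℂ E _ (d (coarseGrain (ρ i) (P i) a) φ)
      (d (Q j (p i j a)) φ)).re =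
      (@inner ℂ H _ (coarseGrain (ρ i) (fun a => P i a ψ) a) (Q j (p i j a) ψ)).re := by
    intro i j a
    rw [inner_apply_left_eq_star, (IsSelfAdjoint.of_nonneg (hdP0 i a)).star_eq, ← mul_apply_eq_comp,
      hdinner ⟨i, a⟩ ⟨j, p i j a⟩, mul_apply_eq_comp, ← coarseGrain_apply, inner_apply_left_eq_star,
      (IsSelfAdjoint.of_nonneg (coarseGrain_nonneg (hP0 i) _ _)).star_eq]
  have hc' : ∀ i j, 0 < μ i j → 1 - e i j = ∑ a, c i j a (p i j a) := fun i j hij => by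
    rw [he, sub_sub_cancel]
    simp only [hinner]
    rw [sum_re_inner_coarseGrain_left (ρ i) (fun a => P i a ψ) fun a => Q j (p i j a) ψ]
    refine Finset.sum_congr rfl fun a _ => ?_
    rw [hρ i j hij, inner_apply_left_eq_star, (IsSelfAdjoint.of_nonneg (hP0 i a)).star_eq,
      ← mul_apply_eq_comp, ← hc, Complex.ofReal_re]
  have hε : ∑ i, ∑ j, μ i j * e i j ≤ ε := by
    have h1 : ∑ i, ∑ j, μ i j * (1 - e i j) = ∑ i, ∑ j, μ i j * ∑ a, c i j a (p i j a) :=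
      Finset.sum_congr rfl fun i _ => Finset.sum_congr rfl fun j _ => by
        rcases (hμ0 i j).eq_or_lt with h0 | h0
        · rw [← h0, zero_mul, zero_mul]
        · rw [hc' i j h0]
    simp only [mul_sub, mul_one, Finset.sum_sub_distrib, hμ1] at h1
    linarith
  have hL' : ∀ i j, 0 < μ i j → ∑ j', μ i j' ≤ L * μ i j := fun i j hij =>
    (div_le_iff₀ hij).1 (hL.2 ⟨i, j, hij, rfl⟩)
  have hL1 : 1 ≤ L := by
    obtain ⟨i, j, hij, rfl⟩ := hL.1
    rw [one_le_div hij]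
    exact Finset.single_le_sum (fun j _ => hμ0 i j) (Finset.mem_univ j)
  obtain ⟨K, _, _, _, R, S, Ω, r, s, hR, hΩ, hrR, hrp, hr1, hsR, hsp, hs1, hval⟩ :=
    hcyc.exists_tracial_strategy hφ (fun i a => hdN ⟨i, a⟩) hdP0 hdP1 (fun j b => hdM ⟨j, b⟩) hdQ0
      hdQ1 p hμ0 hμ1 (fun i a a' haa => by
        by_cases h1 : coarseGrain (ρ i) (P i) a = 0
        · exact Or.inl (by rw [h1, map_zero])
        by_cases h2 : coarseGrain (ρ i) (P i) a' = 0
        · exact Or.inr (Or.inl (by rw [h2, map_zero]))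
        obtain ⟨x, rfl⟩ := exists_of_coarseGrain_ne_zero h1
        obtain ⟨y, rfl⟩ := exists_of_coarseGrain_ne_zero h2
        exact Or.inr (Or.inr (hρsep i x y haa))) he0 he' hL1 hL' hε
  have hadj : StarAlgebra.adjoin ℂ ({T | ∃ i a, T = r i a} ∪ {T | ∃ j b, T = s j b}) ≤ R := by
    refine StarAlgebra.adjoin_le ?_
    rintro T (⟨i, a, rfl⟩ | ⟨j, b, rfl⟩)
    exacts [hrR i a, hsR j b]
  exact ⟨K, _, _, _, Ω, r, s, fun i j a b => reState Ω (r i a * s j b), hΩ,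
    fun i a => ⟨(hrp i a).isSelfAdjoint, (hrp i a).isIdempotentElem⟩, hr1,
    fun j b => ⟨(hsp j b).isSelfAdjoint, (hsp j b).isIdempotentElem⟩, hs1,
    fun x y hx hy => hR.trace x (hadj hx) y (hadj hy),
    fun i j a b => hR.ofReal_reState_mul (hrR i a) (hsR j b) (hrp i a).isSelfAdjoint
      (hsp j b).isSelfAdjoint, hval⟩
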